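/- Local W^{1,p} bound: for every Λ₀ > 0 and every p with 1 ≤ p < 2 there exist C_p(Λ₀) > 0 and 𝔭₀(Λ₀) > 0 such that, if u satisfies the quasi-minimizer hypotheses with momentum 𝔭 ≥ 𝔭₀(Λ₀) and speed c, then for every X ∈ ℝ²: ∫_{B(X, 𝔭)} |∇u|^p dx ≤ C_p(Λ₀) · 𝔭^{2−p}. -/

import Mathlib

open MeasureTheory Filter Metric

noncomputable section

/-- First partial derivative (direction `x₁`), identifying `ℝ²` with `ℂ`. -/
def pd1 (u : ℂ → ℂ) (z : ℂ) : ℂ := fderiv ℝ u z 1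

/-- Second partial derivative (direction `x₂`). -/
def pd2 (u : ℂ → ℂ) (z : ℂ) : ℂ := fderiv ℝ u z Complex.I

/-- Laplacian `Δu`. -/
def lap (u : ℂ → ℂ) (z : ℂ) : ℂ := fderiv ℝ (pd1 u) z 1 + fderiv ℝ (pd2 u) z Complex.I

/-- `|∇u|²`. -/
def gradSq (u : ℂ → ℂ) (z : ℂ) : ℝ := ‖pd1 u z‖ ^ 2 + ‖pd2 u z‖ ^ 2

/-- Ginzburg–Landau energy density. -/
def energyDensity (u : ℂ → ℂ) (z : ℂ) : ℝ :=
  (1 / 2) * gradSq u z + (1 / 4) * (1 - ‖u z‖ ^ 2) ^ 2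

/-- Ginzburg–Landau energy, valued in `[0,∞]`. -/
def energy (u : ℂ → ℂ) : ENNReal := ∫⁻ z : ℂ, ENNReal.ofReal (energyDensity u z)

/-- `E(u)`, real valued. -/
def Efun (u : ℂ → ℂ) : ℝ := (energy u).toReal

/-- The energy space `ℰ`: (smooth) maps with finite Ginzburg–Landau energy. -/
def memE (u : ℂ → ℂ) : Prop := ContDiff ℝ (⊤ : ℕ∞) u ∧ energy u < ⊤

/-- Momentum density `Re(i ∂₂u (conj u − 1))`. -/
def momDensity (u : ℂ → ℂ) (z : ℂ) : ℝ :=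
  (Complex.I * pd2 u z * ((starRingEnd ℂ) (u z) - 1)).re

/-- Integrability of the momentum density. -/
def momInt (u : ℂ → ℂ) : Prop := Integrable (momDensity u)

/-- The momentum `P₂(u)`. -/
def P2 (u : ℂ → ℂ) : ℝ := (1 / 2) * ∫ z : ℂ, momDensity u z

/-- `(TW_c)(u) = 0`: the travelling wave equation `−ic∂₂u − Δu − (1−|u|²)u = 0`. -/
def TW (c : ℝ) (u : ℂ → ℂ) : Prop :=
  ∀ z : ℂ, -(Complex.I * (c : ℂ) * pd2 u z) - lap u z - ((1 - ‖u z‖ ^ 2 : ℝ) : ℂ) * u z = 0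

/-- `E_min(p)`. -/
def Emin (p : ℝ) : ℝ := sInf (Efun '' {u : ℂ → ℂ | memE u ∧ P2 u = p})

/-- Evenness in `x₁`: `u(−x₁, x₂) = u(x₁, x₂)`. -/
def evenX1 (u : ℂ → ℂ) : Prop := ∀ z : ℂ, u (-((starRingEnd ℂ) z)) = u z

/-- Quasi-minimizer hypotheses (with symmetry), momentum `p` and speed `c`. -/
def QuasiMin (Λ₀ : ℝ) (u : ℂ → ℂ) (p c : ℝ) : Prop :=
  memE u ∧ evenX1 u ∧ 0 < c ∧ TW c u ∧ momInt u ∧ P2 u = p ∧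
  Efun u ≤ 2 * Real.pi * Real.log p + Λ₀

/-- `V1` is the degree-one vortex with (increasing) modulus profile `ρ`. -/
def IsVortex (V1 : ℂ → ℂ) (ρ : ℝ → ℝ) : Prop :=
  ContDiff ℝ (⊤ : ℕ∞) V1 ∧
  (∀ z : ℂ, lap V1 z + V1 z * ((1 - ‖V1 z‖ ^ 2 : ℝ) : ℂ) = 0) ∧
  V1 0 = 0 ∧
  (∀ z : ℂ, z ≠ 0 → V1 z = ((ρ ‖z‖ : ℝ) : ℂ) * (z / (‖z‖ : ℂ))) ∧
  ρ 0 = 0 ∧ StrictMonoOn ρ (Set.Ici 0) ∧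
  (∀ r : ℝ, 0 ≤ r → 0 ≤ ρ r ∧ ρ r < 1) ∧
  Filter.Tendsto ρ Filter.atTop (nhds 1)

/-! ### Directional derivatives of real functions on the plane -/

/-- Derivative of a real function in direction `x₁`. -/
def dX (f : ℂ → ℝ) (z : ℂ) : ℝ := fderiv ℝ f z 1

/-- Derivative of a real function in direction `x₂`. -/
def dY (f : ℂ → ℝ) (z : ℂ) : ℝ := fderiv ℝ f z Complex.I

theorem ContDiff.differentiableAt_infty {E : Type*} [NormedAddCommGroup E] [NormedSpace ℝ E]
    {F : Type*} [NormedAddCommGroup F] [NormedSpace ℝ F]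
    {f : E → F} (hf : ContDiff ℝ (⊤ : ℕ∞) f) (z : E) : DifferentiableAt ℝ f z :=
  (hf.differentiable (by simp)).differentiableAt

theorem ContDiff.fderiv_apply_const {E : Type*} [NormedAddCommGroup E] [NormedSpace ℝ E]
    {F : Type*} [NormedAddCommGroup F] [NormedSpace ℝ F]
    {f : E → F} (hf : ContDiff ℝ (⊤ : ℕ∞) f) (v : E) :
    ContDiff ℝ (⊤ : ℕ∞) (fun z => fderiv ℝ f z v) :=
  (hf.fderiv_right (by simp)).clm_apply contDiff_const

@[fun_prop]
theorem contDiff_dX {f : ℂ → ℝ} (hf : ContDiff ℝ (⊤ : ℕ∞) f) :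
    ContDiff ℝ (⊤ : ℕ∞) (dX f) := hf.fderiv_apply_const 1

@[fun_prop]
theorem contDiff_dY {f : ℂ → ℝ} (hf : ContDiff ℝ (⊤ : ℕ∞) f) :
    ContDiff ℝ (⊤ : ℕ∞) (dY f) := hf.fderiv_apply_const Complex.I

theorem dX_eq_of_hasFDerivAt {f : ℂ → ℝ} {z : ℂ} {L : ℂ →L[ℝ] ℝ} (h : HasFDerivAt f L z) :
    dX f z = L 1 := by rw [dX, h.fderiv]

theorem dY_eq_of_hasFDerivAt {f : ℂ → ℝ} {z : ℂ} {L : ℂ →L[ℝ] ℝ} (h : HasFDerivAt f L z) :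
    dY f z = L Complex.I := by rw [dY, h.fderiv]

theorem dX_add {f g : ℂ → ℝ} (hf : ContDiff ℝ (⊤ : ℕ∞) f) (hg : ContDiff ℝ (⊤ : ℕ∞) g) (z : ℂ) :
    dX (fun w => f w + g w) z = dX f z + dX g z :=
  dX_eq_of_hasFDerivAt ((hf.differentiableAt_infty z).hasFDerivAt.add
    (hg.differentiableAt_infty z).hasFDerivAt)

theorem dX_sub {f g : ℂ → ℝ} (hf : ContDiff ℝ (⊤ : ℕ∞) f) (hg : ContDiff ℝ (⊤ : ℕ∞) g) (z : ℂ) :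
    dX (fun w => f w - g w) z = dX f z - dX g z :=
  dX_eq_of_hasFDerivAt ((hf.differentiableAt_infty z).hasFDerivAt.sub
    (hg.differentiableAt_infty z).hasFDerivAt)

theorem dX_mul {f g : ℂ → ℝ} (hf : ContDiff ℝ (⊤ : ℕ∞) f) (hg : ContDiff ℝ (⊤ : ℕ∞) g) (z : ℂ) :
    dX (fun w => f w * g w) z = dX f z * g z + f z * dX g z := by
  have h : dX (fun w => f w * g w) z = _ :=
    dX_eq_of_hasFDerivAt ((hf.differentiableAt_infty z).hasFDerivAt.mul
      (hg.differentiableAt_infty z).hasFDerivAt)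
  rw [h]
  simp [dX]
  ring

theorem dX_comp {φ : ℝ → ℝ} {f : ℂ → ℝ} (hφ : ContDiff ℝ (⊤ : ℕ∞) φ)
    (hf : ContDiff ℝ (⊤ : ℕ∞) f) (z : ℂ) :
    dX (fun w => φ (f w)) z = deriv φ (f z) * dX f z := by
  have h : dX (fun w => φ (f w)) z = _ :=
    dX_eq_of_hasFDerivAt (((hφ.differentiableAt_infty (f z)).hasDerivAt).comp_hasFDerivAt z
      (hf.differentiableAt_infty z).hasFDerivAt)
  rw [h]
  simp [dX]

@[simp]
theorem dX_const (k : ℝ) (z : ℂ) : dX (fun _ => k) z = 0 := by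
  simp [dX]

theorem dX_const_mul (k : ℝ) {f : ℂ → ℝ} (hf : ContDiff ℝ (⊤ : ℕ∞) f) (z : ℂ) :
    dX (fun w => k * f w) z = k * dX f z := by
  rw [dX_mul contDiff_const hf]
  simp

theorem dX_sq {f : ℂ → ℝ} (hf : ContDiff ℝ (⊤ : ℕ∞) f) (z : ℂ) :
    dX (fun w => f w ^ 2) z = 2 * f z * dX f z := by
  simp only [sq]
  rw [dX_mul hf hf]
  ring

@[simp]
theorem dX_re (z : ℂ) : dX (fun w => w.re) z = 1 := by
  have h : dX (fun w => w.re) z = _ :=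
    dX_eq_of_hasFDerivAt Complex.reCLM.hasFDerivAt
  rw [h]
  simp

@[simp]
theorem dX_im (z : ℂ) : dX (fun w => w.im) z = 0 := by
  have h : dX (fun w => w.im) z = _ :=
    dX_eq_of_hasFDerivAt Complex.imCLM.hasFDerivAt
  rw [h]
  simp

theorem dX_comp_add_right (f : ℂ → ℝ) (v z : ℂ) :
    dX (fun w => f (w + v)) z = dX f (z + v) := by
  simp only [dX]
  rw [fderiv_comp_add_right]

theorem dY_add {f g : ℂ → ℝ} (hf : ContDiff ℝ (⊤ : ℕ∞) f) (hg : ContDiff ℝ (⊤ : ℕ∞) g) (z : ℂ) :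
    dY (fun w => f w + g w) z = dY f z + dY g z :=
  dY_eq_of_hasFDerivAt ((hf.differentiableAt_infty z).hasFDerivAt.add
    (hg.differentiableAt_infty z).hasFDerivAt)

theorem dY_sub {f g : ℂ → ℝ} (hf : ContDiff ℝ (⊤ : ℕ∞) f) (hg : ContDiff ℝ (⊤ : ℕ∞) g) (z : ℂ) :
    dY (fun w => f w - g w) z = dY f z - dY g z :=
  dY_eq_of_hasFDerivAt ((hf.differentiableAt_infty z).hasFDerivAt.sub
    (hg.differentiableAt_infty z).hasFDerivAt)

theorem dY_mul {f g : ℂ → ℝ} (hf : ContDiff ℝ (⊤ : ℕ∞) f) (hg : ContDiff ℝ (⊤ : ℕ∞) g) (z : ℂ) :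
    dY (fun w => f w * g w) z = dY f z * g z + f z * dY g z := by
  have h : dY (fun w => f w * g w) z = _ :=
    dY_eq_of_hasFDerivAt ((hf.differentiableAt_infty z).hasFDerivAt.mul
      (hg.differentiableAt_infty z).hasFDerivAt)
  rw [h]
  simp [dY]
  ring

theorem dY_comp {φ : ℝ → ℝ} {f : ℂ → ℝ} (hφ : ContDiff ℝ (⊤ : ℕ∞) φ)
    (hf : ContDiff ℝ (⊤ : ℕ∞) f) (z : ℂ) :
    dY (fun w => φ (f w)) z = deriv φ (f z) * dY f z := by
  have h : dY (fun w => φ (f w)) z = _ :=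
    dY_eq_of_hasFDerivAt (((hφ.differentiableAt_infty (f z)).hasDerivAt).comp_hasFDerivAt z
      (hf.differentiableAt_infty z).hasFDerivAt)
  rw [h]
  simp [dY]

@[simp]
theorem dY_const (k : ℝ) (z : ℂ) : dY (fun _ => k) z = 0 := by
  simp [dY]

theorem dY_const_mul (k : ℝ) {f : ℂ → ℝ} (hf : ContDiff ℝ (⊤ : ℕ∞) f) (z : ℂ) :
    dY (fun w => k * f w) z = k * dY f z := by
  rw [dY_mul contDiff_const hf]
  simp

theorem dY_sq {f : ℂ → ℝ} (hf : ContDiff ℝ (⊤ : ℕ∞) f) (z : ℂ) :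
    dY (fun w => f w ^ 2) z = 2 * f z * dY f z := by
  simp only [sq]
  rw [dY_mul hf hf]
  ring

@[simp]
theorem dY_re (z : ℂ) : dY (fun w => w.re) z = 0 := by
  have h : dY (fun w => w.re) z = _ :=
    dY_eq_of_hasFDerivAt Complex.reCLM.hasFDerivAt
  rw [h]
  simp

@[simp]
theorem dY_im (z : ℂ) : dY (fun w => w.im) z = 1 := by
  have h : dY (fun w => w.im) z = _ :=
    dY_eq_of_hasFDerivAt Complex.imCLM.hasFDerivAt
  rw [h]
  simp

theorem dY_comp_add_right (f : ℂ → ℝ) (v z : ℂ) :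
    dY (fun w => f (w + v)) z = dY f (z + v) := by
  simp only [dY]
  rw [fderiv_comp_add_right]

@[fun_prop]
theorem contDiff_complex_re : ContDiff ℝ (⊤ : ℕ∞) (fun w : ℂ => w.re) := Complex.reCLM.contDiff

@[fun_prop]
theorem contDiff_complex_im : ContDiff ℝ (⊤ : ℕ∞) (fun w : ℂ => w.im) := Complex.imCLM.contDiff

theorem dX_dY_comm {f : ℂ → ℝ} (hf : ContDiff ℝ (⊤ : ℕ∞) f) (z : ℂ) :
    dX (dY f) z = dY (dX f) z := by
  have h : IsSymmSndFDerivAt ℝ f z :=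
    hf.contDiffAt.isSymmSndFDerivAt (by simpa using WithTop.coe_le_coe.2 (le_top : (2 : ℕ∞) ≤ ⊤))
  have hd : DifferentiableAt ℝ (fderiv ℝ f) z :=
    (hf.fderiv_right (m := (⊤ : ℕ∞)) (by simp)).differentiableAt_infty z
  have e : ∀ v w : ℂ, fderiv ℝ (fun y => fderiv ℝ f y v) z w = fderiv ℝ (fderiv ℝ f) z w v := by
    intro v w
    rw [fderiv_clm_apply hd (differentiableAt_const v)]
    simp
  change fderiv ℝ (fun y => fderiv ℝ f y Complex.I) z 1 =
    fderiv ℝ (fun y => fderiv ℝ f y 1) z Complex.I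
  rw [e, e]
  exact h.eq 1 Complex.I

theorem fderiv_real_apply (f : ℂ → ℝ) (z v : ℂ) :
    fderiv ℝ f z v = v.re * dX f z + v.im * dY f z := by
  have : v = v.re • (1 : ℂ) + v.im • Complex.I := by
    simp [Complex.re_add_im]
  conv_lhs => rw [this]
  rw [map_add, map_smul, map_smul]
  rfl

/-! ### Integration of divergences -/

theorem HasCompactSupport.dX {f : ℂ → ℝ} (hf : HasCompactSupport f) :
    HasCompactSupport (dX f) := hf.fderiv_apply ℝ 1

theorem HasCompactSupport.dY {f : ℂ → ℝ} (hf : HasCompactSupport f) :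
    HasCompactSupport (dY f) := hf.fderiv_apply ℝ Complex.I

theorem integral_fderiv_apply_eq_zero {F : Type*} [NormedAddCommGroup F] [NormedSpace ℝ F]
    {f : ℂ → F} (hf : ContDiff ℝ (⊤ : ℕ∞) f)
    (hc : HasCompactSupport f) (v : ℂ) : ∫ z, fderiv ℝ f z v = 0 := by
  have h1 : Integrable f := hf.continuous.integrable_of_hasCompactSupport hc
  have h2 : Integrable (fun z => fderiv ℝ f z v) :=
    (hf.fderiv_apply_const v).continuous.integrable_of_hasCompactSupport (hc.fderiv_apply ℝ v)
  have h := integral_smul_fderiv_eq_neg_fderiv_smul_of_integrable (μ := (volume : Measure ℂ))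
    (f := fun _ : ℂ => (1 : ℝ)) (g := f) (v := v) (by simp) (by simpa using h2)
    (by simpa using h1) (fun x _ => by fun_prop) (fun x _ => hf.differentiableAt_infty x)
  simpa using h

/-- An integrable function dominated by another one up to a compactly supported divergence. -/
theorem integral_le_of_le_add_div {P Q F G : ℂ → ℝ} (hP : Integrable P) (hQ : Integrable Q)
    (hF : ContDiff ℝ (⊤ : ℕ∞) F) (hG : ContDiff ℝ (⊤ : ℕ∞) G)
    (hFc : HasCompactSupport F) (hGc : HasCompactSupport G)
    (h : ∀ z, P z ≤ Q z + (dX F z + dY G z)) : ∫ z, P z ≤ ∫ z, Q z := by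
  have iF : Integrable (dX F) :=
    (contDiff_dX hF).continuous.integrable_of_hasCompactSupport hFc.dX
  have iG : Integrable (dY G) :=
    (contDiff_dY hG).continuous.integrable_of_hasCompactSupport hGc.dY
  have e : ∫ z, (Q z + (dX F z + dY G z)) = ∫ z, Q z := by
    have h0 : ∫ z, (Q z + (dX F z + dY G z)) = (∫ z, Q z) + ∫ z, (dX F z + dY G z) :=
      integral_add hQ (iF.add iG)
    rw [h0, integral_add iF iG]
    have h1 : ∫ z, dX F z = 0 := integral_fderiv_apply_eq_zero hF hFc 1
    have h2 : ∫ z, dY G z = 0 := integral_fderiv_apply_eq_zero hG hGc Complex.I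
    rw [h1, h2]
    ring
  rw [← e]
  exact integral_mono hP (hQ.add (iF.add iG)) h

theorem integral_eq_of_eq_add_div {P Q F G : ℂ → ℝ} (hP : Integrable P) (hQ : Integrable Q)
    (hF : ContDiff ℝ (⊤ : ℕ∞) F) (hG : ContDiff ℝ (⊤ : ℕ∞) G)
    (hFc : HasCompactSupport F) (hGc : HasCompactSupport G)
    (h : ∀ z, P z = Q z + (dX F z + dY G z)) : ∫ z, P z = ∫ z, Q z := by
  refine le_antisymm (integral_le_of_le_add_div hP hQ hF hG hFc hGc fun z => (h z).le) ?_
  have hF' : ContDiff ℝ (⊤ : ℕ∞) (fun z => (-1) * F z) := by fun_prop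
  have hG' : ContDiff ℝ (⊤ : ℕ∞) (fun z => (-1) * G z) := by fun_prop
  refine integral_le_of_le_add_div hQ hP hF' hG' hFc.mul_left hGc.mul_left fun z => ?_
  rw [h z, dX_const_mul _ hF, dY_const_mul _ hG]
  linarith

/-! ### Cutoff functions -/

/-- Smooth cutoff profile, equal to `1` on `(-∞, 1]` and to `0` on `[2, ∞)`. -/
def cutProfile (t : ℝ) : ℝ := Real.smoothTransition (2 - t)

@[fun_prop]
theorem contDiff_cutProfile : ContDiff ℝ (⊤ : ℕ∞) cutProfile :=
  Real.smoothTransition.contDiff.comp (contDiff_const.sub contDiff_id)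

theorem cutProfile_nonneg (t : ℝ) : 0 ≤ cutProfile t := Real.smoothTransition.nonneg _

theorem cutProfile_le_one (t : ℝ) : cutProfile t ≤ 1 := Real.smoothTransition.le_one _

theorem cutProfile_eq_one {t : ℝ} (h : t ≤ 1) : cutProfile t = 1 :=
  Real.smoothTransition.one_of_one_le (by linarith)

theorem cutProfile_eq_zero {t : ℝ} (h : 2 ≤ t) : cutProfile t = 0 :=
  Real.smoothTransition.zero_of_nonpos (by linarith)

theorem deriv_cutProfile_of_lt {t : ℝ} (h : t < 1) : deriv cutProfile t = 0 := by
  have : cutProfile =ᶠ[nhds t] fun _ => 1 := by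
    filter_upwards [Iio_mem_nhds h] with s hs using cutProfile_eq_one (le_of_lt hs)
  rw [this.deriv_eq]
  simp

theorem deriv_cutProfile_of_gt {t : ℝ} (h : 2 < t) : deriv cutProfile t = 0 := by
  have : cutProfile =ᶠ[nhds t] fun _ => 0 := by
    filter_upwards [Ioi_mem_nhds h] with s hs using cutProfile_eq_zero (le_of_lt hs)
  rw [this.deriv_eq]
  simp

theorem exists_bound_deriv_cutProfile : ∃ K : ℝ, 1 ≤ K ∧ ∀ t, |deriv cutProfile t| ≤ K := by
  have hc : Continuous (deriv cutProfile) :=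
    contDiff_cutProfile.continuous_deriv (by simp)
  obtain ⟨K, hK⟩ := (isCompact_Icc (a := (1 : ℝ)) (b := 2)).exists_bound_of_continuousOn
    hc.continuousOn
  refine ⟨max K 1, le_max_right _ _, fun t => ?_⟩
  rcases lt_or_ge t 1 with h | h
  · rw [deriv_cutProfile_of_lt h]
    simp
  rcases lt_or_ge 2 t with h' | h'
  · rw [deriv_cutProfile_of_gt h']
    simp
  exact (hK t ⟨h, h'⟩).trans (le_max_left _ _)

/-- An upper bound of the derivative of `cutProfile`. -/
def cutConst : ℝ := exists_bound_deriv_cutProfile.choose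

theorem one_le_cutConst : 1 ≤ cutConst := exists_bound_deriv_cutProfile.choose_spec.1

theorem abs_deriv_cutProfile_le (t : ℝ) : |deriv cutProfile t| ≤ cutConst :=
  exists_bound_deriv_cutProfile.choose_spec.2 t

theorem HasCompactSupport.of_eq_zero_of_lt {E : Type*} [Zero E] {f : ℂ → E} (R : ℝ)
    (h : ∀ z, R < ‖z‖ → f z = 0) : HasCompactSupport f :=
  HasCompactSupport.intro (isCompact_closedBall 0 R) fun z hz => h z (by simpa using hz)

theorem norm_sq_eq_re_im (z : ℂ) : ‖z‖ ^ 2 = z.re ^ 2 + z.im ^ 2 := by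
  rw [Complex.sq_norm, Complex.normSq_apply]
  ring

/-- Radial cutoff function at scale `R`. -/
def cutoff (R : ℝ) (z : ℂ) : ℝ := cutProfile ((z.re ^ 2 + z.im ^ 2) / R ^ 2)

@[fun_prop]
theorem contDiff_cutoff (R : ℝ) : ContDiff ℝ (⊤ : ℕ∞) (cutoff R) := by
  unfold cutoff
  fun_prop

theorem cutoff_nonneg (R : ℝ) (z : ℂ) : 0 ≤ cutoff R z := cutProfile_nonneg _

theorem cutoff_le_one (R : ℝ) (z : ℂ) : cutoff R z ≤ 1 := cutProfile_le_one _

theorem cutoff_eq_one {R : ℝ} (hR : 0 < R) {z : ℂ} (h : ‖z‖ ≤ R) : cutoff R z = 1 := by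
  apply cutProfile_eq_one
  rw [← norm_sq_eq_re_im, div_le_one (by positivity)]
  gcongr

theorem cutoff_eq_zero {R : ℝ} (hR : 0 < R) {z : ℂ} (h : 2 * R ≤ ‖z‖) : cutoff R z = 0 := by
  apply cutProfile_eq_zero
  rw [← norm_sq_eq_re_im, le_div_iff₀ (by positivity)]
  nlinarith

theorem hasCompactSupport_cutoff {R : ℝ} (hR : 0 < R) : HasCompactSupport (cutoff R) :=
  HasCompactSupport.of_eq_zero_of_lt (2 * R) fun _ hz => cutoff_eq_zero hR hz.le

theorem dX_cutoff (R : ℝ) (z : ℂ) : dX (cutoff R) z =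
    deriv cutProfile ((z.re ^ 2 + z.im ^ 2) / R ^ 2) * (2 * z.re / R ^ 2) := by
  have h : dX (cutoff R) z = _ := dX_comp (φ := cutProfile)
    (f := fun z => (z.re ^ 2 + z.im ^ 2) / R ^ 2) (by fun_prop) (by fun_prop) z
  rw [h]
  simp (disch := fun_prop) only [div_eq_mul_inv, dX_mul, dX_add, dX_sq, dX_re, dX_im, dX_const]
  ring

theorem dY_cutoff (R : ℝ) (z : ℂ) : dY (cutoff R) z =
    deriv cutProfile ((z.re ^ 2 + z.im ^ 2) / R ^ 2) * (2 * z.im / R ^ 2) := by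
  have h : dY (cutoff R) z = _ := dY_comp (φ := cutProfile)
    (f := fun z => (z.re ^ 2 + z.im ^ 2) / R ^ 2) (by fun_prop) (by fun_prop) z
  rw [h]
  simp (disch := fun_prop) only [div_eq_mul_inv, dY_mul, dY_add, dY_sq, dY_re, dY_im, dY_const]
  ring

theorem gradient_cutoff_bound {R : ℝ} (hR : 0 < R) (z : ℂ) :
    dX (cutoff R) z ^ 2 + dY (cutoff R) z ^ 2 ≤ (4 * cutConst / R) ^ 2 := by
  have hr := norm_sq_eq_re_im z
  have e : dX (cutoff R) z ^ 2 + dY (cutoff R) z ^ 2 =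
      (deriv cutProfile (‖z‖ ^ 2 / R ^ 2)) ^ 2 * (4 * ‖z‖ ^ 2 / R ^ 4) := by
    rw [dX_cutoff, dY_cutoff, hr]
    ring
  rw [e]
  have hK := one_le_cutConst
  rcases lt_or_ge (2 * R) ‖z‖ with h | h
  · rw [deriv_cutProfile_of_gt]
    · simp
      positivity
    · rw [lt_div_iff₀ (by positivity)]
      nlinarith
  · have h1 : deriv cutProfile (‖z‖ ^ 2 / R ^ 2) ^ 2 ≤ cutConst ^ 2 := by
      rw [← sq_abs]
      gcongr
      exact abs_deriv_cutProfile_le _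
    have h2 : 4 * ‖z‖ ^ 2 / R ^ 4 ≤ 16 / R ^ 2 := by
      rw [div_le_div_iff₀ (by positivity) (by positivity)]
      have : ‖z‖ ^ 2 ≤ (2 * R) ^ 2 := by gcongr
      nlinarith [pow_pos hR 2]
    calc _ ≤ cutConst ^ 2 * (16 / R ^ 2) := by gcongr
      _ = _ := by ring

theorem gradient_cutoff_eq_zero {R : ℝ} (hR : 0 < R) {z : ℂ} (h : ‖z‖ < R) :
    dX (cutoff R) z = 0 ∧ dY (cutoff R) z = 0 := by
  have : deriv cutProfile ((z.re ^ 2 + z.im ^ 2) / R ^ 2) = 0 := by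
    apply deriv_cutProfile_of_lt
    rw [← norm_sq_eq_re_im, div_lt_one (by positivity)]
    gcongr
  rw [dX_cutoff, dY_cutoff, this]
  simp

theorem gradient_cutoff_eq_zero_of_gt {R : ℝ} (hR : 0 < R) {z : ℂ} (h : 2 * R < ‖z‖) :
    dX (cutoff R) z = 0 ∧ dY (cutoff R) z = 0 := by
  have : deriv cutProfile ((z.re ^ 2 + z.im ^ 2) / R ^ 2) = 0 := by
    apply deriv_cutProfile_of_gt
    rw [← norm_sq_eq_re_im, lt_div_iff₀ (by positivity)]
    nlinarith
  rw [dX_cutoff, dY_cutoff, this]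
  simp

/-! ### Travelling waves in real coordinates -/

/-- Squared modulus of `a + i b`. -/
def msq (a b : ℂ → ℝ) (z : ℂ) : ℝ := a z ^ 2 + b z ^ 2

/-- Squared gradient of `a + i b`. -/
def gsq (a b : ℂ → ℝ) (z : ℂ) : ℝ := dX a z ^ 2 + dY a z ^ 2 + dX b z ^ 2 + dY b z ^ 2

/-- First component of the current of `a + i b`. -/
def curX (a b : ℂ → ℝ) (z : ℂ) : ℝ := a z * dX b z - b z * dX a z

/-- Second component of the current of `a + i b`. -/
def curY (a b : ℂ → ℝ) (z : ℂ) : ℝ := a z * dY b z - b z * dY a z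

/-- `a + i b` is a finite energy travelling wave of speed `c`. -/
structure IsWave (a b : ℂ → ℝ) (c : ℝ) : Prop where
  smooth_re : ContDiff ℝ (⊤ : ℕ∞) a
  smooth_im : ContDiff ℝ (⊤ : ℕ∞) b
  eq_re : ∀ z, dX (dX a) z + dY (dY a) z = c * dY b z - (1 - msq a b z) * a z
  eq_im : ∀ z, dX (dX b) z + dY (dY b) z = -(c * dY a z) - (1 - msq a b z) * b z
  integrable_gsq : Integrable (gsq a b)
  integrable_pot : Integrable (fun z => (1 - msq a b z) ^ 2)

section smoothness

variable {a b : ℂ → ℝ}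

@[fun_prop]
theorem contDiff_msq (ha : ContDiff ℝ (⊤ : ℕ∞) a) (hb : ContDiff ℝ (⊤ : ℕ∞) b) :
    ContDiff ℝ (⊤ : ℕ∞) (msq a b) := by
  unfold msq
  fun_prop

@[fun_prop]
theorem contDiff_gsq (ha : ContDiff ℝ (⊤ : ℕ∞) a) (hb : ContDiff ℝ (⊤ : ℕ∞) b) :
    ContDiff ℝ (⊤ : ℕ∞) (gsq a b) := by
  unfold gsq
  fun_prop

@[fun_prop]
theorem contDiff_curX (ha : ContDiff ℝ (⊤ : ℕ∞) a) (hb : ContDiff ℝ (⊤ : ℕ∞) b) :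
    ContDiff ℝ (⊤ : ℕ∞) (curX a b) := by
  unfold curX
  fun_prop

@[fun_prop]
theorem contDiff_curY (ha : ContDiff ℝ (⊤ : ℕ∞) a) (hb : ContDiff ℝ (⊤ : ℕ∞) b) :
    ContDiff ℝ (⊤ : ℕ∞) (curY a b) := by
  unfold curY
  fun_prop

theorem gsq_nonneg (z : ℂ) : 0 ≤ gsq a b z := by
  unfold gsq
  positivity

theorem msq_nonneg (z : ℂ) : 0 ≤ msq a b z := by
  unfold msq
  positivity

theorem dX_msq (ha : ContDiff ℝ (⊤ : ℕ∞) a) (hb : ContDiff ℝ (⊤ : ℕ∞) b) (z : ℂ) :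
    dX (msq a b) z = 2 * (a z * dX a z + b z * dX b z) := by
  have h : dX (msq a b) z = _ := dX_add (f := fun z => a z ^ 2) (g := fun z => b z ^ 2)
    (by fun_prop) (by fun_prop) z
  rw [h, dX_sq ha, dX_sq hb]
  ring

theorem dY_msq (ha : ContDiff ℝ (⊤ : ℕ∞) a) (hb : ContDiff ℝ (⊤ : ℕ∞) b) (z : ℂ) :
    dY (msq a b) z = 2 * (a z * dY a z + b z * dY b z) := by
  have h : dY (msq a b) z = _ := dY_add (f := fun z => a z ^ 2) (g := fun z => b z ^ 2)
    (by fun_prop) (by fun_prop) z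
  rw [h, dY_sq ha, dY_sq hb]
  ring

theorem gradient_msq_sq_le (ha : ContDiff ℝ (⊤ : ℕ∞) a) (hb : ContDiff ℝ (⊤ : ℕ∞) b) (z : ℂ) :
    dX (msq a b) z ^ 2 + dY (msq a b) z ^ 2 ≤ 4 * msq a b z * gsq a b z := by
  rw [dX_msq ha hb, dY_msq ha hb, msq, gsq]
  nlinarith [sq_nonneg (a z * dX b z - b z * dX a z), sq_nonneg (a z * dY b z - b z * dY a z)]

theorem current_sq_le (z : ℂ) :
    curX a b z ^ 2 + curY a b z ^ 2 ≤ msq a b z * gsq a b z := by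
  rw [curX, curY, msq, gsq]
  nlinarith [sq_nonneg (a z * dX a z + b z * dX b z), sq_nonneg (a z * dY a z + b z * dY b z)]

/-- The gradient decomposes into the gradient of the modulus and the current. -/
theorem msq_mul_gsq (ha : ContDiff ℝ (⊤ : ℕ∞) a) (hb : ContDiff ℝ (⊤ : ℕ∞) b) (z : ℂ) :
    msq a b z * gsq a b z = (dX (msq a b) z ^ 2 + dY (msq a b) z ^ 2) / 4 +
      (curX a b z ^ 2 + curY a b z ^ 2) := by
  rw [dX_msq ha hb, dY_msq ha hb, curX, curY, msq, gsq]
  ring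

end smoothness

theorem IsWave.laplacian_msq {a b : ℂ → ℝ} {c : ℝ} (h : IsWave a b c) (z : ℂ) :
    dX (dX (msq a b)) z + dY (dY (msq a b)) z =
      2 * (gsq a b z + c * curY a b z - (1 - msq a b z) * msq a b z) := by
  have ha := h.smooth_re
  have hb := h.smooth_im
  have e1 : dX (msq a b) = fun z => 2 * (a z * dX a z + b z * dX b z) :=
    funext (dX_msq ha hb)
  have e2 : dY (msq a b) = fun z => 2 * (a z * dY a z + b z * dY b z) :=
    funext (dY_msq ha hb)
  have h1 := h.eq_re z
  have h2 := h.eq_im z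
  rw [e1, e2]
  simp (disch := fun_prop) only [dX_mul, dX_add, dX_const, dY_mul, dY_add, dY_const]
  rw [gsq, curY]
  rw [msq] at h1 h2 ⊢
  linear_combination (2 * a z) * h1 + (2 * b z) * h2

theorem IsWave.div_current {a b : ℂ → ℝ} {c : ℝ} (h : IsWave a b c) (z : ℂ) :
    dX (curX a b) z + dY (curY a b) z = - (c / 2) * dY (msq a b) z := by
  have ha := h.smooth_re
  have hb := h.smooth_im
  have h1 := h.eq_re z
  have h2 := h.eq_im z
  have e1 : curX a b = fun z => a z * dX b z - b z * dX a z := rfl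
  have e2 : curY a b = fun z => a z * dY b z - b z * dY a z := rfl
  rw [e1, e2, dY_msq ha hb]
  simp (disch := fun_prop) only [dX_mul, dX_sub, dY_mul, dY_sub]
  linear_combination (a z) * h2 - (b z) * h1

/-! ### The stress tensor -/

/-- First diagonal component of the stress tensor. -/
def stressXX (a b : ℂ → ℝ) (z : ℂ) : ℝ :=
  (1 / 2) * (dX a z ^ 2 + dX b z ^ 2 - dY a z ^ 2 - dY b z ^ 2) - (1 / 4) * (1 - msq a b z) ^ 2

/-- Second diagonal component of the stress tensor. -/
def stressYY (a b : ℂ → ℝ) (z : ℂ) : ℝ :=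
  (1 / 2) * (dY a z ^ 2 + dY b z ^ 2 - dX a z ^ 2 - dX b z ^ 2) - (1 / 4) * (1 - msq a b z) ^ 2

/-- Off-diagonal component of the stress tensor. -/
def stressXY (a b : ℂ → ℝ) (z : ℂ) : ℝ := dX a z * dY a z + dX b z * dY b z

/-- Jacobian determinant of `a + i b`. -/
def jac (a b : ℂ → ℝ) (z : ℂ) : ℝ := dX a z * dY b z - dY a z * dX b z

section

variable {a b : ℂ → ℝ}

@[fun_prop]
theorem contDiff_stressXX (ha : ContDiff ℝ (⊤ : ℕ∞) a) (hb : ContDiff ℝ (⊤ : ℕ∞) b) :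
    ContDiff ℝ (⊤ : ℕ∞) (stressXX a b) := by
  unfold stressXX
  fun_prop

@[fun_prop]
theorem contDiff_stressYY (ha : ContDiff ℝ (⊤ : ℕ∞) a) (hb : ContDiff ℝ (⊤ : ℕ∞) b) :
    ContDiff ℝ (⊤ : ℕ∞) (stressYY a b) := by
  unfold stressYY
  fun_prop

@[fun_prop]
theorem contDiff_stressXY (ha : ContDiff ℝ (⊤ : ℕ∞) a) (hb : ContDiff ℝ (⊤ : ℕ∞) b) :
    ContDiff ℝ (⊤ : ℕ∞) (stressXY a b) := by
  unfold stressXY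
  fun_prop

end

theorem IsWave.div_stress_fst {a b : ℂ → ℝ} {c : ℝ} (h : IsWave a b c) (z : ℂ) :
    dX (stressXX a b) z + dY (stressXY a b) z = c * jac a b z := by
  have ha := h.smooth_re
  have hb := h.smooth_im
  have e1 : stressXX a b = fun z => (1 / 2) * (dX a z ^ 2 + dX b z ^ 2 - dY a z ^ 2 - dY b z ^ 2)
    - (1 / 4) * (1 - msq a b z) ^ 2 := rfl
  have e2 : stressXY a b = fun z => dX a z * dY a z + dX b z * dY b z := rfl
  have h1 := h.eq_re z
  have h2 := h.eq_im z
  rw [e1, e2]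
  simp (disch := fun_prop) only [dX_mul, dX_add, dX_sub, dX_sq, dX_const, dX_msq,
    dY_mul, dY_add, dX_dY_comm, jac]
  linear_combination (dX a z) * h1 + (dX b z) * h2

theorem IsWave.div_stress_snd {a b : ℂ → ℝ} {c : ℝ} (h : IsWave a b c) (z : ℂ) :
    dX (stressXY a b) z + dY (stressYY a b) z = 0 := by
  have ha := h.smooth_re
  have hb := h.smooth_im
  have e1 : stressYY a b = fun z => (1 / 2) * (dY a z ^ 2 + dY b z ^ 2 - dX a z ^ 2 - dX b z ^ 2)
    - (1 / 4) * (1 - msq a b z) ^ 2 := rfl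
  have e2 : stressXY a b = fun z => dX a z * dY a z + dX b z * dY b z := rfl
  have h1 := h.eq_re z
  have h2 := h.eq_im z
  rw [e1, e2]
  simp (disch := fun_prop) only [dX_mul, dX_add, dY_sq, dY_sub, dY_const, dY_msq,
    dY_mul, dY_add, dX_dY_comm]
  linear_combination (dY a z) * h1 + (dY b z) * h2

/-! ### The global Pohozaev identity -/

/-- The rectangle `[-r, r] × [-s, s]`. -/
def rect (r s : ℝ) : Set ℂ := {z | |z.re| ≤ r ∧ |z.im| ≤ s}

theorem measurableSet_rect (r s : ℝ) : MeasurableSet (rect r s) := by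
  exact ((isClosed_le Complex.continuous_re.abs continuous_const).inter
    (isClosed_le Complex.continuous_im.abs continuous_const)).measurableSet

theorem volume_rect {r s : ℝ} (hr : 0 ≤ r) :
    volume (rect r s) = ENNReal.ofReal (4 * r * s) := by
  have h : rect r s =
      Complex.measurableEquivRealProd ⁻¹' (Set.Icc (-r) r ×ˢ Set.Icc (-s) s) := by
    ext z
    simp [rect, abs_le, Complex.measurableEquivRealProd]
    tauto
  rw [h, Complex.volume_preserving_equiv_real_prod.measure_preimage
    (measurableSet_Icc.prod measurableSet_Icc).nullMeasurableSet]
  rw [Measure.volume_eq_prod, Measure.prod_prod, Real.volume_Icc, Real.volume_Icc,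
    ← ENNReal.ofReal_mul (by linarith)]
  congr 1
  ring

/-- The function `x₁`, cut off at scale `R` in `x₁` and at scale `S` in `x₂`. -/
def window (R S : ℝ) (z : ℂ) : ℝ :=
  z.re * (cutProfile (z.re ^ 2 / R ^ 2) * cutProfile (z.im ^ 2 / S ^ 2))

@[fun_prop]
theorem contDiff_window (R S : ℝ) : ContDiff ℝ (⊤ : ℕ∞) (window R S) := by
  unfold window
  fun_prop

theorem abs_le_of_sq_div_lt {x R : ℝ} (hR : 0 < R) (h : x ^ 2 / R ^ 2 ≤ 2) : |x| ≤ 2 * R := by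
  rw [div_le_iff₀ (by positivity)] at h
  apply abs_le_of_sq_le_sq' _ (by positivity) |> abs_le.2
  nlinarith

theorem dX_window (R S : ℝ) (z : ℂ) : dX (window R S) z =
    (cutProfile (z.re ^ 2 / R ^ 2) + 2 * (z.re ^ 2 / R ^ 2) * deriv cutProfile (z.re ^ 2 / R ^ 2)) *
      cutProfile (z.im ^ 2 / S ^ 2) := by
  have e : window R S = fun z => z.re * (cutProfile (z.re ^ 2 / R ^ 2) *
    cutProfile (z.im ^ 2 / S ^ 2)) := rfl
  have h1 := dX_comp (φ := cutProfile) (f := fun z => z.re ^ 2 / R ^ 2)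
    (by fun_prop) (by fun_prop) z
  have h2 := dX_comp (φ := cutProfile) (f := fun z => z.im ^ 2 / S ^ 2)
    (by fun_prop) (by fun_prop) z
  rw [e]
  simp (disch := fun_prop) only [dX_mul, h1, h2]
  simp (disch := fun_prop) only [div_eq_mul_inv, dX_mul, dX_sq, dX_re, dX_im, dX_const]
  ring

theorem dY_window (R S : ℝ) (z : ℂ) : dY (window R S) z =
    (z.re * cutProfile (z.re ^ 2 / R ^ 2)) *
      (deriv cutProfile (z.im ^ 2 / S ^ 2) * (2 * z.im / S ^ 2)) := by
  have e : window R S = fun z => z.re * (cutProfile (z.re ^ 2 / R ^ 2) *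
    cutProfile (z.im ^ 2 / S ^ 2)) := rfl
  have h1 := dY_comp (φ := cutProfile) (f := fun z => z.re ^ 2 / R ^ 2)
    (by fun_prop) (by fun_prop) z
  have h2 := dY_comp (φ := cutProfile) (f := fun z => z.im ^ 2 / S ^ 2)
    (by fun_prop) (by fun_prop) z
  rw [e]
  simp (disch := fun_prop) only [dY_mul, h1, h2]
  simp (disch := fun_prop) only [div_eq_mul_inv, dY_mul, dY_sq, dY_re, dY_im, dY_const]
  ring

theorem abs_cutProfile_le (t : ℝ) : |cutProfile t| ≤ 1 := by
  rw [abs_of_nonneg (cutProfile_nonneg t)]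
  exact cutProfile_le_one t

theorem abs_mul_deriv_cutProfile_le {t : ℝ} (ht : 0 ≤ t) :
    |t * deriv cutProfile t| ≤ 2 * cutConst := by
  have hK := one_le_cutConst
  rcases lt_or_ge 2 t with h | h
  · rw [deriv_cutProfile_of_gt h]
    simp
    linarith
  · rw [abs_mul, abs_of_nonneg ht]
    exact mul_le_mul h (abs_deriv_cutProfile_le t) (abs_nonneg _) (by norm_num)

theorem abs_dX_window_le (R S : ℝ) (z : ℂ) : |dX (window R S) z| ≤ 1 + 4 * cutConst := by
  have hK := one_le_cutConst
  rw [dX_window, abs_mul]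
  have h1 : |2 * (z.re ^ 2 / R ^ 2) * deriv cutProfile (z.re ^ 2 / R ^ 2)| ≤ 4 * cutConst := by
    rw [mul_assoc, abs_mul, abs_two]
    have := abs_mul_deriv_cutProfile_le (t := z.re ^ 2 / R ^ 2) (by positivity)
    linarith
  have h2 := abs_cutProfile_le (z.im ^ 2 / S ^ 2)
  have h3 := (abs_add_le (cutProfile (z.re ^ 2 / R ^ 2))
    (2 * (z.re ^ 2 / R ^ 2) * deriv cutProfile (z.re ^ 2 / R ^ 2))).trans
      (add_le_add (abs_cutProfile_le _) h1)
  calc _ ≤ (1 + 4 * cutConst) * 1 := mul_le_mul h3 h2 (abs_nonneg _) (by linarith)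
    _ = _ := mul_one _

theorem abs_dY_window_le {R S : ℝ} (hR : 0 < R) (hS : 0 < S) (z : ℂ) :
    |dY (window R S) z| ≤ (rect (2 * R) (2 * S)).indicator (fun _ => 8 * cutConst * R / S) z := by
  have hK := one_le_cutConst
  rw [dY_window]
  by_cases h1 : z.re ^ 2 / R ^ 2 ≤ 2
  · by_cases h2 : z.im ^ 2 / S ^ 2 ≤ 2
    · have i1 := abs_le_of_sq_div_lt hR h1
      have i2 := abs_le_of_sq_div_lt hS h2
      rw [Set.indicator_of_mem (show z ∈ rect (2 * R) (2 * S) from ⟨i1, i2⟩)]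
      have j1 : |z.re * cutProfile (z.re ^ 2 / R ^ 2)| ≤ 2 * R * 1 := by
        rw [abs_mul]
        exact mul_le_mul i1 (abs_cutProfile_le _) (abs_nonneg _) (by linarith)
      have j2 : |deriv cutProfile (z.im ^ 2 / S ^ 2) * (2 * z.im / S ^ 2)| ≤
          cutConst * (4 / S) := by
        rw [abs_mul]
        refine mul_le_mul (abs_deriv_cutProfile_le _) ?_ (abs_nonneg _) (by linarith)
        rw [abs_div, abs_mul, abs_two, abs_of_pos (by positivity : 0 < S ^ 2),
          div_le_div_iff₀ (by positivity) hS]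
        nlinarith
      rw [abs_mul]
      calc _ ≤ (2 * R * 1) * (cutConst * (4 / S)) :=
            mul_le_mul j1 j2 (abs_nonneg _) (by linarith)
        _ = _ := by ring
    · rw [deriv_cutProfile_of_gt (not_le.1 h2)]
      simp only [zero_mul, mul_zero, abs_zero]
      exact Set.indicator_nonneg (fun _ _ => by positivity) _
  · rw [cutProfile_eq_zero (not_le.1 h1).le]
    simp only [zero_mul, mul_zero, abs_zero]
    exact Set.indicator_nonneg (fun _ _ => by positivity) _

theorem hasCompactSupport_window {R S : ℝ} (hR : 0 < R) (hS : 0 < S) :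
    HasCompactSupport (window R S) := by
  apply HasCompactSupport.of_eq_zero_of_lt (2 * R + 2 * S)
  intro z hz
  unfold window
  by_cases h1 : z.re ^ 2 / R ^ 2 ≤ 2
  · by_cases h2 : z.im ^ 2 / S ^ 2 ≤ 2
    · have i1 := abs_le_of_sq_div_lt hR h1
      have i2 := abs_le_of_sq_div_lt hS h2
      have := Complex.norm_le_abs_re_add_abs_im z
      linarith
    · rw [cutProfile_eq_zero (not_le.1 h2).le]
      simp
  · rw [cutProfile_eq_zero (not_le.1 h1).le]
    simp

/-- First component of the momentum density. -/
def momX (a b : ℂ → ℝ) (z : ℂ) : ℝ := b z * dX a z - (a z - 1) * dX b z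

/-- Second component of the momentum density. -/
def momY (a b : ℂ → ℝ) (z : ℂ) : ℝ := b z * dY a z - (a z - 1) * dY b z

section

variable {a b : ℂ → ℝ} {c : ℝ}

@[fun_prop]
theorem contDiff_momX (ha : ContDiff ℝ (⊤ : ℕ∞) a) (hb : ContDiff ℝ (⊤ : ℕ∞) b) :
    ContDiff ℝ (⊤ : ℕ∞) (momX a b) := by
  unfold momX
  fun_prop

@[fun_prop]
theorem contDiff_momY (ha : ContDiff ℝ (⊤ : ℕ∞) a) (hb : ContDiff ℝ (⊤ : ℕ∞) b) :
    ContDiff ℝ (⊤ : ℕ∞) (momY a b) := by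
  unfold momY
  fun_prop

theorem integral_linear_comb {f g h : ℂ → ℝ} (hf : Integrable f) (hg : Integrable g)
    (hh : Integrable h) (k l m : ℝ) : ∫ z, (k * f z + l * g z + m * h z) =
      k * (∫ z, f z) + l * (∫ z, g z) + m * ∫ z, h z := by
  have h1 : ∫ z, (k * f z + l * g z + m * h z) = (∫ z, (k * f z + l * g z)) + ∫ z, m * h z :=
    integral_add ((hf.const_mul k).add (hg.const_mul l)) (hh.const_mul m)
  have h2 : ∫ z, (k * f z + l * g z) = (∫ z, k * f z) + ∫ z, l * g z :=
    integral_add (hf.const_mul k) (hg.const_mul l)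
  rw [h1, h2, integral_const_mul, integral_const_mul, integral_const_mul]

theorem curl_mom (ha : ContDiff ℝ (⊤ : ℕ∞) a) (hb : ContDiff ℝ (⊤ : ℕ∞) b) (z : ℂ) :
    dX (momY a b) z - dY (momX a b) z = - 2 * jac a b z := by
  have e1 : momX a b = fun z => b z * dX a z - (a z - 1) * dX b z := rfl
  have e2 : momY a b = fun z => b z * dY a z - (a z - 1) * dY b z := rfl
  rw [e1, e2]
  simp (disch := fun_prop) only [dX_mul, dX_sub, dX_const, dY_mul, dY_sub, dY_const, dX_dY_comm,
    jac]
  ring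

theorem IsWave.integrable_stressXX (h : IsWave a b c) : Integrable (stressXX a b) := by
  refine Integrable.mono' (h.integrable_gsq.add h.integrable_pot)
    (contDiff_stressXX h.smooth_re h.smooth_im).continuous.aestronglyMeasurable
    (Eventually.of_forall fun z => ?_)
  simp only [Pi.add_apply, Real.norm_eq_abs, stressXX, gsq]
  rw [abs_le]
  constructor <;> nlinarith [sq_nonneg (dX a z), sq_nonneg (dY a z), sq_nonneg (dX b z),
    sq_nonneg (dY b z), sq_nonneg (1 - msq a b z)]

theorem abs_stressXY_le (z : ℂ) : |stressXY a b z| ≤ gsq a b z := by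
  simp only [stressXY, gsq]
  rw [abs_le]
  constructor <;> nlinarith [sq_nonneg (dX a z), sq_nonneg (dY a z), sq_nonneg (dX b z),
    sq_nonneg (dY b z), sq_nonneg (dX a z + dY a z), sq_nonneg (dX b z + dY b z),
    sq_nonneg (dX a z - dY a z), sq_nonneg (dX b z - dY b z)]

theorem mul_abs_momX_le {A R : ℝ} (hR : 0 < R) (z : ℂ) :
    A * |momX a b z| ≤ gsq a b z / R + R * A ^ 2 * (1 - msq a b z) ^ 2 + 5 * (R * A ^ 2) := by
  have h1 : momX a b z ^ 2 ≤ gsq a b z * (5 + (1 - msq a b z) ^ 2) := by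
    have i1 : momX a b z ^ 2 ≤ (dX a z ^ 2 + dX b z ^ 2) * ((a z - 1) ^ 2 + b z ^ 2) := by
      rw [momX]
      nlinarith [sq_nonneg (b z * dX b z + (a z - 1) * dX a z)]
    have i2 : (a z - 1) ^ 2 + b z ^ 2 ≤ 5 + (1 - msq a b z) ^ 2 := by
      rw [msq]
      nlinarith [sq_nonneg (a z + 1), sq_nonneg (b z), sq_nonneg (a z ^ 2 + b z ^ 2 - 2)]
    have i3 : dX a z ^ 2 + dX b z ^ 2 ≤ gsq a b z := by
      rw [gsq]
      nlinarith [sq_nonneg (dY a z), sq_nonneg (dY b z)]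
    refine i1.trans (mul_le_mul i3 i2 (by positivity) (gsq_nonneg z))
  have hg : 0 ≤ gsq a b z := gsq_nonneg z
  have hZ : 0 ≤ 5 + (1 - msq a b z) ^ 2 := by positivity
  set Z := 5 + (1 - msq a b z) ^ 2 with hZdef
  have h2 : (A * |momX a b z|) ^ 2 ≤ (gsq a b z / R + R * A ^ 2 * Z) ^ 2 := by
    rw [mul_pow, sq_abs]
    have : (gsq a b z / R + R * A ^ 2 * Z) ^ 2 =
      (gsq a b z / R - R * A ^ 2 * Z) ^ 2 + 4 * (A ^ 2 * (gsq a b z * Z)) := by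
      field_simp
      ring
    rw [this]
    have : A ^ 2 * momX a b z ^ 2 ≤ A ^ 2 * (gsq a b z * Z) := by gcongr
    nlinarith [sq_nonneg (gsq a b z / R - R * A ^ 2 * Z), mul_nonneg (sq_nonneg A)
      (mul_nonneg hg hZ)]
  have h3 := abs_le_of_sq_le_sq h2 (by positivity)
  have h4 := (le_abs_self _).trans h3
  rw [hZdef] at h4
  linarith

/-- Pohozaev identity in the direction orthogonal to the propagation. -/
theorem IsWave.pohozaev (h : IsWave a b c) (hm : Integrable (momY a b)) :
    ∫ z, (stressXX a b z + c / 2 * momY a b z) = 0 := by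
  have ha := h.smooth_re
  have hb := h.smooth_im
  have hK := one_le_cutConst
  set f : ℂ → ℝ := fun z => stressXX a b z + c / 2 * momY a b z with hf
  have hfi : Integrable f := h.integrable_stressXX.add (hm.const_mul _)
  have hfc : ContDiff ℝ (⊤ : ℕ∞) f := by fun_prop
  let R : ℕ → ℝ := fun n => n + 1
  have hR : ∀ n, 0 < R n := fun n => by positivity
  let X : ℕ → ℂ → ℝ := fun n => window (R n) (R n ^ 6)
  have hXs : ∀ n, ContDiff ℝ (⊤ : ℕ∞) (X n) := fun n => contDiff_window _ _
  -- passage to the limit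
  have lim1 : Tendsto (fun n => ∫ z, dX (X n) z * f z) atTop (nhds (∫ z, f z)) := by
    refine tendsto_integral_of_dominated_convergence (fun z => (1 + 4 * cutConst) * |f z|)
      (fun n => ?_) (hfi.abs.const_mul _) (fun n => ?_) ?_
    · have := hXs n
      exact (by fun_prop : ContDiff ℝ (⊤ : ℕ∞)
        (fun z => dX (X n) z * f z)).continuous.aestronglyMeasurable
    · refine Eventually.of_forall fun z => ?_
      rw [norm_mul, Real.norm_eq_abs, Real.norm_eq_abs]
      exact mul_le_mul_of_nonneg_right (abs_dX_window_le _ _ _) (abs_nonneg _)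
    · refine Eventually.of_forall fun z => ?_
      refine tendsto_const_nhds.congr' ?_
      obtain ⟨N, hN⟩ := exists_nat_gt (‖z‖)
      filter_upwards [eventually_ge_atTop N] with n hn
      have hRn : ‖z‖ < R n := by
        have : (N : ℝ) ≤ n := by exact_mod_cast hn
        simp only [R]
        linarith
      have hR1 : 1 ≤ R n := by simp [R]
      have h1 : z.re ^ 2 / R n ^ 2 < 1 := by
        rw [div_lt_one (by have := hR n; positivity)]
        apply sq_lt_sq'
        · linarith [abs_le.1 (Complex.abs_re_le_norm z)]
        · linarith [abs_le.1 (Complex.abs_re_le_norm z)]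
      have h2 : z.im ^ 2 / (R n ^ 6) ^ 2 < 1 := by
        have : R n ≤ R n ^ 6 := le_self_pow₀ hR1 (by norm_num)
        rw [div_lt_one (by have := hR n; positivity)]
        apply sq_lt_sq'
        · linarith [abs_le.1 (Complex.abs_im_le_norm z)]
        · linarith [abs_le.1 (Complex.abs_im_le_norm z)]
      rw [dX_window, deriv_cutProfile_of_lt h1, cutProfile_eq_one h1.le, cutProfile_eq_one h2.le]
      simp
  set I1 := ∫ z, gsq a b z with hI1
  set I2 := ∫ z, (1 - msq a b z) ^ 2 with hI2
  have bound : ∀ n, |∫ z, dX (X n) z * f z| ≤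
      ((8 * cutConst) * I1 + (|c| / 2) * (I1 + (8 * cutConst) ^ 2 * I2 +
        (80 * (8 * cutConst) ^ 2))) / R n := by
    intro n
    have hRn := hR n
    have hR1 : 1 ≤ R n := by simp [R]
    have hXn := hXs n
    have hXc : HasCompactSupport (X n) := hasCompactSupport_window hRn (by positivity)
    have e : ∫ z, dX (X n) z * f z =
        ∫ z, -(dY (X n) z * (stressXY a b z - c / 2 * momX a b z)) := by
      refine integral_eq_of_eq_add_div (F := fun z => X n z * f z)
        (G := fun z => X n z * (stressXY a b z - c / 2 * momX a b z)) ?_ ?_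
        (by fun_prop) (by fun_prop) hXc.mul_right hXc.mul_right fun z => ?_
      · exact (by fun_prop : ContDiff ℝ (⊤ : ℕ∞)
          (fun z => dX (X n) z * f z)).continuous.integrable_of_hasCompactSupport
            hXc.dX.mul_right
      · exact (Continuous.integrable_of_hasCompactSupport (by fun_prop : ContDiff ℝ (⊤ : ℕ∞)
          (fun z => dY (X n) z * (stressXY a b z - c / 2 * momX a b z))).continuous
            hXc.dY.mul_right).neg
      · have h1 := h.div_stress_fst z
        have h2 := curl_mom ha hb z
        rw [hf]
        simp (disch := fun_prop) only [dX_mul, dX_add, dX_const, dY_mul, dY_sub, dY_const]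
        linear_combination (- X n z) * h1 - (c / 2) * (X n z) * h2
    rw [e]
    set A : ℂ → ℝ := fun z => (rect (2 * R n) (2 * R n ^ 6)).indicator
      (fun _ => 8 * cutConst * R n / R n ^ 6) z with hA
    have hind : Integrable (fun z => (rect (2 * R n) (2 * R n ^ 6)).indicator
      (fun _ => (8 * cutConst) ^ 2 * (R n ^ 3 / R n ^ 12)) z) := by
      refine (integrable_indicator_iff (measurableSet_rect _ _)).2 ?_
      refine integrableOn_const ?_
      rw [volume_rect (by positivity)]
      simp
    have hA5 : ∀ z, R n * A z ^ 2 = (rect (2 * R n) (2 * R n ^ 6)).indicator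
      (fun _ => (8 * cutConst) ^ 2 * (R n ^ 3 / R n ^ 12)) z := by
      intro z
      by_cases hz : z ∈ rect (2 * R n) (2 * R n ^ 6)
      · simp only [hA, Set.indicator_of_mem hz]
        field_simp
      · simp [hA, Set.indicator_of_notMem hz]
    have hp : ∀ k : ℕ, R n ^ 3 / R n ^ (k + 4) ≤ 1 / R n := by
      intro k
      rw [div_le_div_iff₀ (by positivity) hRn]
      have : 1 ≤ R n ^ k := one_le_pow₀ hR1
      rw [pow_add]
      nlinarith [pow_pos hRn 4]
    have hA1 : ∀ z, A z ≤ (8 * cutConst) / R n := by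
      intro z
      refine (Set.indicator_apply_le' (fun _ => le_rfl) (fun _ => by positivity)).trans ?_
      rw [div_le_div_iff₀ (by positivity) hRn]
      have : 1 ≤ R n ^ 4 := one_le_pow₀ hR1
      have e6 : R n ^ 6 = R n ^ 2 * R n ^ 4 := by ring
      rw [e6]
      have : 0 ≤ 8 * cutConst * R n ^ 2 := by positivity
      nlinarith
    have hA2 : ∀ z, R n * A z ^ 2 ≤ (8 * cutConst) ^ 2 / R n := by
      intro z
      rw [hA5]
      refine (Set.indicator_apply_le' (fun _ => le_rfl) (fun _ => by positivity)).trans ?_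
      have := hp 8
      calc _ ≤ (8 * cutConst) ^ 2 * (1 / R n) := by gcongr
        _ = _ := by ring
    have hA0 : ∀ z, 0 ≤ A z := fun z => Set.indicator_nonneg (fun _ _ => by positivity) _
    rw [← Real.norm_eq_abs]
    refine (norm_integral_le_of_norm_le (g := fun z => (8 * cutConst / R n + |c| / 2 / R n) *
      gsq a b z + (|c| / 2 * ((8 * cutConst) ^ 2 / R n)) * (1 - msq a b z) ^ 2 +
        (|c| / 2 * 5) * ((rect (2 * R n) (2 * R n ^ 6)).indicator
          (fun _ => (8 * cutConst) ^ 2 * (R n ^ 3 / R n ^ 12)) z)) ?_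
        (Eventually.of_forall fun z => ?_)).trans ?_
    · exact ((h.integrable_gsq.const_mul _).add (h.integrable_pot.const_mul _)).add
        (hind.const_mul _)
    · have hb1 : |dY (X n) z| ≤ A z := abs_dY_window_le hRn (by positivity) z
      rw [Real.norm_eq_abs, abs_neg, abs_mul]
      have k1 : |stressXY a b z - c / 2 * momX a b z| ≤
          gsq a b z + (|c| / 2) * |momX a b z| := by
        refine (abs_sub _ _).trans ?_
        rw [abs_mul, abs_div, abs_two]
        gcongr
        exact abs_stressXY_le z
      have k2 := mul_abs_momX_le (a := a) (b := b) (A := A z) hRn z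
      have k3 : R n * A z ^ 2 * (1 - msq a b z) ^ 2 ≤
          (8 * cutConst) ^ 2 / R n * (1 - msq a b z) ^ 2 := by
        gcongr
        exact hA2 z
      rw [← hA5 z]
      calc _ ≤ A z * (gsq a b z + (|c| / 2) * |momX a b z|) :=
            mul_le_mul hb1 k1 (abs_nonneg _) (hA0 z)
        _ = A z * gsq a b z + (|c| / 2) * (A z * |momX a b z|) := by ring
        _ ≤ 8 * cutConst / R n * gsq a b z + (|c| / 2) * (gsq a b z / R n +
            (8 * cutConst) ^ 2 / R n * (1 - msq a b z) ^ 2 + 5 * (R n * A z ^ 2)) := by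
          have := gsq_nonneg (a := a) (b := b) z
          gcongr
          · exact hA1 z
          · exact k2.trans (by linarith)
        _ = _ := by ring
    · have j1 : ∫ z, (rect (2 * R n) (2 * R n ^ 6)).indicator
          (fun _ => (8 * cutConst) ^ 2 * (R n ^ 3 / R n ^ 12)) z ≤
            16 * (8 * cutConst) ^ 2 / R n := by
        rw [integral_indicator (measurableSet_rect _ _), setIntegral_const, Measure.real,
          volume_rect (by positivity), ENNReal.toReal_ofReal (by positivity), smul_eq_mul]
        have := hp 1
        calc _ = 16 * (8 * cutConst) ^ 2 * (R n ^ 3 / R n ^ (1 + 4)) := by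
              field_simp
              ring
          _ ≤ 16 * (8 * cutConst) ^ 2 * (1 / R n) := by gcongr
          _ = _ := by ring
      rw [integral_linear_comb h.integrable_gsq h.integrable_pot hind, ← hI1, ← hI2]
      calc _ ≤ (8 * cutConst / R n + |c| / 2 / R n) * I1 +
            |c| / 2 * ((8 * cutConst) ^ 2 / R n) * I2 +
              |c| / 2 * 5 * (16 * (8 * cutConst) ^ 2 / R n) := by gcongr
        _ = _ := by
          field_simp
          ring
  have lim0 : Tendsto (fun n => ∫ z, dX (X n) z * f z) atTop (nhds 0) := by
    refine squeeze_zero_norm bound ?_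
    refine Tendsto.div_atTop tendsto_const_nhds ?_
    exact tendsto_atTop_add_const_right _ _ tendsto_natCast_atTop_atTop
  exact tendsto_nhds_unique lim1 lim0

end

/-! ### Bounds for the modulus -/

theorem tendsto_cutoff (z : ℂ) :
    Tendsto (fun n : ℕ => cutoff ((n : ℝ) + 1) z) atTop (nhds 1) := by
  refine tendsto_const_nhds.congr' ?_
  obtain ⟨N, hN⟩ := exists_nat_gt ‖z‖
  filter_upwards [eventually_ge_atTop N] with n hn
  have : (N : ℝ) ≤ n := by exact_mod_cast hn
  rw [cutoff_eq_one (by positivity) (by linarith)]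

theorem tendsto_integral_cutoff {g : ℂ → ℝ} (hg : Integrable g) :
    Tendsto (fun n : ℕ => ∫ z, cutoff ((n : ℝ) + 1) z * g z) atTop (nhds (∫ z, g z)) := by
  refine tendsto_integral_of_dominated_convergence (fun z => ‖g z‖) (fun n => ?_)
    hg.norm (fun n => ?_) ?_
  · exact (contDiff_cutoff _).continuous.aestronglyMeasurable.mul hg.aestronglyMeasurable
  · refine Eventually.of_forall fun z => ?_
    rw [norm_mul, Real.norm_eq_abs, abs_of_nonneg (cutoff_nonneg _ _)]
    exact mul_le_of_le_one_left (norm_nonneg _) (cutoff_le_one _ _)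
  · refine Eventually.of_forall fun z => ?_
    simpa using (tendsto_cutoff z).mul_const (g z)

theorem integral_le_of_cutoff {g : ℂ → ℝ} (hg : Integrable g) {A B : ℝ}
    (h : ∀ R : ℝ, 1 ≤ R → ∫ z, cutoff R z * g z ≤ A + B / R) : ∫ z, g z ≤ A := by
  have h2 : Tendsto (fun n : ℕ => A + B / ((n : ℝ) + 1)) atTop (nhds (A + 0)) :=
    tendsto_const_nhds.add (Tendsto.div_atTop tendsto_const_nhds
      (tendsto_atTop_add_const_right _ _ tendsto_natCast_atTop_atTop))
  rw [add_zero] at h2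
  refine le_of_tendsto_of_tendsto' (tendsto_integral_cutoff hg) h2 fun n => ?_
  exact h _ (by have : (0 : ℝ) ≤ n := Nat.cast_nonneg n
                linarith)

/-- Young's inequality for the scalar product of a cutoff gradient with a vector field. -/
theorem abs_gradient_cutoff_dot_le {R : ℝ} (hR : 0 < R) (z : ℂ) (x y t s : ℝ)
    (h : x ^ 2 + y ^ 2 ≤ 4 * t * s) (ht : 0 ≤ t) (hs : 0 ≤ s) :
    |dX (cutoff R) z * x + dY (cutoff R) z * y| ≤ 4 * cutConst / R * (t + s) := by
  have hK := one_le_cutConst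
  apply abs_le_of_sq_le_sq _ (by positivity)
  have h1 := gradient_cutoff_bound hR z
  calc _ ≤ (dX (cutoff R) z ^ 2 + dY (cutoff R) z ^ 2) * (x ^ 2 + y ^ 2) := by
        nlinarith [sq_nonneg (dX (cutoff R) z * y - dY (cutoff R) z * x)]
    _ ≤ (4 * cutConst / R) ^ 2 * (t + s) ^ 2 := by
        refine mul_le_mul h1 (h.trans ?_) (by positivity) (by positivity)
        nlinarith [sq_nonneg (t - s)]
    _ = _ := by ring

section

variable {a b : ℂ → ℝ} {c : ℝ}

theorem arctan_le_of_nonneg {x : ℝ} (hx : 0 ≤ x) : Real.arctan x ≤ x := by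
  have := Real.le_tan (Real.arctan_nonneg.2 hx) (Real.arctan_lt_pi_div_two x)
  rwa [Real.tan_arctan] at this

theorem gsq_add_curY_ge (z : ℂ) : -(c ^ 2 / 4 * msq a b z) ≤ gsq a b z + c * curY a b z := by
  rw [gsq, curY, msq]
  nlinarith [sq_nonneg (dY b z + c / 2 * a z), sq_nonneg (dY a z - c / 2 * b z),
    sq_nonneg (dX a z), sq_nonneg (dX b z)]

theorem IsWave.integral_supersolution_le (h : IsWave a b c) (hc : c ≠ 0) {R : ℝ} (hR : 0 < R) :
    ∫ z, cutoff R z * (Real.smoothTransition (msq a b z - (1 + c ^ 2 / 4)) *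
      (2 * msq a b z * (msq a b z - (1 + c ^ 2 / 4)))) ≤
    4 * cutConst / R * ((∫ z, gsq a b z) +
      (1 + c ^ 2 / 4) / (c ^ 2 / 4) ^ 2 * ∫ z, (1 - msq a b z) ^ 2) := by
  have ha := h.smooth_re
  have hb := h.smooth_im
  have hK := one_le_cutConst
  have hc2 : 0 < c ^ 2 / 4 := by positivity
  set k := c ^ 2 / 4 with hk
  set Φ : ℝ → ℝ := fun t => Real.smoothTransition (t - (1 + k)) with hΦ
  have hΦs : ContDiff ℝ (⊤ : ℕ∞) Φ :=
    Real.smoothTransition.contDiff.comp (contDiff_id.sub contDiff_const)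
  have hΦ' : ∀ t, 0 ≤ deriv Φ t := by
    intro t
    apply Monotone.deriv_nonneg
    intro x y hxy
    exact Real.smoothTransition.monotone (by linarith)
  have hη := contDiff_cutoff R
  have hηc := hasCompactSupport_cutoff hR
  rw [← integral_const_mul, ← integral_add h.integrable_gsq (h.integrable_pot.const_mul _),
    ← integral_const_mul]
  refine integral_le_of_le_add_div (F := fun z => cutoff R z * (Φ (msq a b z) * dX (msq a b) z))
    (G := fun z => cutoff R z * (Φ (msq a b z) * dY (msq a b) z)) ?_ ?_ (by fun_prop)
    (by fun_prop) hηc.mul_right hηc.mul_right fun z => ?_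
  · refine Continuous.integrable_of_hasCompactSupport ?_ hηc.mul_right
    have : Continuous (fun z => Φ (msq a b z)) := (hΦs.continuous).comp (by fun_prop :
      ContDiff ℝ (⊤ : ℕ∞) (msq a b)).continuous
    have h2 := (contDiff_msq ha hb).continuous
    have h3 := hη.continuous
    exact h3.mul (this.mul (by fun_prop))
  · exact (h.integrable_gsq.add (h.integrable_pot.const_mul _)).const_mul _
  · have e1 := dX_comp hΦs (contDiff_msq ha hb) z
    have e2 := dY_comp hΦs (contDiff_msq ha hb) z
    simp (disch := fun_prop) only [dX_mul, dY_mul, e1, e2]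
    have hL := h.laplacian_msq z
    have hg := gsq_add_curY_ge (a := a) (b := b) (c := c) z
    rw [show c ^ 2 / 4 = k from rfl] at hg
    have hW := msq_nonneg (a := a) (b := b) z
    have hG := gradient_msq_sq_le ha hb z
    have hgs := gsq_nonneg (a := a) (b := b) z
    have hη0 := cutoff_nonneg R z
    have hΦ0 : 0 ≤ Φ (msq a b z) := Real.smoothTransition.nonneg _
    have hΦ1 : Φ (msq a b z) ≤ 1 := Real.smoothTransition.le_one _
    have hΦd := hΦ' (msq a b z)
    change cutoff R z * (Φ (msq a b z) * _) ≤ _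
    have main : |dX (cutoff R) z * (Φ (msq a b z) * dX (msq a b) z) +
        dY (cutoff R) z * (Φ (msq a b z) * dY (msq a b) z)| ≤ 4 * cutConst / R *
          (gsq a b z + (1 + k) / k ^ 2 * (1 - msq a b z) ^ 2) := by
      rcases le_or_gt (msq a b z) (1 + k) with hle | hgt
      · have : Φ (msq a b z) = 0 := Real.smoothTransition.zero_of_nonpos (by linarith)
        rw [this]
        simp only [zero_mul, mul_zero, add_zero, abs_zero]
        positivity
      · refine abs_gradient_cutoff_dot_le hR z _ _ _ _ ?_ hgs (by positivity)
        have hWb : msq a b z ≤ (1 + k) / k ^ 2 * (1 - msq a b z) ^ 2 := by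
          rw [div_mul_eq_mul_div, le_div_iff₀ (by positivity)]
          nlinarith [mul_pos hc2 (sub_pos.2 hgt), mul_nonneg hc2.le (mul_nonneg hW hc2.le)]
        calc _ = Φ (msq a b z) ^ 2 * (dX (msq a b) z ^ 2 + dY (msq a b) z ^ 2) := by ring
          _ ≤ 1 * (4 * msq a b z * gsq a b z) := by
            refine mul_le_mul (pow_le_one₀ hΦ0 hΦ1) hG (by positivity) (by norm_num)
          _ ≤ _ := by nlinarith
    have hm := (abs_le.1 main).1
    have t1 : 0 ≤ cutoff R z * (deriv Φ (msq a b z) *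
        (dX (msq a b) z ^ 2 + dY (msq a b) z ^ 2)) := by positivity
    have t2 : cutoff R z * (Φ (msq a b z) * (2 * msq a b z * (msq a b z - (1 + k)))) ≤
        cutoff R z * (Φ (msq a b z) * (dX (dX (msq a b)) z + dY (dY (msq a b)) z)) := by
      rw [hL]
      refine mul_le_mul_of_nonneg_left (mul_le_mul_of_nonneg_left ?_ hΦ0) hη0
      nlinarith
    linarith

/-- Universal bound of the modulus of finite energy travelling waves. -/
theorem IsWave.msq_le (h : IsWave a b c) (hc : c ≠ 0) (z : ℂ) :
    msq a b z ≤ 1 + c ^ 2 / 4 := by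
  have ha := h.smooth_re
  have hb := h.smooth_im
  have hK := one_le_cutConst
  by_contra! hz
  set f : ℂ → ℝ := fun z => Real.smoothTransition (msq a b z - (1 + c ^ 2 / 4)) *
      (2 * msq a b z * (msq a b z - (1 + c ^ 2 / 4))) with hf
  have hfc : Continuous f := by
    have : Continuous (fun z => Real.smoothTransition (msq a b z - (1 + c ^ 2 / 4))) :=
      Real.smoothTransition.continuous.comp
        ((contDiff_msq ha hb).continuous.sub continuous_const)
    have h2 := (contDiff_msq ha hb).continuous
    exact this.mul (by fun_prop)
  have hf0 : ∀ w, 0 ≤ f w := by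
    intro w
    have hW := msq_nonneg (a := a) (b := b) w
    rcases le_or_gt (msq a b w) (1 + c ^ 2 / 4) with hle | hgt
    · simp only [hf]
      rw [Real.smoothTransition.zero_of_nonpos (by linarith), zero_mul]
    · have := Real.smoothTransition.nonneg (msq a b w - (1 + c ^ 2 / 4))
      have : 0 ≤ msq a b w - (1 + c ^ 2 / 4) := by linarith
      simp only [hf]
      positivity
  have hfz : 0 < f z := by
    have h1 := Real.smoothTransition.pos_of_pos (sub_pos.2 hz)
    have h2 := sub_pos.2 hz
    have h3 : 0 < msq a b z := by nlinarith [sq_nonneg c]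
    simp only [hf]
    positivity
  set R0 := ‖z‖ + 1 with hR0
  have hR0p : 0 < R0 := by positivity
  have hpos : 0 < ∫ w, cutoff R0 w * f w := by
    refine Continuous.integral_pos_of_hasCompactSupport_nonneg_nonzero
      ((contDiff_cutoff R0).continuous.mul hfc) (hasCompactSupport_cutoff hR0p).mul_right
      (fun w => mul_nonneg (cutoff_nonneg _ _) (hf0 w)) (x := z) ?_
    rw [cutoff_eq_one hR0p (by linarith), one_mul]
    exact hfz.ne'
  set M := 4 * cutConst * ((∫ z, gsq a b z) +
      (1 + c ^ 2 / 4) / (c ^ 2 / 4) ^ 2 * ∫ z, (1 - msq a b z) ^ 2) with hM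
  have hM0 : 0 ≤ M := by
    have := integral_nonneg (μ := volume) (f := gsq a b) (fun z => gsq_nonneg z)
    have := integral_nonneg (μ := volume) (f := fun z => (1 - msq a b z) ^ 2)
      (fun z => sq_nonneg _)
    positivity
  have hle : ∀ R, 2 * R0 ≤ R → ∫ w, cutoff R0 w * f w ≤ M / R := by
    intro R hR
    have hRp : 0 < R := by linarith
    calc _ ≤ ∫ w, cutoff R w * f w := by
          refine integral_mono (Continuous.integrable_of_hasCompactSupport
            ((contDiff_cutoff R0).continuous.mul hfc) (hasCompactSupport_cutoff hR0p).mul_right)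
            (Continuous.integrable_of_hasCompactSupport
            ((contDiff_cutoff R).continuous.mul hfc) (hasCompactSupport_cutoff hRp).mul_right)
            fun w => mul_le_mul_of_nonneg_right ?_ (hf0 w)
          rcases le_or_gt ‖w‖ R with hw | hw
          · rw [cutoff_eq_one hRp hw]
            exact cutoff_le_one _ _
          · rw [cutoff_eq_zero hR0p (by linarith)]
            exact cutoff_nonneg _ _
      _ ≤ _ := h.integral_supersolution_le hc hRp
      _ = _ := by rw [hM]; ring
  set I := ∫ w, cutoff R0 w * f w
  have := hle (2 * R0 + (M + 1) / I) (by have : 0 < (M + 1) / I := by positivity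
                                         linarith)
  rw [le_div_iff₀ (by positivity)] at this
  have e : I * (2 * R0 + (M + 1) / I) = 2 * R0 * I + (M + 1) := by
    field_simp
  nlinarith [mul_pos hR0p hpos]

/-- Energy estimate for the modulus away from level sets far from one. -/
theorem IsWave.integral_gradient_msq_le (h : IsWave a b c) (hW : ∀ z, msq a b z ≤ 2)
    {t : ℝ} (ht : 0 < t) :
    ∫ z, (1 / (1 + ((1 - msq a b z) / t) ^ 2)) * (dX (msq a b) z ^ 2 + dY (msq a b) z ^ 2) ≤
    (4 * t + 4 * |c|) * (∫ z, gsq a b z) + 2 * |c| * ∫ z, (1 - msq a b z) ^ 2 := by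
  have ha := h.smooth_re
  have hb := h.smooth_im
  have hK := one_le_cutConst
  set Φ : ℝ → ℝ := fun y => t * Real.arctan ((1 - y) / t) with hΦ
  have hΦs : ContDiff ℝ (⊤ : ℕ∞) Φ := by
    have : ContDiff ℝ (⊤ : ℕ∞) (fun y : ℝ => Real.arctan ((1 - y) / t)) :=
      Real.contDiff_arctan.comp (by fun_prop : ContDiff ℝ (⊤ : ℕ∞) (fun y : ℝ => (1 - y) / t))
    fun_prop
  have hΦ' : ∀ y, deriv Φ y = - (1 / (1 + ((1 - y) / t) ^ 2)) := by
    intro y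
    have h1 : HasDerivAt (fun y : ℝ => (1 - y) / t) (-1 / t) y :=
      ((hasDerivAt_id y).const_sub 1).div_const t
    have h2 := (h1.arctan.const_mul t).deriv
    rw [hΦ, h2]
    field_simp
  have habs : ∀ x : ℝ, |Real.arctan x| ≤ |x| := by
    intro x
    rcases le_total 0 x with hx | hx
    · rw [abs_of_nonneg hx, abs_of_nonneg (Real.arctan_nonneg.2 hx)]
      exact arctan_le_of_nonneg hx
    · rw [abs_of_nonpos hx, abs_of_nonpos (Real.arctan_le_zero.2 hx), ← Real.arctan_neg]
      exact arctan_le_of_nonneg (by linarith)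
  have hΦ1 : ∀ y, |Φ y| ≤ |1 - y| := by
    intro y
    rw [hΦ]
    simp only [abs_mul, abs_of_pos ht]
    have := habs ((1 - y) / t)
    rw [abs_div, abs_of_pos ht, le_div_iff₀ ht] at this
    linarith
  have hΦ2 : ∀ y, |Φ y| ≤ 2 * t := by
    intro y
    rw [hΦ]
    simp only [abs_mul, abs_of_pos ht]
    have h1 : |Real.arctan ((1 - y) / t)| ≤ 2 := by
      have := Real.pi_lt_four
      rw [abs_le]
      constructor
      · linarith [Real.neg_pi_div_two_lt_arctan ((1 - y) / t)]
      · linarith [Real.arctan_lt_pi_div_two ((1 - y) / t)]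
    nlinarith
  have hΦ3 : ∀ y, 0 ≤ Φ y * (1 - y) := by
    intro y
    rw [hΦ]
    rcases le_total y 1 with hy | hy
    · have h1 : 0 ≤ Real.arctan ((1 - y) / t) := Real.arctan_nonneg.2
        (div_nonneg (by linarith) ht.le)
      have h2 : 0 ≤ 1 - y := by linarith
      simp only
      positivity
    · have h1 : Real.arctan ((1 - y) / t) ≤ 0 := Real.arctan_le_zero.2
        (div_nonpos_of_nonpos_of_nonneg (by linarith) ht.le)
      have h2 : 1 - y ≤ 0 := by linarith
      simp only
      rw [mul_assoc]
      exact mul_nonneg ht.le (mul_nonneg_of_nonpos_of_nonpos h1 h2)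
  have hWs := contDiff_msq ha hb
  have hgi := h.integrable_gsq
  have hpi := h.integrable_pot
  have hcont : Continuous (fun z => (1 / (1 + ((1 - msq a b z) / t) ^ 2)) *
      (dX (msq a b) z ^ 2 + dY (msq a b) z ^ 2)) := by
    have h1 := hWs.continuous
    have h2 := (contDiff_dX hWs).continuous
    have h3 := (contDiff_dY hWs).continuous
    refine Continuous.mul (continuous_const.div (by fun_prop) fun z => by positivity) (by fun_prop)
  have hG8 : ∀ z, dX (msq a b) z ^ 2 + dY (msq a b) z ^ 2 ≤ 8 * gsq a b z := by
    intro z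
    have h1 := gradient_msq_sq_le ha hb z
    have h2 := gsq_nonneg (a := a) (b := b) z
    nlinarith [hW z]
  refine integral_le_of_cutoff (B := 4 * cutConst * ((8 * ∫ z, gsq a b z) +
    ∫ z, (1 - msq a b z) ^ 2)) ?_ fun R hR1 => ?_
  · refine (hgi.const_mul 8).mono' hcont.aestronglyMeasurable (Eventually.of_forall fun z => ?_)
    rw [Real.norm_eq_abs, abs_of_nonneg (by positivity)]
    refine le_trans ?_ (hG8 z)
    refine mul_le_of_le_one_left (by positivity) ?_
    rw [div_le_one (by positivity)]
    nlinarith [sq_nonneg ((1 - msq a b z) / t)]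
  · have hR : 0 < R := by linarith
    have hη := contDiff_cutoff R
    have hηc := hasCompactSupport_cutoff hR
    have e : (4 * t + 4 * |c|) * (∫ z, gsq a b z) + 2 * |c| * (∫ z, (1 - msq a b z) ^ 2) +
        4 * cutConst * ((8 * ∫ z, gsq a b z) + ∫ z, (1 - msq a b z) ^ 2) / R =
        ∫ z, ((4 * t + 4 * |c| + 4 * cutConst * 8 / R) * gsq a b z +
          (2 * |c| + 4 * cutConst / R) * (1 - msq a b z) ^ 2 + 0 * gsq a b z) := by
      rw [integral_linear_comb hgi hpi hgi]
      ring
    rw [e]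
    refine integral_le_of_le_add_div
      (F := fun z => -1 * (cutoff R z * (Φ (msq a b z) * dX (msq a b) z)))
      (G := fun z => -1 * (cutoff R z * (Φ (msq a b z) * dY (msq a b) z))) ?_ ?_ (by fun_prop)
      (by fun_prop) hηc.mul_right.mul_left hηc.mul_right.mul_left fun z => ?_
    · exact Continuous.integrable_of_hasCompactSupport (hη.continuous.mul hcont) hηc.mul_right
    · exact ((hgi.const_mul _).add (hpi.const_mul _)).add (hgi.const_mul _)
    · have e1 := dX_comp hΦs hWs z
      have e2 := dY_comp hΦs hWs z
      simp (disch := fun_prop) only [dX_mul, dY_mul, dX_const, dY_const, e1, e2]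
      rw [hΦ']
      have hL := h.laplacian_msq z
      have hW0 := msq_nonneg (a := a) (b := b) z
      have hgs := gsq_nonneg (a := a) (b := b) z
      have hη0 := cutoff_nonneg R z
      have hη1 := cutoff_le_one R z
      have i1 := hΦ1 (msq a b z)
      have i2 := hΦ2 (msq a b z)
      have i3 := hΦ3 (msq a b z)
      have main : |dX (cutoff R) z * (Φ (msq a b z) * dX (msq a b) z) +
        dY (cutoff R) z * (Φ (msq a b z) * dY (msq a b) z)| ≤ 4 * cutConst / R *
          (8 * gsq a b z + (1 - msq a b z) ^ 2) := by
        refine abs_gradient_cutoff_dot_le hR z _ _ _ _ ?_ (by positivity) (by positivity)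
        have : Φ (msq a b z) ^ 2 ≤ (1 - msq a b z) ^ 2 := sq_le_sq.2 i1
        calc _ = Φ (msq a b z) ^ 2 * (dX (msq a b) z ^ 2 + dY (msq a b) z ^ 2) := by ring
          _ ≤ (1 - msq a b z) ^ 2 * (8 * gsq a b z) :=
            mul_le_mul this (hG8 z) (by positivity) (by positivity)
          _ ≤ _ := by nlinarith [mul_nonneg (sq_nonneg (1 - msq a b z)) hgs]
      have hm := (abs_le.1 main).2
      have hcur : |c * (Φ (msq a b z) * curY a b z)| ≤
          |c| * ((1 - msq a b z) ^ 2 + 2 * gsq a b z) := by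
        rw [abs_mul]
        refine mul_le_mul_of_nonneg_left ?_ (abs_nonneg c)
        rw [abs_mul]
        have j1 : |curY a b z| ^ 2 ≤ 2 * gsq a b z := by
          rw [sq_abs]
          have := current_sq_le (a := a) (b := b) z
          nlinarith [hW z, sq_nonneg (curX a b z)]
        have j2 : |Φ (msq a b z)| ^ 2 ≤ (1 - msq a b z) ^ 2 := by
          rw [sq_abs]
          exact sq_le_sq.2 i1
        nlinarith [sq_nonneg (|Φ (msq a b z)| - |curY a b z|)]
      have hcur2 : cutoff R z * (c * (Φ (msq a b z) * curY a b z)) ≤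
          |c| * ((1 - msq a b z) ^ 2 + 2 * gsq a b z) := by
        have k1 := (le_abs_self _).trans hcur
        have k2 : 0 ≤ |c| * ((1 - msq a b z) ^ 2 + 2 * gsq a b z) := by positivity
        calc _ ≤ cutoff R z * (|c| * ((1 - msq a b z) ^ 2 + 2 * gsq a b z)) := by gcongr
          _ ≤ _ := mul_le_of_le_one_left k2 hη1
      have hg2 : cutoff R z * (Φ (msq a b z) * gsq a b z) ≤ 2 * t * gsq a b z := by
        have k1 := (le_abs_self _).trans i2
        calc _ ≤ cutoff R z * (2 * t * gsq a b z) := by gcongr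
          _ ≤ _ := mul_le_of_le_one_left (by positivity) hη1
      have hg3 : 0 ≤ cutoff R z * (Φ (msq a b z) * (1 - msq a b z) * msq a b z) := by positivity
      have hL' : dY (dY (msq a b)) z =
        2 * (gsq a b z + c * curY a b z - (1 - msq a b z) * msq a b z) - dX (dX (msq a b)) z := by
        linarith
      rw [hL']
      have e3 : 4 * cutConst * 8 / R = 8 * (4 * cutConst / R) := by ring
      rw [e3]
      linarith

end

/-! ### The Cauchy kernel -/

theorem integrableOn_polar {E : Type*} [NormedAddCommGroup E] {G : ℝ × ℝ → E} (hG : Continuous G)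
    {R : ℝ} (h : ∀ p : ℝ × ℝ, R < p.1 → G p = 0) :
    IntegrableOn G (Set.Ioi 0 ×ˢ Set.Ioo (-Real.pi) Real.pi) := by
  have h1 : IntegrableOn G (Set.Icc 0 R ×ˢ Set.Icc (-Real.pi) Real.pi) :=
    hG.continuousOn.integrableOn_compact (isCompact_Icc.prod isCompact_Icc)
  refine h1.of_forall_sdiff_eq_zero (measurableSet_Ioi.prod measurableSet_Ioo) fun p hp => ?_
  apply h
  by_contra! hle
  exact hp.2 ⟨⟨le_of_lt hp.1.1, hle⟩, ⟨hp.1.2.1.le, hp.1.2.2.le⟩⟩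

theorem fderiv_complex_apply (f : ℂ → ℂ) (z v : ℂ) :
    fderiv ℝ f z v = v.re * fderiv ℝ f z 1 + v.im * fderiv ℝ f z Complex.I := by
  have : v = v.re • (1 : ℂ) + v.im • Complex.I := by
    apply Complex.ext <;> simp
  conv_lhs => rw [this]
  rw [map_add, map_smul, map_smul, Complex.real_smul, Complex.real_smul]

/-- The Cauchy kernel inverts the Cauchy–Riemann operator. -/
theorem integral_cauchyRiemann_div {f : ℂ → ℂ} (hf : ContDiff ℝ (⊤ : ℕ∞) f)
    (hc : HasCompactSupport f) :
    ∫ w, (fderiv ℝ f w 1 + Complex.I * fderiv ℝ f w Complex.I) / w = -(2 * Real.pi) * f 0 := by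
  obtain ⟨R, hR⟩ : ∃ R : ℝ, ∀ z, R < ‖z‖ → fderiv ℝ f z = 0 := by
    obtain ⟨R, hR⟩ := (hc.fderiv ℝ).isCompact.isBounded.subset_closedBall 0
    refine ⟨R, fun z hz => ?_⟩
    by_contra hne
    have := hR (subset_tsupport _ hne)
    rw [mem_closedBall_zero_iff] at this
    linarith
  let e : ℝ → ℂ := fun θ => Complex.exp (θ * Complex.I)
  have he : Continuous e := by fun_prop
  have he1 : ∀ θ, ‖e θ‖ = 1 := fun θ => Complex.norm_exp_ofReal_mul_I θ
  have hdf : Continuous (fderiv ℝ f) := hf.continuous_fderiv (by simp)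
  let A : ℝ × ℝ → ℂ := fun p => fderiv ℝ f (p.1 * e p.2) (e p.2)
  let B : ℝ × ℝ → ℂ := fun p => fderiv ℝ f (p.1 * e p.2) (Complex.I * e p.2)
  have hA : Continuous A := by
    refine (hdf.comp (by fun_prop)).clm_apply (by fun_prop)
  have hB : Continuous B := by
    refine (hdf.comp (by fun_prop)).clm_apply (by fun_prop)
  have hzero : ∀ p : ℝ × ℝ, max R 0 < p.1 → fderiv ℝ f (p.1 * e p.2) = 0 := by
    intro p hp
    apply hR
    rw [norm_mul, he1, mul_one, Complex.norm_real, Real.norm_eq_abs,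
      abs_of_pos ((le_max_right _ _).trans_lt hp)]
    exact (le_max_left _ _).trans_lt hp
  have hAi := integrableOn_polar hA (R := max R 0) fun p hp => by simp [A, hzero p hp]
  have hBi := integrableOn_polar hB (R := max R 0) fun p hp => by simp [B, hzero p hp]
  have hAint : ∫ p in Set.Ioi 0 ×ˢ Set.Ioo (-Real.pi) Real.pi, A p = -(2 * Real.pi) * f 0 := by
    have hsw : ∫ p in Set.Ioi 0 ×ˢ Set.Ioo (-Real.pi) Real.pi, A p =
        ∫ θ in Set.Ioo (-Real.pi) Real.pi, ∫ r in Set.Ioi (0 : ℝ), A (r, θ) := by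
      have h1 := setIntegral_prod (μ := volume) (ν := volume) A hAi
      rw [Measure.volume_eq_prod, h1]
      refine integral_integral_swap (f := fun r θ => A (r, θ)) ?_
      rw [Measure.prod_restrict]
      exact hAi
    rw [hsw]
    have h2 : ∀ θ, ∫ r in Set.Ioi (0 : ℝ), A (r, θ) = - f 0 := by
      intro θ
      have hcd : ContDiff ℝ (⊤ : ℕ∞) (fun r : ℝ => f (r * e θ)) := by
        refine hf.comp ?_
        exact (Complex.ofRealCLM.contDiff).mul contDiff_const
      have hcs : HasCompactSupport (fun r : ℝ => f (r * e θ)) := by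
        obtain ⟨S, hS⟩ := hc.isCompact.isBounded.subset_closedBall 0
        refine HasCompactSupport.intro (isCompact_closedBall (0 : ℝ) S) fun r hr => ?_
        by_contra hne
        have := hS (subset_tsupport _ hne)
        rw [mem_closedBall_zero_iff, norm_mul, he1, mul_one, Complex.norm_real] at this
        exact hr (by simpa using this)
      have h3 := hcs.integral_Ioi_deriv_eq (hcd.of_le (by simp)) 0
      have h4 : ∀ r : ℝ, deriv (fun r : ℝ => f (r * e θ)) r = A (r, θ) := by
        intro r
        have h5 : HasDerivAt (fun r : ℝ => (r : ℂ) * e θ) (1 * e θ) r :=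
          (Complex.ofRealCLM.hasDerivAt).mul_const _
        have h6 := (hf.differentiableAt_infty (r * e θ)).hasFDerivAt.comp_hasDerivAt r h5
        rw [one_mul] at h6
        exact h6.deriv
      simp_rw [h4] at h3
      rw [h3]
      simp
    simp_rw [h2]
    rw [setIntegral_const, measureReal_def, Real.volume_Ioo, ENNReal.toReal_ofReal
      (by linarith [Real.pi_pos]), Complex.real_smul]
    push_cast
    ring
  have hBint : ∫ p in Set.Ioi 0 ×ˢ Set.Ioo (-Real.pi) Real.pi, B p = 0 := by
    have h1 := setIntegral_prod (μ := volume) (ν := volume) B hBi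
    rw [Measure.volume_eq_prod, h1]
    refine setIntegral_eq_zero_of_forall_eq_zero fun r hr => ?_
    have hr0 : (r : ℂ) ≠ 0 := by
      simpa using (ne_of_gt hr : r ≠ 0)
    rw [← integral_Ioc_eq_integral_Ioo, ← intervalIntegral.integral_of_le
      (by linarith [Real.pi_pos])]
    have h2 : ∀ θ : ℝ, HasDerivAt (fun θ : ℝ => (r : ℂ)⁻¹ * f (r * e θ)) (B (r, θ)) θ := by
      intro θ
      have h5 : HasDerivAt (fun θ : ℝ => (r : ℂ) * e θ) (r * (e θ * (1 * Complex.I))) θ :=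
        (((Complex.ofRealCLM.hasDerivAt (x := θ)).mul_const Complex.I).cexp).const_mul _
      have h6 := ((hf.differentiableAt_infty (r * e θ)).hasFDerivAt.comp_hasDerivAt θ
        h5).const_mul ((r : ℂ)⁻¹)
      have hval : (r : ℂ)⁻¹ * fderiv ℝ f (r * e θ) (r * (e θ * (1 * Complex.I))) = B (r, θ) := by
        have : (r : ℂ) * (e θ * (1 * Complex.I)) = r • (Complex.I * e θ) := by
          rw [Complex.real_smul]
          ring
        rw [this, map_smul, Complex.real_smul, ← mul_assoc, inv_mul_cancel₀ hr0, one_mul]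
      rw [hval] at h6
      exact h6
    rw [intervalIntegral.integral_eq_sub_of_hasDerivAt (fun θ _ => h2 θ)
      (Continuous.intervalIntegrable (by fun_prop) _ _)]
    have h7 : e Real.pi = e (-Real.pi) := by
      simp only [e]
      push_cast
      rw [Complex.exp_pi_mul_I, neg_mul, Complex.exp_neg, Complex.exp_pi_mul_I]
      norm_num
    rw [h7, sub_self]
  rw [← Complex.integral_comp_polarCoord_symm, polarCoord_target]
  have key : ∀ p ∈ Set.Ioi (0 : ℝ) ×ˢ Set.Ioo (-Real.pi) Real.pi,
      p.1 • ((fderiv ℝ f (Complex.polarCoord.symm p) 1 +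
        Complex.I * fderiv ℝ f (Complex.polarCoord.symm p) Complex.I) /
          Complex.polarCoord.symm p) = A p + Complex.I * B p := by
    intro p hp
    have hp0 : (p.1 : ℂ) ≠ 0 := by
      simpa using (ne_of_gt hp.1 : p.1 ≠ 0)
    have hpe : Complex.polarCoord.symm p = p.1 * e p.2 := by
      rw [Complex.polarCoord_symm_apply]
      simp only [e, Complex.exp_mul_I]
      push_cast
      rfl
    have hre : (e p.2).re = Real.cos p.2 := by
      simp only [e, Complex.exp_ofReal_mul_I_re]
    have him : (e p.2).im = Real.sin p.2 := by
      simp only [e, Complex.exp_ofReal_mul_I_im]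
    have hene : e p.2 ≠ 0 := Complex.exp_ne_zero _
    have hid : (Real.cos p.2 : ℂ) ^ 2 + (Real.sin p.2 : ℂ) ^ 2 = 1 := by
      exact_mod_cast Real.cos_sq_add_sin_sq p.2
    have hee : e p.2 = (Real.cos p.2 : ℂ) + (Real.sin p.2 : ℂ) * Complex.I := by
      simp only [e, Complex.exp_mul_I]
      push_cast
      rfl
    rw [hpe]
    simp only [A, B]
    rw [fderiv_complex_apply f _ (e p.2), fderiv_complex_apply f _ (Complex.I * e p.2)]
    have hre2 : (Complex.I * e p.2).re = - Real.sin p.2 := by simp [him]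
    have him2 : (Complex.I * e p.2).im = Real.cos p.2 := by simp [hre]
    rw [hre, him, hre2, him2, Complex.real_smul]
    generalize fderiv ℝ f (p.1 * e p.2) 1 = x
    generalize fderiv ℝ f (p.1 * e p.2) Complex.I = y
    rw [← mul_div_assoc, mul_div_mul_left _ _ hp0, div_eq_iff hene, hee]
    push_cast at hid ⊢
    linear_combination (-(x + Complex.I * y)) * hid +
      (x * Complex.sin p.2 ^ 2 - y * Complex.sin p.2 * Complex.cos p.2) * Complex.I_sq
  rw [setIntegral_congr_fun (measurableSet_Ioi.prod measurableSet_Ioo) key]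
  rw [integral_add hAi (hBi.const_mul _), integral_const_mul, hAint, hBint, mul_zero, add_zero]

/-! ### Powers of the norm and interior gradient estimates -/

theorem volume_ball_complex_real (X : ℂ) {r : ℝ} (hr : 0 ≤ r) :
    volume.real (ball X r) = Real.pi * r ^ 2 := by
  rw [measureReal_def, Complex.volume_ball, ENNReal.toReal_mul, ENNReal.toReal_pow,
    ENNReal.toReal_ofReal hr]
  simp [mul_comm]

theorem integrableOn_norm_rpow {q r : ℝ} (hq : q < 2) :
    IntegrableOn (fun w : ℂ => ‖w‖ ^ (-q)) (ball 0 r) := by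
  refine (integrableOn_fun_norm_addHaar (E := ℂ) volume (f := fun y : ℝ => y ^ (-q))
    (r := r)).2 ?_
  rw [Complex.finrank_real_complex]
  have h1 : IntegrableOn (fun y : ℝ => y ^ (1 - q)) (Set.Ioo 0 r) := by
    rcases le_or_gt 0 r with h | h
    · have := (intervalIntegral.intervalIntegrable_rpow' (a := 0) (b := r)
        (show -1 < 1 - q by linarith)).1
      exact this.mono_set Set.Ioo_subset_Ioc_self
    · simp [Set.Ioo_eq_empty_of_le h.le]
  refine h1.congr_fun (fun y hy => ?_) measurableSet_Ioo
  simp only [smul_eq_mul, Nat.add_one_sub_one, pow_one]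
  rw [show 1 - q = 1 + -q by ring, Real.rpow_add hy.1, Real.rpow_one]

theorem integral_norm_rpow {q r : ℝ} (hq : q < 2) (hr : 0 ≤ r) :
    ∫ w in ball (0 : ℂ) r, ‖w‖ ^ (-q) = 2 * Real.pi / (2 - q) * r ^ (2 - q) := by
  have h0 : ∫ w in ball (0 : ℂ) r, ‖w‖ ^ (-q) =
      ∫ w : ℂ, (Set.Iio r).indicator (fun y : ℝ => y ^ (-q)) ‖w‖ := by
    rw [← integral_indicator measurableSet_ball]
    congr 1
    ext w
    simp [Set.indicator]
  rw [h0, integral_fun_norm_addHaar, Complex.finrank_real_complex,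
    volume_ball_complex_real 0 zero_le_one]
  have h1 : ∫ y in Set.Ioi (0 : ℝ), y ^ (2 - 1) •
      (Set.Iio r).indicator (fun y : ℝ => y ^ (-q)) y = ∫ y in (0 : ℝ)..r, y ^ (1 - q) := by
    have e1 : ∀ y ∈ Set.Ioi (0 : ℝ), y ^ (2 - 1) • (Set.Iio r).indicator
        (fun y : ℝ => y ^ (-q)) y = (Set.Iio r).indicator (fun y : ℝ => y ^ (1 - q)) y := by
      intro y hy
      by_cases h : y ∈ Set.Iio r
      · simp only [Set.indicator_of_mem h, smul_eq_mul, Nat.add_one_sub_one, pow_one]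
        rw [show 1 - q = 1 + -q by ring, Real.rpow_add hy, Real.rpow_one]
      · simp [Set.indicator_of_notMem h]
    rw [setIntegral_congr_fun measurableSet_Ioi e1, setIntegral_indicator measurableSet_Iio,
      intervalIntegral.integral_of_le hr, integral_Ioc_eq_integral_Ioo, Set.Ioi_inter_Iio]
  rw [h1, integral_rpow (Or.inl (by linarith)), Real.zero_rpow (by linarith)]
  rw [show 1 - q + 1 = 2 - q by ring]
  simp only [smul_eq_mul, nsmul_eq_mul]
  push_cast
  have : 2 - q ≠ 0 := by linarith
  field_simp
  ring

theorem integrableOn_norm_sub_rpow {q r : ℝ} (hq : q < 2) (w : ℂ) :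
    IntegrableOn (fun z : ℂ => ‖z - w‖ ^ (-q)) (ball w r) := by
  have h := (measurePreserving_sub_right (volume : Measure ℂ) w).integrableOn_comp_preimage
    (measurableEmbedding_subRight w) (f := fun z => ‖z‖ ^ (-q)) (s := ball 0 r)
  have e : (fun x : ℂ => x - w) ⁻¹' ball 0 r = ball w r := by
    ext z
    simp [dist_eq_norm]
  rw [e] at h
  exact h.2 (integrableOn_norm_rpow hq)

theorem integral_norm_sub_rpow {q r : ℝ} (hq : q < 2) (hr : 0 ≤ r) (w : ℂ) :
    ∫ z in ball w r, ‖z - w‖ ^ (-q) = 2 * Real.pi / (2 - q) * r ^ (2 - q) := by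
  have h := (measurePreserving_sub_right (volume : Measure ℂ) w).setIntegral_preimage_emb
    (measurableEmbedding_subRight w) (fun z => ‖z‖ ^ (-q)) (ball 0 r)
  have e : (fun x : ℂ => x - w) ⁻¹' ball 0 r = ball w r := by
    ext z
    simp [dist_eq_norm]
  rw [e, integral_norm_rpow hq hr] at h
  exact h

theorem norm_sub_rpow_le {q r : ℝ} (hq : 0 ≤ q) (hr : 0 < r) (z w : ℂ) :
    ‖z - w‖ ^ (-q) ≤ (ball w r).indicator (fun z => ‖z - w‖ ^ (-q)) z + r ^ (-q) := by
  by_cases hz : z ∈ ball w r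
  · rw [Set.indicator_of_mem hz]
    have := Real.rpow_nonneg hr.le (-q)
    linarith
  · rw [Set.indicator_of_notMem hz, zero_add]
    apply Real.rpow_le_rpow_of_nonpos hr _ (by linarith)
    simpa [dist_eq_norm] using hz

theorem integrableOn_ball_norm_sub_rpow {q r : ℝ} (hq : 0 ≤ q) (hq2 : q < 2) (hr : 0 < r)
    (X w : ℂ) : IntegrableOn (fun z : ℂ => ‖z - w‖ ^ (-q)) (ball X r) := by
  have h1 : IntegrableOn (fun z => (ball w r).indicator (fun z => ‖z - w‖ ^ (-q)) z + r ^ (-q))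
      (ball X r) :=
    ((integrable_indicator_iff measurableSet_ball).2
      (integrableOn_norm_sub_rpow hq2 w)).integrableOn.add (integrableOn_const measure_ball_lt_top.ne)
  refine h1.mono' ?_ (Eventually.of_forall fun z => ?_)
  · exact ((measurable_id.sub_const w).norm.pow_const _).aestronglyMeasurable
  · rw [Real.norm_eq_abs, abs_of_nonneg (by positivity)]
    exact norm_sub_rpow_le hq hr z w

theorem integral_ball_norm_sub_rpow_le {q r : ℝ} (hq : 0 ≤ q) (hq2 : q < 2) (hr : 0 < r)
    (X w : ℂ) : ∫ z in ball X r, ‖z - w‖ ^ (-q) ≤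
      (2 * Real.pi / (2 - q) + Real.pi) * r ^ (2 - q) := by
  have hi := (integrable_indicator_iff measurableSet_ball).2
      (integrableOn_norm_sub_rpow (r := r) hq2 w)
  have hc : IntegrableOn (fun _ : ℂ => r ^ (-q)) (ball X r) := integrableOn_const measure_ball_lt_top.ne
  have h1 : ∫ z in ball X r, ‖z - w‖ ^ (-q) ≤ ∫ z in ball X r,
      ((ball w r).indicator (fun z => ‖z - w‖ ^ (-q)) z + r ^ (-q)) :=
    integral_mono (integrableOn_ball_norm_sub_rpow hq hq2 hr X w) (hi.integrableOn.add hc)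
      fun z => norm_sub_rpow_le hq hr z w
  rw [integral_add hi.integrableOn hc, setIntegral_const, volume_ball_complex_real X hr.le] at h1
  have h2 : ∫ z in ball X r, (ball w r).indicator (fun z => ‖z - w‖ ^ (-q)) z ≤
      ∫ z in ball w r, ‖z - w‖ ^ (-q) := by
    refine (setIntegral_le_integral hi (Eventually.of_forall fun z => ?_)).trans_eq
      (integral_indicator measurableSet_ball)
    exact Set.indicator_nonneg (fun _ _ => by positivity) _
  rw [integral_norm_sub_rpow hq2 hr.le] at h2
  have e : r ^ (2 - q) = r ^ 2 * r ^ (-q) := by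
    rw [sub_eq_add_neg, Real.rpow_add hr]
    norm_num
  rw [smul_eq_mul] at h1
  have : Real.pi * r ^ 2 * r ^ (-q) = Real.pi * r ^ (2 - q) := by rw [e]; ring
  linarith

/-- Recovering a compactly supported vector field from its divergence and its curl. -/
theorem integral_div_curl_div {P Q : ℂ → ℝ} (hP : ContDiff ℝ (⊤ : ℕ∞) P)
    (hQ : ContDiff ℝ (⊤ : ℕ∞) Q) (hPc : HasCompactSupport P) (hQc : HasCompactSupport Q) :
    ∫ w : ℂ, (((dX P w + dY Q w : ℝ) : ℂ) - Complex.I * ((dX Q w - dY P w : ℝ) : ℂ)) / w =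
      -(2 * Real.pi) * ((P 0 : ℂ) - Complex.I * (Q 0 : ℂ)) := by
  have hPC : ContDiff ℝ (⊤ : ℕ∞) (fun w => (P w : ℂ)) := Complex.ofRealCLM.contDiff.comp hP
  have hQC : ContDiff ℝ (⊤ : ℕ∞) (fun w => (Q w : ℂ)) := Complex.ofRealCLM.contDiff.comp hQ
  have hf : ContDiff ℝ (⊤ : ℕ∞) (fun w => (P w : ℂ) - Complex.I * (Q w : ℂ)) :=
    hPC.sub (contDiff_const.mul hQC)
  have hc : HasCompactSupport (fun w => (P w : ℂ) - Complex.I * (Q w : ℂ)) := by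
    refine HasCompactSupport.sub ?_ (HasCompactSupport.mul_left ?_)
    · exact hPc.comp_left (g := fun x : ℝ => (x : ℂ)) rfl
    · exact hQc.comp_left (g := fun x : ℝ => (x : ℂ)) rfl
  rw [← integral_cauchyRiemann_div hf hc]
  congr 1
  ext w
  have h1 : ∀ v, fderiv ℝ (fun w => (P w : ℂ) - Complex.I * (Q w : ℂ)) w v =
      (fderiv ℝ P w v : ℂ) - Complex.I * (fderiv ℝ Q w v : ℂ) := by
    intro v
    have a1 : HasFDerivAt (fun w => (P w : ℂ)) (Complex.ofRealCLM.comp (fderiv ℝ P w)) w :=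
      Complex.ofRealCLM.hasFDerivAt.comp w (hP.differentiableAt_infty w).hasFDerivAt
    have a2 : HasFDerivAt (fun w => (Q w : ℂ)) (Complex.ofRealCLM.comp (fderiv ℝ Q w)) w :=
      Complex.ofRealCLM.hasFDerivAt.comp w (hQ.differentiableAt_infty w).hasFDerivAt
    have a3 : HasFDerivAt (fun w => (P w : ℂ) - Complex.I * (Q w : ℂ)) _ w :=
      a1.sub (a2.const_mul Complex.I)
    rw [a3.fderiv]
    simp
  rw [h1, h1]
  congr 1
  simp only [dX, dY]
  push_cast
  linear_combination (fderiv ℝ Q w Complex.I : ℂ) * Complex.I_sq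

theorem integrable_div_of_continuous {s : ℂ → ℂ} (hs : Continuous s) (hc : HasCompactSupport s) :
    Integrable (fun w => s w / w) := by
  obtain ⟨S, hS⟩ := hc.isCompact.isBounded.subset_ball 0
  obtain ⟨K, hK⟩ := hs.bounded_above_of_compact_support hc
  have h1 : IntegrableOn (fun w : ℂ => K * ‖w‖ ^ (-(1 : ℝ))) (ball 0 S) :=
    (integrableOn_norm_rpow (by norm_num)).const_mul K
  have h2 : IntegrableOn (fun w => s w / w) (ball 0 S) := by
    refine h1.mono' (hs.measurable.div measurable_id).aestronglyMeasurable
      (Eventually.of_forall fun w => ?_)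
    rw [norm_div, Real.rpow_neg_one, div_eq_mul_inv]
    gcongr
    exact hK w
  refine (integrableOn_iff_integrable_of_support_subset fun w hw => ?_).1 h2
  apply hS
  apply subset_tsupport
  intro h0
  apply hw
  simp [h0]

theorem contDiff_deriv_cutProfile : ContDiff ℝ (⊤ : ℕ∞) (deriv cutProfile) :=
  (contDiff_infty_iff_deriv.1 contDiff_cutProfile).2

theorem integral_mul_dX_eq {k f : ℂ → ℝ} (hk : ContDiff ℝ (⊤ : ℕ∞) k)
    (hf : ContDiff ℝ (⊤ : ℕ∞) f) (hkc : HasCompactSupport k) :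
    ∫ z, k z * dX f z = ∫ z, -(dX k z * f z) := by
  refine integral_eq_of_eq_add_div (F := fun z => k z * f z) (G := fun _ => 0)
    ?_ ?_ (by fun_prop) (by fun_prop) hkc.mul_right ?_ fun z => ?_
  · exact Continuous.integrable_of_hasCompactSupport (by fun_prop : ContDiff ℝ (⊤ : ℕ∞)
      (fun z => k z * dX f z)).continuous hkc.mul_right
  · exact (Continuous.integrable_of_hasCompactSupport (by fun_prop : ContDiff ℝ (⊤ : ℕ∞)
      (fun z => dX k z * f z)).continuous hkc.dX.mul_right).neg
  · exact HasCompactSupport.zero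
  · rw [dX_mul hk hf, dY_const]
    ring

theorem integral_mul_dY_eq {k f : ℂ → ℝ} (hk : ContDiff ℝ (⊤ : ℕ∞) k)
    (hf : ContDiff ℝ (⊤ : ℕ∞) f) (hkc : HasCompactSupport k) :
    ∫ z, k z * dY f z = ∫ z, -(dY k z * f z) := by
  refine integral_eq_of_eq_add_div (F := fun _ => 0) (G := fun z => k z * f z)
    ?_ ?_ (by fun_prop) (by fun_prop) ?_ hkc.mul_right fun z => ?_
  · exact Continuous.integrable_of_hasCompactSupport (by fun_prop : ContDiff ℝ (⊤ : ℕ∞)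
      (fun z => k z * dY f z)).continuous hkc.mul_right
  · exact (Continuous.integrable_of_hasCompactSupport (by fun_prop : ContDiff ℝ (⊤ : ℕ∞)
      (fun z => dY k z * f z)).continuous hkc.dY.mul_right).neg
  · exact HasCompactSupport.zero
  · rw [dY_mul hk hf, dX_const]
    ring

theorem abs_integral_neg_mul_le {k f : ℂ → ℝ} {M : ℝ} (hk : Integrable k) (hM : ∀ z, |f z| ≤ M) :
    |∫ z, -(k z * f z)| ≤ M * ∫ z, |k z| := by
  rw [← integral_const_mul, ← Real.norm_eq_abs]
  refine norm_integral_le_of_norm_le (hk.abs.const_mul M) (Eventually.of_forall fun z => ?_)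
  rw [norm_neg, norm_mul, Real.norm_eq_abs, Real.norm_eq_abs, mul_comm]
  exact mul_le_mul_of_nonneg_right (hM z) (abs_nonneg _)

theorem exists_gradient_bound_zero : ∃ C : ℝ, 0 < C ∧ ∀ (f : ℂ → ℝ) (M N : ℝ),
    ContDiff ℝ (⊤ : ℕ∞) f → (∀ z, |f z| ≤ M) → (∀ z, |dX (dX f) z + dY (dY f) z| ≤ N) →
    dX f 0 ^ 2 + dY f 0 ^ 2 ≤ (C * (M + N)) ^ 2 := by
  set k : ℂ → ℝ := fun w => 2 * deriv cutProfile (w.re ^ 2 + w.im ^ 2) with hk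
  have hks : ContDiff ℝ (⊤ : ℕ∞) k := by
    have := contDiff_deriv_cutProfile
    fun_prop
  have hkc : HasCompactSupport k := by
    refine HasCompactSupport.of_eq_zero_of_lt 2 fun z hz => ?_
    have : 2 < z.re ^ 2 + z.im ^ 2 := by
      rw [← norm_sq_eq_re_im]
      nlinarith
    simp [hk, deriv_cutProfile_of_gt this]
  have hθ := contDiff_cutoff 1
  have hθc := hasCompactSupport_cutoff one_pos
  have hdθX : ∀ z, dX (cutoff 1) z = k z * z.re := fun z => by
    rw [dX_cutoff, hk]
    simp
    ring
  have hdθY : ∀ z, dY (cutoff 1) z = k z * z.im := fun z => by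
    rw [dY_cutoff, hk]
    simp
    ring
  have hθi : Integrable (fun w => ‖((cutoff 1 w : ℝ) : ℂ) / w‖) := by
    refine (integrable_div_of_continuous (s := fun w => ((cutoff 1 w : ℝ) : ℂ)) ?_ ?_).norm
    · exact Complex.continuous_ofReal.comp hθ.continuous
    · exact hθc.comp_left (g := fun x : ℝ => (x : ℂ)) rfl
  set A := ∫ w, ‖((cutoff 1 w : ℝ) : ℂ) / w‖ with hA
  have hkX : Integrable (dX k) := (contDiff_dX hks).continuous.integrable_of_hasCompactSupport
    hkc.dX
  have hkY : Integrable (dY k) := (contDiff_dY hks).continuous.integrable_of_hasCompactSupport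
    hkc.dY
  set B := ∫ w, |dX k w| with hB
  set D := ∫ w, |dY k w| with hD
  have hA0 : 0 ≤ A := integral_nonneg fun _ => norm_nonneg _
  have hB0 : 0 ≤ B := integral_nonneg fun _ => abs_nonneg _
  have hD0 : 0 ≤ D := integral_nonneg fun _ => abs_nonneg _
  refine ⟨A + B + D + 1, by positivity, fun f M N hf hM hN => ?_⟩
  have hM0 : 0 ≤ M := (abs_nonneg _).trans (hM 0)
  have hN0 : 0 ≤ N := (abs_nonneg _).trans (hN 0)
  have h1 := integral_div_curl_div (P := fun z => cutoff 1 z * dX f z)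
    (Q := fun z => cutoff 1 z * dY f z) (by fun_prop) (by fun_prop) hθc.mul_right hθc.mul_right
  set L : ℂ → ℝ := fun z => dX (dX f) z + dY (dY f) z with hL
  have hLs : ContDiff ℝ (⊤ : ℕ∞) L := by fun_prop
  have e1 : ∀ w : ℂ, (((dX (fun z => cutoff 1 z * dX f z) w + dY (fun z => cutoff 1 z * dY f z) w
      : ℝ) : ℂ) - Complex.I * ((dX (fun z => cutoff 1 z * dY f z) w -
      dY (fun z => cutoff 1 z * dX f z) w : ℝ) : ℂ)) / w =
      ((cutoff 1 w * L w : ℝ) : ℂ) / w +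
        (((k w * dX f w : ℝ) : ℂ) - Complex.I * ((k w * dY f w : ℝ) : ℂ)) := by
    intro w
    simp (disch := fun_prop) only [dX_mul, dY_mul]
    rw [dX_dY_comm hf, hdθX, hdθY]
    rcases eq_or_ne w 0 with rfl | hw
    · have : k 0 = 0 := by
        simp only [hk]
        rw [deriv_cutProfile_of_lt (by simp)]
        simp
      simp [this]
    · rw [div_add' _ _ _ hw]
      congr 1
      have hw2 : w = (w.re : ℂ) + (w.im : ℂ) * Complex.I := (Complex.re_add_im w).symm
      simp only [hL]
      push_cast
      linear_combination (-(k w : ℂ) * ((dX f w : ℂ) - Complex.I * (dY f w : ℂ))) * hw2 +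
        ((k w : ℂ) * (dY f w : ℂ) * w.im) * Complex.I_sq
  simp_rw [e1] at h1
  have i1 : Integrable (fun w => ((cutoff 1 w * L w : ℝ) : ℂ) / w) := by
    refine integrable_div_of_continuous (s := fun w => ((cutoff 1 w * L w : ℝ) : ℂ)) ?_ ?_
    · exact Complex.continuous_ofReal.comp (hθ.mul hLs).continuous
    · exact (hθc.mul_right (f' := L)).comp_left (g := fun x : ℝ => (x : ℂ)) rfl
  have i2 : Integrable (fun w => k w * dX f w) :=
    Continuous.integrable_of_hasCompactSupport (hks.mul (contDiff_dX hf)).continuous hkc.mul_right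
  have i3 : Integrable (fun w => k w * dY f w) :=
    Continuous.integrable_of_hasCompactSupport (hks.mul (contDiff_dY hf)).continuous hkc.mul_right
  have i4 : Integrable (fun w => Complex.I * ((k w * dY f w : ℝ) : ℂ)) := i3.ofReal.const_mul _
  have i5 : Integrable (fun w => ((k w * dX f w : ℝ) : ℂ) -
      Complex.I * ((k w * dY f w : ℝ) : ℂ)) := i2.ofReal.sub i4
  have i6 : Integrable (fun w => ((k w * dX f w : ℝ) : ℂ)) := i2.ofReal
  rw [integral_add i1 i5, integral_sub i6 i4, integral_const_mul,
    integral_complex_ofReal, integral_complex_ofReal, integral_mul_dX_eq hks hf hkc, integral_mul_dY_eq hks hf hkc,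
    cutoff_eq_one one_pos (by simp)] at h1
  have b1 : ‖∫ w, ((cutoff 1 w * L w : ℝ) : ℂ) / w‖ ≤ N * A := by
    rw [hA, ← integral_const_mul]
    refine norm_integral_le_of_norm_le (hθi.const_mul N) (Eventually.of_forall fun w => ?_)
    rw [Complex.ofReal_mul, mul_comm (cutoff 1 w : ℂ), mul_div_assoc, norm_mul]
    refine mul_le_mul_of_nonneg_right ?_ (norm_nonneg _)
    rw [Complex.norm_real]
    exact hN w
  have b2 := abs_integral_neg_mul_le hkX hM
  have b3 := abs_integral_neg_mul_le hkY hM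
  rw [← hB] at b2
  rw [← hD] at b3
  set x := ∫ z, -(dX k z * f z)
  set y := ∫ z, -(dY k z * f z)
  have hn : ‖((-(2 * Real.pi) : ℂ)) * ((dX f 0 : ℂ) - Complex.I * (dY f 0 : ℂ))‖ ≤
      (A + B + D + 1) * (M + N) := by
    simp only [one_mul] at h1
    rw [← h1]
    refine (norm_add_le _ _).trans ?_
    have : ‖(x : ℂ) - Complex.I * (y : ℂ)‖ ≤ |x| + |y| := by
      refine (norm_sub_le _ _).trans ?_
      rw [norm_mul, Complex.norm_I, one_mul, Complex.norm_real, Complex.norm_real]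
      rfl
    nlinarith [mul_nonneg hA0 hM0, mul_nonneg hB0 hN0, mul_nonneg hD0 hN0]
  have hnorm : ‖((dX f 0 : ℂ) - Complex.I * (dY f 0 : ℂ))‖ ^ 2 = dX f 0 ^ 2 + dY f 0 ^ 2 := by
    rw [norm_sq_eq_re_im]
    simp
  rw [← hnorm]
  rw [norm_mul, norm_neg] at hn
  have hpi : (1 : ℝ) ≤ ‖(2 * Real.pi : ℂ)‖ := by
    rw [norm_mul, Complex.norm_real, Real.norm_eq_abs, abs_of_pos Real.pi_pos]
    simp
    linarith [Real.pi_gt_three]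
  have : ‖((dX f 0 : ℂ) - Complex.I * (dY f 0 : ℂ))‖ ≤ (A + B + D + 1) * (M + N) := by
    refine le_trans ?_ hn
    exact le_mul_of_one_le_left (norm_nonneg _) hpi
  gcongr

theorem exists_gradient_bound : ∃ C : ℝ, 0 < C ∧ ∀ (f : ℂ → ℝ) (M N : ℝ),
    ContDiff ℝ (⊤ : ℕ∞) f → (∀ z, |f z| ≤ M) → (∀ z, |dX (dX f) z + dY (dY f) z| ≤ N) →
    ∀ z, dX f z ^ 2 + dY f z ^ 2 ≤ (C * (M + N)) ^ 2 := by
  obtain ⟨C, hC, h⟩ := exists_gradient_bound_zero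
  refine ⟨C, hC, fun f M N hf hM hN z => ?_⟩
  have e1 : ∀ g : ℂ → ℝ, dX (fun w => g (w + z)) = fun w => dX g (w + z) :=
    fun g => funext fun w => dX_comp_add_right g z w
  have e2 : ∀ g : ℂ → ℝ, dY (fun w => g (w + z)) = fun w => dY g (w + z) :=
    fun g => funext fun w => dY_comp_add_right g z w
  have := h (fun w => f (w + z)) M N (hf.comp (contDiff_id.add contDiff_const))
    (fun w => hM _) (fun w => by rw [e1, e2, e1, e2]; exact hN _)
  rw [e1, e2] at this
  simpa using this

theorem dY_cos_mul_im (k : ℝ) (z : ℂ) :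
    dY (fun w => Real.cos (k * w.im)) z = -(k * Real.sin (k * z.im)) := by
  have := dY_comp (φ := Real.cos) (f := fun w => k * w.im) Real.contDiff_cos (by fun_prop) z
  rw [this, dY_const_mul k (by fun_prop), dY_im, Real.deriv_cos]
  ring

theorem dY_sin_mul_im (k : ℝ) (z : ℂ) :
    dY (fun w => Real.sin (k * w.im)) z = k * Real.cos (k * z.im) := by
  have := dY_comp (φ := Real.sin) (f := fun w => k * w.im) Real.contDiff_sin (by fun_prop) z
  rw [this, dY_const_mul k (by fun_prop), dY_im, Real.deriv_sin]
  ring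

theorem dX_cos_mul_im (k : ℝ) (z : ℂ) : dX (fun w => Real.cos (k * w.im)) z = 0 := by
  have := dX_comp (φ := Real.cos) (f := fun w => k * w.im) Real.contDiff_cos (by fun_prop) z
  rw [this, dX_const_mul k (by fun_prop), dX_im]
  ring

theorem dX_sin_mul_im (k : ℝ) (z : ℂ) : dX (fun w => Real.sin (k * w.im)) z = 0 := by
  have := dX_comp (φ := Real.sin) (f := fun w => k * w.im) Real.contDiff_sin (by fun_prop) z
  rw [this, dX_const_mul k (by fun_prop), dX_im]
  ring

/-- Travelling waves of bounded modulus and speed have a bounded gradient. -/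
theorem exists_gsq_le : ∃ L : ℝ, 1 ≤ L ∧ ∀ (a b : ℂ → ℝ) (c : ℝ), IsWave a b c → |c| ≤ 1 →
    (∀ z, msq a b z ≤ 2) → ∀ z, gsq a b z ≤ L ^ 2 := by
  obtain ⟨K, hK, hgrad⟩ := exists_gradient_bound
  refine ⟨12 * K + 2, by linarith, fun a b c h hc hW z => ?_⟩
  have ha := h.smooth_re
  have hb := h.smooth_im
  set k := c / 2 with hk
  have hck : c = 2 * k := by rw [hk]; ring
  have hk2 : k ^ 2 ≤ 1 / 4 := by
    have := sq_le_one_iff_abs_le_one c |>.2 hc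
    rw [hk]
    linarith [div_pow c 2 2]
  set P : ℂ → ℝ := fun w => Real.cos (k * w.im) with hP
  set Q : ℂ → ℝ := fun w => Real.sin (k * w.im) with hQ
  have hPs : ContDiff ℝ (⊤ : ℕ∞) P := Real.contDiff_cos.comp (by fun_prop)
  have hQs : ContDiff ℝ (⊤ : ℕ∞) Q := Real.contDiff_sin.comp (by fun_prop)
  have dPX : dX P = fun _ => 0 := funext fun w => dX_cos_mul_im k w
  have dQX : dX Q = fun _ => 0 := funext fun w => dX_sin_mul_im k w
  have dPY : dY P = fun w => -k * Q w := funext fun w => by rw [hP, dY_cos_mul_im]; ring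
  have dQY : dY Q = fun w => k * P w := funext fun w => dY_sin_mul_im k w
  have hPQ : ∀ w, P w ^ 2 + Q w ^ 2 = 1 := fun w => Real.cos_sq_add_sin_sq _
  set α : ℂ → ℝ := fun w => P w * a w - Q w * b w with hα
  set β : ℂ → ℝ := fun w => Q w * a w + P w * b w with hβ
  have hαs : ContDiff ℝ (⊤ : ℕ∞) α := by fun_prop
  have hβs : ContDiff ℝ (⊤ : ℕ∞) β := by fun_prop
  have hαβ : ∀ w, α w ^ 2 + β w ^ 2 = msq a b w := fun w => by
    simp only [hα, hβ, msq]
    linear_combination (a w ^ 2 + b w ^ 2) * hPQ w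
  have αX : dX α = fun w => P w * dX a w - Q w * dX b w := by
    ext w
    simp (disch := fun_prop) only [hα, dX_mul, dX_sub, dPX, dQX]
    ring
  have βX : dX β = fun w => Q w * dX a w + P w * dX b w := by
    ext w
    simp (disch := fun_prop) only [hβ, dX_mul, dX_add, dPX, dQX]
    ring
  have αY : dY α = fun w => P w * (dY a w - k * b w) - Q w * (dY b w + k * a w) := by
    ext w
    simp (disch := fun_prop) only [hα, dY_mul, dY_sub, dPY, dQY]
    ring
  have βY : dY β = fun w => Q w * (dY a w - k * b w) + P w * (dY b w + k * a w) := by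
    ext w
    simp (disch := fun_prop) only [hβ, dY_mul, dY_add, dPY, dQY]
    ring
  have lapα : ∀ w, dX (dX α) w + dY (dY α) w = -((1 - msq a b w + k ^ 2) * α w) := by
    intro w
    have h1 := h.eq_re w
    have h2 := h.eq_im w
    rw [αX, αY]
    simp (disch := fun_prop) only [hα, dY_mul, dY_sub, dX_mul, dX_sub, dY_add, dPY, dQY, dPX, dQX,
      dY_const]
    rw [hck] at h1 h2
    linear_combination P w * h1 - Q w * h2
  have lapβ : ∀ w, dX (dX β) w + dY (dY β) w = -((1 - msq a b w + k ^ 2) * β w) := by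
    intro w
    have h1 := h.eq_re w
    have h2 := h.eq_im w
    rw [βX, βY]
    simp (disch := fun_prop) only [hβ, dY_mul, dY_sub, dX_mul, dX_add, dY_add, dPY, dQY, dPX, dQX,
      dY_const]
    rw [hck] at h1 h2
    linear_combination Q w * h1 + P w * h2
  have hM : ∀ w, |α w| ≤ 2 ∧ |β w| ≤ 2 := fun w => by
    have := hαβ w
    have := hW w
    constructor <;> apply abs_le_of_sq_le_sq _ (by norm_num) <;> nlinarith [sq_nonneg (α w), sq_nonneg (β w)]
  have hV : ∀ w, |1 - msq a b w + k ^ 2| ≤ 2 := fun w => by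
    have := hW w
    have := msq_nonneg (a := a) (b := b) w
    rw [abs_le]
    constructor <;> nlinarith [sq_nonneg k]
  have g1 := hgrad α 2 4 hαs (fun w => (hM w).1) (fun w => by
    rw [lapα, abs_neg, abs_mul]
    nlinarith [hV w, (hM w).1, abs_nonneg (α w), abs_nonneg (1 - msq a b w + k ^ 2)]) z
  have g2 := hgrad β 2 4 hβs (fun w => (hM w).2) (fun w => by
    rw [lapβ, abs_neg, abs_mul]
    nlinarith [hV w, (hM w).2, abs_nonneg (β w), abs_nonneg (1 - msq a b w + k ^ 2)]) z
  have e1 : dX α z ^ 2 + dX β z ^ 2 = dX a z ^ 2 + dX b z ^ 2 := by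
    rw [αX, βX]
    linear_combination (dX a z ^ 2 + dX b z ^ 2) * hPQ z
  have e2 : dY α z ^ 2 + dY β z ^ 2 = (dY a z - k * b z) ^ 2 + (dY b z + k * a z) ^ 2 := by
    rw [αY, βY]
    linear_combination ((dY a z - k * b z) ^ 2 + (dY b z + k * a z) ^ 2) * hPQ z
  have e3 : dY a z ^ 2 + dY b z ^ 2 ≤ 2 * ((dY a z - k * b z) ^ 2 + (dY b z + k * a z) ^ 2) +
      2 * k ^ 2 * msq a b z := by
    rw [msq]
    nlinarith [sq_nonneg (dY a z - 2 * k * b z), sq_nonneg (dY b z + 2 * k * a z)]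
  have e4 : k ^ 2 * msq a b z ≤ 1 / 2 := by
    nlinarith [hW z, msq_nonneg (a := a) (b := b) z, sq_nonneg k]
  rw [gsq]
  nlinarith [sq_nonneg (dX a z), sq_nonneg (dX b z)]

/-! ### Logarithmic cutoffs and clearing-out -/

/-- Logarithmic cutoff centred at `m`. -/
def logCut (s : ℝ) (m z : ℂ) : ℝ :=
  cutProfile (s * Real.log (1 + ((z.re - m.re) ^ 2 + (z.im - m.im) ^ 2)))

theorem norm_sub_sq_eq (z m : ℂ) : ‖z - m‖ ^ 2 = (z.re - m.re) ^ 2 + (z.im - m.im) ^ 2 := by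
  rw [norm_sq_eq_re_im]
  simp

theorem contDiff_log_one_add_sq (m : ℂ) : ContDiff ℝ (⊤ : ℕ∞)
    (fun z : ℂ => Real.log (1 + ((z.re - m.re) ^ 2 + (z.im - m.im) ^ 2))) :=
  ContDiff.log (by fun_prop) fun z => by positivity

@[fun_prop]
theorem contDiff_logCut (s : ℝ) (m : ℂ) : ContDiff ℝ (⊤ : ℕ∞) (logCut s m) :=
  contDiff_cutProfile.comp (contDiff_const.mul (contDiff_log_one_add_sq m))

theorem logCut_nonneg (s : ℝ) (m z : ℂ) : 0 ≤ logCut s m z := cutProfile_nonneg _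

theorem logCut_le_one (s : ℝ) (m z : ℂ) : logCut s m z ≤ 1 := cutProfile_le_one _

theorem one_add_sq_le_of_le {s : ℝ} (hs : 0 < s) {x t : ℝ} (h : s * Real.log (1 + x ^ 2) ≤ t) :
    1 + x ^ 2 ≤ Real.exp (t / s) := by
  rw [← Real.log_le_iff_le_exp (by positivity), le_div_iff₀ hs]
  linarith

theorem one_add_sq_lt_of_lt {s : ℝ} (hs : 0 < s) {x t : ℝ} (h : t < s * Real.log (1 + x ^ 2)) :
    Real.exp (t / s) < 1 + x ^ 2 := by
  rw [← Real.lt_log_iff_exp_lt (by positivity), div_lt_iff₀ hs]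
  linarith

theorem logCut_eq_one {s : ℝ} (hs : 0 < s) {m z : ℂ} (h : 1 + ‖z - m‖ ^ 2 ≤ Real.exp (1 / s)) :
    logCut s m z = 1 := by
  apply cutProfile_eq_one
  rw [← norm_sub_sq_eq]
  by_contra! h2
  exact absurd (one_add_sq_lt_of_lt hs h2) (not_lt.2 h)

theorem logCut_eq_zero {s : ℝ} (hs : 0 < s) {m z : ℂ} (h : Real.exp (1 / s) ≤ ‖z - m‖) :
    logCut s m z = 0 := by
  apply cutProfile_eq_zero
  rw [← norm_sub_sq_eq]
  by_contra! h2
  have h3 := one_add_sq_le_of_le hs h2.le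
  have h4 : Real.exp (2 / s) = Real.exp (1 / s) ^ 2 := by
    rw [← Real.exp_nat_mul]
    congr 1
    push_cast
    ring
  have := Real.exp_pos (1 / s)
  nlinarith

theorem hasCompactSupport_logCut {s : ℝ} (hs : 0 < s) (m : ℂ) :
    HasCompactSupport (logCut s m) := by
  refine HasCompactSupport.of_eq_zero_of_lt (Real.exp (1 / s) + ‖m‖) fun z hz => ?_
  apply logCut_eq_zero hs
  have := norm_sub_norm_le z m
  linarith

theorem dX_logCut (s : ℝ) (m z : ℂ) : dX (logCut s m) z =
    deriv cutProfile (s * Real.log (1 + ‖z - m‖ ^ 2)) *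
      (2 * s * (z.re - m.re) / (1 + ‖z - m‖ ^ 2)) := by
  have hq : ContDiff ℝ (⊤ : ℕ∞) (fun z : ℂ => 1 + ((z.re - m.re) ^ 2 + (z.im - m.im) ^ 2)) := by
    fun_prop
  have hl : dX (fun z : ℂ => Real.log (1 + ((z.re - m.re) ^ 2 + (z.im - m.im) ^ 2))) z =
      2 * (z.re - m.re) / (1 + ((z.re - m.re) ^ 2 + (z.im - m.im) ^ 2)) := by
    have h1 := ((hq.differentiableAt_infty z).hasFDerivAt.log (by positivity))
    rw [dX_eq_of_hasFDerivAt h1]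
    change (_ : ℝ)⁻¹ * dX (fun z : ℂ => 1 + ((z.re - m.re) ^ 2 + (z.im - m.im) ^ 2)) z = _
    simp (disch := fun_prop) only [dX_add, dX_sub, dX_sq, dX_const, dX_re, dX_im]
    ring
  have h2 := dX_comp (f := fun z => s * Real.log (1 + ((z.re - m.re) ^ 2 + (z.im - m.im) ^ 2)))
    contDiff_cutProfile (contDiff_const.mul (contDiff_log_one_add_sq m)) z
  rw [show logCut s m = fun z => cutProfile (s * Real.log (1 + ((z.re - m.re) ^ 2 +
    (z.im - m.im) ^ 2))) from rfl, h2, dX_const_mul s (contDiff_log_one_add_sq m), hl,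
    norm_sub_sq_eq]
  ring

theorem dY_logCut (s : ℝ) (m z : ℂ) : dY (logCut s m) z =
    deriv cutProfile (s * Real.log (1 + ‖z - m‖ ^ 2)) *
      (2 * s * (z.im - m.im) / (1 + ‖z - m‖ ^ 2)) := by
  have hq : ContDiff ℝ (⊤ : ℕ∞) (fun z : ℂ => 1 + ((z.re - m.re) ^ 2 + (z.im - m.im) ^ 2)) := by
    fun_prop
  have hl : dY (fun z : ℂ => Real.log (1 + ((z.re - m.re) ^ 2 + (z.im - m.im) ^ 2))) z =
      2 * (z.im - m.im) / (1 + ((z.re - m.re) ^ 2 + (z.im - m.im) ^ 2)) := by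
    have h1 := ((hq.differentiableAt_infty z).hasFDerivAt.log (by positivity))
    rw [dY_eq_of_hasFDerivAt h1]
    change (_ : ℝ)⁻¹ * dY (fun z : ℂ => 1 + ((z.re - m.re) ^ 2 + (z.im - m.im) ^ 2)) z = _
    simp (disch := fun_prop) only [dY_add, dY_sub, dY_sq, dY_const, dY_re, dY_im]
    ring
  have h2 := dY_comp (f := fun z => s * Real.log (1 + ((z.re - m.re) ^ 2 + (z.im - m.im) ^ 2)))
    contDiff_cutProfile (contDiff_const.mul (contDiff_log_one_add_sq m)) z
  rw [show logCut s m = fun z => cutProfile (s * Real.log (1 + ((z.re - m.re) ^ 2 +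
    (z.im - m.im) ^ 2))) from rfl, h2, dY_const_mul s (contDiff_log_one_add_sq m), hl,
    norm_sub_sq_eq]
  ring

theorem gradient_logCut_eq (s : ℝ) (m z : ℂ) :
    dX (logCut s m) z ^ 2 + dY (logCut s m) z ^ 2 =
      deriv cutProfile (s * Real.log (1 + ‖z - m‖ ^ 2)) ^ 2 *
        (4 * s ^ 2 * ‖z - m‖ ^ 2 / (1 + ‖z - m‖ ^ 2) ^ 2) := by
  rw [dX_logCut, dY_logCut]
  have h : 1 + ‖z - m‖ ^ 2 ≠ 0 := by positivity
  have e := norm_sub_sq_eq z m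
  set N := ‖z - m‖ ^ 2
  set d := deriv cutProfile (s * Real.log (1 + N))
  field_simp
  rw [e]
  ring

theorem gradient_logCut_le (s : ℝ) (m z : ℂ) :
    dX (logCut s m) z ^ 2 + dY (logCut s m) z ^ 2 ≤
      (2 * cutConst * s) ^ 2 * (1 + ‖z - m‖ ^ 2)⁻¹ := by
  rw [gradient_logCut_eq]
  have h1 := abs_deriv_cutProfile_le (s * Real.log (1 + ‖z - m‖ ^ 2))
  set d := deriv cutProfile (s * Real.log (1 + ‖z - m‖ ^ 2))
  have h2 : d ^ 2 ≤ cutConst ^ 2 := sq_le_sq' (abs_le.1 h1).1 (abs_le.1 h1).2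
  have h3 : 4 * s ^ 2 * ‖z - m‖ ^ 2 / (1 + ‖z - m‖ ^ 2) ^ 2 ≤
      4 * s ^ 2 * (1 + ‖z - m‖ ^ 2)⁻¹ := by
    rw [← div_eq_mul_inv, div_le_div_iff₀ (by positivity) (by positivity)]
    have : 0 ≤ s ^ 2 * (1 + ‖z - m‖ ^ 2) := by positivity
    nlinarith
  calc _ ≤ cutConst ^ 2 * (4 * s ^ 2 * (1 + ‖z - m‖ ^ 2)⁻¹) := by gcongr
    _ = _ := by ring

theorem deriv_cutProfile_log_eq_zero {s : ℝ} (hs : 0 < s) {m z : ℂ}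
    (h : Real.exp (1 / s) ≤ ‖z - m‖) :
    deriv cutProfile (s * Real.log (1 + ‖z - m‖ ^ 2)) = 0 := by
  apply deriv_cutProfile_of_gt
  by_contra! h2
  have h3 := one_add_sq_le_of_le hs h2
  have h4 : Real.exp (2 / s) = Real.exp (1 / s) ^ 2 := by
    rw [← Real.exp_nat_mul]
    congr 1
    push_cast
    ring
  have := Real.exp_pos (1 / s)
  nlinarith

theorem gradient_logCut_le_exp {s : ℝ} (hs : 0 < s) (m z : ℂ) :
    dX (logCut s m) z ^ 2 + dY (logCut s m) z ^ 2 ≤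
      (2 * cutConst * s) ^ 2 * Real.exp (-(1 / s)) := by
  by_cases h : s * Real.log (1 + ‖z - m‖ ^ 2) < 1
  · rw [gradient_logCut_eq, deriv_cutProfile_of_lt h]
    simp
    positivity
  · refine (gradient_logCut_le s m z).trans ?_
    gcongr
    rw [Real.exp_neg]
    gcongr
    push Not at h
    rw [← Real.le_log_iff_exp_le (by positivity), div_le_iff₀ hs]
    linarith

theorem integral_ball_inv_one_add_sq (m : ℂ) {R : ℝ} (hR : 0 ≤ R) :
    ∫ z in ball m R, (1 + ‖z - m‖ ^ 2)⁻¹ = Real.pi * Real.log (1 + R ^ 2) := by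
  have hm := (measurePreserving_sub_right (volume : Measure ℂ) m).setIntegral_preimage_emb
    (measurableEmbedding_subRight m) (fun z => (1 + ‖z‖ ^ 2)⁻¹) (ball 0 R)
  have e : (fun x : ℂ => x - m) ⁻¹' ball 0 R = ball m R := by
    ext z
    simp [dist_eq_norm]
  rw [e] at hm
  rw [hm]
  have h0 : ∫ w in ball (0 : ℂ) R, (1 + ‖w‖ ^ 2)⁻¹ =
      ∫ w : ℂ, (Set.Iio R).indicator (fun y : ℝ => (1 + y ^ 2)⁻¹) ‖w‖ := by
    rw [← integral_indicator measurableSet_ball]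
    congr 1
    ext w
    simp [Set.indicator]
  rw [h0, integral_fun_norm_addHaar, Complex.finrank_real_complex,
    volume_ball_complex_real 0 zero_le_one]
  have h1 : ∫ y in Set.Ioi (0 : ℝ), y ^ (2 - 1) •
      (Set.Iio R).indicator (fun y : ℝ => (1 + y ^ 2)⁻¹) y = ∫ y in (0 : ℝ)..R, y / (1 + y ^ 2) := by
    have e1 : ∀ y ∈ Set.Ioi (0 : ℝ), y ^ (2 - 1) • (Set.Iio R).indicator
        (fun y : ℝ => (1 + y ^ 2)⁻¹) y = (Set.Iio R).indicator (fun y : ℝ => y / (1 + y ^ 2)) y := by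
      intro y hy
      by_cases h : y ∈ Set.Iio R
      · simp only [Set.indicator_of_mem h, smul_eq_mul, Nat.add_one_sub_one, pow_one, div_eq_mul_inv]
      · simp [Set.indicator_of_notMem h]
    rw [setIntegral_congr_fun measurableSet_Ioi e1, setIntegral_indicator measurableSet_Iio,
      intervalIntegral.integral_of_le hR, integral_Ioc_eq_integral_Ioo, Set.Ioi_inter_Iio]
  have h2 : ∫ y in (0 : ℝ)..R, y / (1 + y ^ 2) = Real.log (1 + R ^ 2) / 2 := by
    have := intervalIntegral.integral_eq_sub_of_hasDerivAt (a := 0) (b := R)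
      (f := fun y => Real.log (1 + y ^ 2) / 2) (f' := fun y => y / (1 + y ^ 2)) (fun y _ => ?_) ?_
    · rw [this]
      simp
    · have h3 : HasDerivAt (fun y : ℝ => 1 + y ^ 2) (2 * y) y := by
        simpa using (hasDerivAt_pow 2 y).const_add 1
      have h4 := (h3.log (by positivity)).div_const 2
      have e5 : y / (1 + y ^ 2) = 2 * y / (1 + y ^ 2) / 2 := by ring
      rw [e5]
      exact h4
    · apply Continuous.intervalIntegrable
      exact continuous_id.div (by fun_prop) fun y => by positivity
  rw [h1, h2]
  simp
  ring

theorem integrable_gradient_logCut {s : ℝ} (hs : 0 < s) (m : ℂ) :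
    Integrable (fun z => dX (logCut s m) z ^ 2 + dY (logCut s m) z ^ 2) := by
  have hc := hasCompactSupport_logCut hs m
  refine Continuous.integrable_of_hasCompactSupport ?_ ?_
  · exact (by fun_prop : ContDiff ℝ (⊤ : ℕ∞)
      (fun z => dX (logCut s m) z ^ 2 + dY (logCut s m) z ^ 2)).continuous
  · simp only [pow_two]
    exact hc.dX.mul_right.add hc.dY.mul_right

theorem integral_gradient_logCut_le {s : ℝ} (hs : 0 < s) (m : ℂ) :
    ∫ z, (dX (logCut s m) z ^ 2 + dY (logCut s m) z ^ 2) ≤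
      (2 * cutConst * s) ^ 2 * (Real.pi * (2 / s + 1)) := by
  set R := Real.exp (1 / s) with hR
  have hR0 : 0 < R := Real.exp_pos _
  have hci : IntegrableOn (fun z : ℂ => (1 + ‖z - m‖ ^ 2)⁻¹) (ball m R) := by
    refine ((Continuous.continuousOn ?_).integrableOn_compact (isCompact_closedBall m R)).mono_set
      ball_subset_closedBall
    exact Continuous.inv₀ (by fun_prop) fun z => by positivity
  have h1 : ∫ z, (dX (logCut s m) z ^ 2 + dY (logCut s m) z ^ 2) ≤
      ∫ z, (ball m R).indicator (fun z => (2 * cutConst * s) ^ 2 * (1 + ‖z - m‖ ^ 2)⁻¹) z := by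
    refine integral_mono (integrable_gradient_logCut hs m)
      ((integrable_indicator_iff measurableSet_ball).2 (hci.const_mul _)) fun z => ?_
    by_cases hz : z ∈ ball m R
    · simp only [Set.indicator_of_mem hz]
      exact gradient_logCut_le s m z
    · simp only [Set.indicator_of_notMem hz]
      rw [gradient_logCut_eq, deriv_cutProfile_log_eq_zero hs]
      · simp
      · rwa [mem_ball, dist_eq_norm, not_lt] at hz
  rw [integral_indicator measurableSet_ball, integral_const_mul,
    integral_ball_inv_one_add_sq m hR0.le] at h1
  refine h1.trans ?_
  gcongr
  have h2 : R ^ 2 = Real.exp (2 / s) := by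
    rw [hR, ← Real.exp_nat_mul]
    congr 1
    push_cast
    ring
  rw [h2, Real.log_le_iff_le_exp (by positivity), Real.exp_add]
  have h3 : 1 ≤ Real.exp (2 / s) := Real.one_le_exp (by positivity)
  have h4 : (2 : ℝ) ≤ Real.exp 1 := by linarith [Real.add_one_le_exp (1 : ℝ)]
  nlinarith

/-- Energy density of `a + i b`. -/
def enD (a b : ℂ → ℝ) (z : ℂ) : ℝ := (1 / 2) * gsq a b z + (1 / 4) * (1 - msq a b z) ^ 2

@[fun_prop]
theorem contDiff_enD {a b : ℂ → ℝ} (ha : ContDiff ℝ (⊤ : ℕ∞) a) (hb : ContDiff ℝ (⊤ : ℕ∞) b) :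
    ContDiff ℝ (⊤ : ℕ∞) (enD a b) := by
  unfold enD
  fun_prop

theorem enD_nonneg (a b : ℂ → ℝ) (z : ℂ) : 0 ≤ enD a b z := by
  have := gsq_nonneg (a := a) (b := b) z
  unfold enD
  positivity

section
variable {a b : ℂ → ℝ} {c : ℝ}

theorem IsWave.integrable_enD (h : IsWave a b c) : Integrable (enD a b) :=
  (h.integrable_gsq.const_mul _).add (h.integrable_pot.const_mul _)

theorem abs_stress_form_le (z : ℂ) (x y : ℝ) :
    |stressXX a b z * x ^ 2 + 2 * stressXY a b z * (x * y) + stressYY a b z * y ^ 2| ≤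
      enD a b z * (x ^ 2 + y ^ 2) := by
  rw [stressXX, stressXY, stressYY, enD, gsq, abs_le]
  have h1 := sq_nonneg (dX a z * x + dY a z * y)
  have h2 := sq_nonneg (dX b z * x + dY b z * y)
  have h3 := sq_nonneg (dX a z * y - dY a z * x)
  have h4 := sq_nonneg (dX b z * y - dY b z * x)
  have h5 : 0 ≤ (1 - msq a b z) ^ 2 * (x ^ 2 + y ^ 2) := by positivity
  constructor <;> nlinarith

theorem abs_jac_le (z : ℂ) : |jac a b z| ≤ gsq a b z / 2 := by
  rw [jac, gsq, abs_le]
  constructor <;> nlinarith [sq_nonneg (dX a z + dY b z), sq_nonneg (dY a z - dX b z),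
    sq_nonneg (dX a z - dY b z), sq_nonneg (dY a z + dX b z)]

/-- Local Pohozaev inequality with a logarithmic cutoff. -/
theorem IsWave.integral_logCut_le (h : IsWave a b c) {s : ℝ} (hs : 0 < s) (m : ℂ) :
    ∫ z, (1 / 2) * logCut s m z * (1 - msq a b z) ^ 2 ≤
      2 * cutConst * s * (∫ z in ball m (Real.exp (1 / s)), enD a b z) +
        |c| * Real.exp (1 / s) * ∫ z, gsq a b z := by
  have ha := h.smooth_re
  have hb := h.smooth_im
  set R := Real.exp (1 / s) with hR
  have hR0 : 0 < R := Real.exp_pos _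
  have hK := one_le_cutConst
  set Q : ℂ → ℝ := (ball m R).indicator
    (fun z => 2 * cutConst * s * enD a b z + |c| * R * gsq a b z) with hQ
  have hQi : Integrable Q := ((h.integrable_enD.const_mul _).add
    (h.integrable_gsq.const_mul _)).indicator measurableSet_ball
  have hζ := contDiff_logCut s m
  have hζc := hasCompactSupport_logCut hs m
  set V1 : ℂ → ℝ := fun z => stressXX a b z * (z.re - m.re) + stressXY a b z * (z.im - m.im)
  set V2 : ℂ → ℝ := fun z => stressXY a b z * (z.re - m.re) + stressYY a b z * (z.im - m.im)
  have hV1 : ContDiff ℝ (⊤ : ℕ∞) V1 := by fun_prop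
  have hV2 : ContDiff ℝ (⊤ : ℕ∞) V2 := by fun_prop
  have key : ∫ z, (1 / 2) * logCut s m z * (1 - msq a b z) ^ 2 ≤ ∫ z, Q z := by
    refine integral_le_of_le_add_div (F := fun z => -1 * (logCut s m z * V1 z))
      (G := fun z => -1 * (logCut s m z * V2 z)) ?_ hQi (by fun_prop) (by fun_prop)
      hζc.mul_right.mul_left hζc.mul_right.mul_left fun z => ?_
    · refine Continuous.integrable_of_hasCompactSupport ?_ hζc.mul_left.mul_right
      exact (by fun_prop : ContDiff ℝ (⊤ : ℕ∞)
        (fun z => (1 / 2) * logCut s m z * (1 - msq a b z) ^ 2)).continuous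
    · have e1 := h.div_stress_fst z
      have e2 := h.div_stress_snd z
      have e3 : stressXX a b z + stressYY a b z = -(1 / 2) * (1 - msq a b z) ^ 2 := by
        rw [stressXX, stressYY]
        ring
      simp (disch := fun_prop) only [V1, V2, dX_const_mul, dY_const_mul, dX_mul, dY_mul, dX_add,
        dY_add, dX_sub, dY_sub, dX_re, dX_im, dX_const, dY_const, dY_re, dY_im]
      set d := deriv cutProfile (s * Real.log (1 + ‖z - m‖ ^ 2)) with hd
      set x := z.re - m.re
      set y := z.im - m.im
      have hxy : ‖z - m‖ ^ 2 = x ^ 2 + y ^ 2 := norm_sub_sq_eq z m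
      have hg : dX (logCut s m) z * V1 z + dY (logCut s m) z * V2 z ≤
          |d| * (2 * s * enD a b z) := by
        have e4 : dX (logCut s m) z * V1 z + dY (logCut s m) z * V2 z = d *
            ((2 * s / (1 + ‖z - m‖ ^ 2)) * (stressXX a b z * x ^ 2 + 2 * stressXY a b z * (x * y) +
              stressYY a b z * y ^ 2)) := by
          rw [dX_logCut, dY_logCut]
          simp only [V1, V2]
          ring
        rw [e4]
        refine (le_abs_self _).trans ?_
        rw [abs_mul, abs_mul, abs_of_nonneg (show 0 ≤ 2 * s / (1 + ‖z - m‖ ^ 2) by positivity)]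
        refine mul_le_mul_of_nonneg_left ?_ (abs_nonneg d)
        have e5 := abs_stress_form_le (a := a) (b := b) z x y
        rw [← hxy] at e5
        have e6 := enD_nonneg a b z
        rw [div_mul_eq_mul_div, div_le_iff₀ (by positivity)]
        nlinarith
      simp only [V1, V2] at hg
      by_cases hz : z ∈ ball m R
      · rw [hQ, Set.indicator_of_mem hz]
        have hz' : ‖z - m‖ < R := by simpa [dist_eq_norm] using hz
        have hx : |x| ≤ R := by
          apply abs_le_of_sq_le_sq _ hR0.le
          nlinarith [norm_nonneg (z - m), sq_nonneg y]
        have h1 : logCut s m z * (x * (c * jac a b z)) ≤ |c| * R * gsq a b z := by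
          refine (le_abs_self _).trans ?_
          rw [abs_mul, abs_mul, abs_mul, abs_of_nonneg (logCut_nonneg s m z)]
          have g0 := gsq_nonneg (a := a) (b := b) z
          calc _ ≤ 1 * (R * (|c| * gsq a b z)) := by
                gcongr
                · exact logCut_le_one s m z
                · linarith [abs_jac_le (a := a) (b := b) z]
            _ = _ := by ring
        have h2 : |d| * (2 * s * enD a b z) ≤ 2 * cutConst * s * enD a b z := by
          have := abs_deriv_cutProfile_le (s * Real.log (1 + ‖z - m‖ ^ 2))
          have e6 := enD_nonneg a b z
          calc _ ≤ cutConst * (2 * s * enD a b z) := by gcongr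
            _ = _ := by ring
        linear_combination h1 + h2 + hg + (logCut s m z * x) * e1 + (logCut s m z * y) * e2 +
          logCut s m z * e3
      · have hz' : R ≤ ‖z - m‖ := by simpa only [mem_ball, dist_eq_norm, not_lt] using hz
        have h0 : logCut s m z = 0 := logCut_eq_zero hs hz'
        have hd0 : d = 0 := deriv_cutProfile_log_eq_zero hs hz'
        rw [hQ, Set.indicator_of_notMem hz, h0, dX_logCut, dY_logCut, ← hd, hd0]
        simp
  refine key.trans ?_
  rw [hQ, integral_indicator measurableSet_ball, integral_add
    (h.integrable_enD.const_mul _).integrableOn (h.integrable_gsq.const_mul _).integrableOn,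
    integral_const_mul, integral_const_mul]
  have hle := setIntegral_le_integral (s := ball m R) h.integrable_gsq
    (Eventually.of_forall fun z => gsq_nonneg z)
  have : 0 ≤ |c| * R := by positivity
  nlinarith

theorem norm_fderiv_sq_le (f : ℂ → ℝ) (z : ℂ) :
    ‖fderiv ℝ f z‖ ^ 2 ≤ dX f z ^ 2 + dY f z ^ 2 := by
  have h : ‖fderiv ℝ f z‖ ≤ √(dX f z ^ 2 + dY f z ^ 2) := by
    refine ContinuousLinearMap.opNorm_le_bound _ (Real.sqrt_nonneg _) fun v => ?_
    rw [fderiv_real_apply, Real.norm_eq_abs, ← Real.sqrt_sq (norm_nonneg v), ← Real.sqrt_mul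
      (by positivity), norm_sq_eq_re_im]
    apply Real.abs_le_sqrt
    nlinarith [sq_nonneg (v.re * dY f z - v.im * dX f z)]
  calc _ ≤ √(dX f z ^ 2 + dY f z ^ 2) ^ 2 := by gcongr
    _ = _ := Real.sq_sqrt (by positivity)

/-- Near a point where the modulus is small the energy is logarithmically large. -/
theorem IsWave.le_energy_of_msq_lt (h : IsWave a b c) {L s : ℝ} (hL : 1 ≤ L)
    (hW : ∀ z, msq a b z ≤ 2) (hg : ∀ z, gsq a b z ≤ L ^ 2) (hs : 0 < s) (hs1 : s ≤ 1) {m : ℂ}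
    (hm : msq a b m < 1 / 4) :
    Real.pi / (1152 * L ^ 2) ≤
      2 * cutConst * s * (∫ z in ball m (Real.exp (1 / s)), enD a b z) +
        |c| * Real.exp (1 / s) * ∫ z, gsq a b z := by
  refine le_trans ?_ (h.integral_logCut_le hs m)
  have ha := h.smooth_re
  have hb := h.smooth_im
  have hL0 : 0 < L := by linarith
  set r := 1 / (12 * L) with hr
  have hr0 : 0 < r := by positivity
  have hr1 : r ≤ 1 := by
    rw [hr, div_le_one (by positivity)]
    linarith
  have hlip : ∀ z, ‖fderiv ℝ (msq a b) z‖ ≤ 3 * L := fun z => by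
    have h1 := norm_fderiv_sq_le (msq a b) z
    have h2 := gradient_msq_sq_le ha hb z
    have h3 := hW z
    have h4 := hg z
    have h5 := gsq_nonneg (a := a) (b := b) z
    apply abs_le_of_sq_le_sq _ (by positivity) |> (le_abs_self _).trans
    nlinarith
  have hball : ∀ z ∈ ball m r, (1 / 8 : ℝ) ≤ (1 / 2) * logCut s m z * (1 - msq a b z) ^ 2 := by
    intro z hz
    have hz' : ‖z - m‖ < r := by simpa [dist_eq_norm] using hz
    have h1 := (convex_univ (𝕜 := ℝ) (E := ℂ)).norm_image_sub_le_of_norm_fderiv_le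
      (f := msq a b) (fun x _ => (contDiff_msq ha hb).differentiableAt_infty x)
      (fun x _ => hlip x) (Set.mem_univ m) (Set.mem_univ z)
    have h2 : 3 * L * ‖z - m‖ ≤ 1 / 4 := by
      calc 3 * L * ‖z - m‖ ≤ 3 * L * r := by gcongr
        _ = 1 / 4 := by rw [hr]; field_simp; norm_num
    have h3 := (le_abs_self _).trans (h1.trans h2)
    have h4 : logCut s m z = 1 := by
      apply logCut_eq_one hs
      have h5 : 1 + 1 ≤ Real.exp (1 / s) := by
        refine le_trans ?_ (Real.add_one_le_exp _)
        have : 1 ≤ 1 / s := by rwa [le_div_iff₀ hs, one_mul]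
        linarith
      nlinarith [norm_nonneg (z - m)]
    rw [h4]
    nlinarith
  have hI : Integrable (fun z => (1 / 2) * logCut s m z * (1 - msq a b z) ^ 2) := by
    refine Continuous.integrable_of_hasCompactSupport ?_
      (hasCompactSupport_logCut hs m).mul_left.mul_right
    exact (by fun_prop : ContDiff ℝ (⊤ : ℕ∞)
        (fun z => (1 / 2) * logCut s m z * (1 - msq a b z) ^ 2)).continuous
  calc Real.pi / (1152 * L ^ 2) = ∫ z in ball m r, (1 / 8 : ℝ) := by
        rw [setIntegral_const, volume_ball_complex_real m hr0.le, hr, smul_eq_mul]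
        field_simp
        norm_num
    _ ≤ ∫ z in ball m r, (1 / 2) * logCut s m z * (1 - msq a b z) ^ 2 :=
        setIntegral_mono_on (integrableOn_const measure_ball_lt_top.ne) hI.integrableOn
          measurableSet_ball hball
    _ ≤ _ := setIntegral_le_integral hI (Eventually.of_forall fun z => by
        have := logCut_nonneg s m z
        simp only [Pi.zero_apply]
        positivity)

end

theorem exists_finset_cover {S : Set ℂ} {r : ℝ} (hr : 0 < r) {M : ℕ}
    (h : ∀ F : Finset ℂ, (F : Set ℂ) ⊆ S → (F : Set ℂ).Pairwise (fun x y => r ≤ ‖x - y‖) →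
      F.card ≤ M) : ∃ F : Finset ℂ, F.card ≤ M ∧ ∀ z ∈ S, ∃ m ∈ F, ‖z - m‖ < r := by
  by_contra! hc
  have step : ∀ n : ℕ, ∃ F : Finset ℂ, (F : Set ℂ) ⊆ S ∧
      (F : Set ℂ).Pairwise (fun x y => r ≤ ‖x - y‖) ∧ F.card = n := by
    intro n
    induction n with
    | zero => exact ⟨∅, by simp⟩
    | succ n ih =>
      obtain ⟨F, hF, hp, hn⟩ := ih
      obtain ⟨z, hz, hzF⟩ := hc F (h F hF hp)
      have hzn : z ∉ F := fun hm => by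
        have := hzF z hm
        simp at this
        linarith
      refine ⟨insert z F, ?_, ?_, by rw [Finset.card_insert_of_notMem hzn, hn]⟩
      · rw [Finset.coe_insert]
        exact Set.insert_subset hz hF
      · rw [Finset.coe_insert]
        refine hp.insert fun y hy _ => ⟨hzF y hy, ?_⟩
        rw [norm_sub_rev]
        exact hzF y hy
  obtain ⟨F, hF, hp, hn⟩ := step (M + 1)
  have := h F hF hp
  omega

/-- A travelling wave with energy and speed of the size expected at momentum `exp ℓ`. -/
structure IsSlowWave (L ℓ : ℝ) (a b : ℂ → ℝ) (c : ℝ) : Prop where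
  wave : IsWave a b c
  speed_pos : 0 < c
  speed_le : c ≤ 8 * ℓ * Real.exp (-ℓ)
  msq_le : ∀ z, msq a b z ≤ 2
  gsq_le : ∀ z, gsq a b z ≤ L ^ 2
  energy_le : ∫ z, enD a b z ≤ 8 * ℓ

namespace IsSlowWave
variable {L ℓ c : ℝ} {a b : ℂ → ℝ}

theorem integral_gsq_le (h : IsSlowWave L ℓ a b c) : ∫ z, gsq a b z ≤ 16 * ℓ := by
  have h1 : ∫ z, gsq a b z ≤ ∫ z, 2 * enD a b z := by
    refine integral_mono h.wave.integrable_gsq (h.wave.integrable_enD.const_mul 2) fun z => ?_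
    simp only [enD]
    nlinarith [sq_nonneg (1 - msq a b z)]
  rw [integral_const_mul] at h1
  linarith [h.energy_le]

theorem integral_pot_le (h : IsSlowWave L ℓ a b c) : ∫ z, (1 - msq a b z) ^ 2 ≤ 32 * ℓ := by
  have h1 : ∫ z, (1 - msq a b z) ^ 2 ≤ ∫ z, 4 * enD a b z := by
    refine integral_mono h.wave.integrable_pot (h.wave.integrable_enD.const_mul 4) fun z => ?_
    simp only [enD]
    nlinarith [gsq_nonneg (a := a) (b := b) z]
  rw [integral_const_mul] at h1
  linarith [h.energy_le]

end IsSlowWave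

theorem tendsto_pow_mul_exp_neg_mul (C : ℝ) (n : ℕ) {k : ℝ} (hk : 0 < k) :
    Tendsto (fun x : ℝ => C * x ^ n * Real.exp (-(k * x))) atTop (nhds 0) := by
  have h1 := (Real.tendsto_pow_mul_exp_neg_atTop_nhds_zero n).comp
    (tendsto_id.const_mul_atTop hk)
  have h2 := h1.const_mul (C / k ^ n)
  rw [mul_zero] at h2
  refine h2.congr fun x => ?_
  simp only [Function.comp, id]
  rw [mul_pow]
  field_simp

/-- Zeros are contained in a bounded number of small discs. -/
theorem exists_vortex_cover {L : ℝ} (hL : 1 ≤ L) : ∃ M : ℕ, ∀ᶠ ℓ : ℝ in atTop,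
    ∀ (a b : ℂ → ℝ) (c : ℝ), IsSlowWave L ℓ a b c → ∃ F : Finset ℂ, F.card ≤ M ∧
      ∀ z, msq a b z < 1 / 4 → ∃ m ∈ F, ‖z - m‖ < 2 * Real.exp (ℓ / 8) := by
  have hL0 : 0 < L := by linarith
  have hK := one_le_cutConst
  set κ := Real.pi / (1152 * L ^ 2) with hκ
  have hκ0 : 0 < κ := by positivity
  refine ⟨⌈256 * cutConst / κ⌉₊, ?_⟩
  have hev := (tendsto_pow_mul_exp_neg_mul 128 2 (show (0 : ℝ) < 7 / 8 by norm_num)).eventually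
    (gt_mem_nhds (show (0 : ℝ) < κ / 2 by positivity))
  filter_upwards [hev, eventually_ge_atTop 8] with ℓ hsmall hℓ a b c h
  refine exists_finset_cover (S := {z | msq a b z < 1 / 4}) (by positivity) fun F hF hp => ?_
  have hpt : ∀ m ∈ F, κ * ℓ / (32 * cutConst) ≤ ∫ z in ball m (Real.exp (ℓ / 8)), enD a b z := by
    intro m hm
    have h1 := h.wave.le_energy_of_msq_lt hL h.msq_le h.gsq_le (s := 8 / ℓ) (by positivity)
      (by rw [div_le_one (by linarith)]; exact hℓ) (hF hm)
    rw [one_div_div, ← hκ, abs_of_pos h.speed_pos] at h1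
    have h2 : c * Real.exp (ℓ / 8) * ∫ z, gsq a b z ≤ κ / 2 := by
      calc c * Real.exp (ℓ / 8) * ∫ z, gsq a b z ≤
            8 * ℓ * Real.exp (-ℓ) * Real.exp (ℓ / 8) * (16 * ℓ) := by
            have := h.integral_gsq_le
            have := h.speed_le
            have := h.speed_pos
            have : 0 ≤ ∫ z, gsq a b z := integral_nonneg fun z => gsq_nonneg z
            gcongr
        _ = 128 * ℓ ^ 2 * Real.exp (-(7 / 8 * ℓ)) := by
            rw [mul_assoc (8 * ℓ), ← Real.exp_add]
            ring_nf
        _ ≤ κ / 2 := hsmall.le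
    set I := ∫ z in ball m (Real.exp (ℓ / 8)), enD a b z
    have h3 : κ / 2 ≤ 2 * cutConst * (8 / ℓ) * I := by linarith
    rw [div_le_iff₀ (by positivity)]
    have h4 : 2 * cutConst * (8 / ℓ) * I = 16 * cutConst * I / ℓ := by ring
    rw [h4, le_div_iff₀ (by linarith)] at h3
    linarith
  have hdisj : (F : Set ℂ).Pairwise (Function.onFun Disjoint
      fun m => ball m (Real.exp (ℓ / 8))) := by
    intro x hx y hy hxy
    apply ball_disjoint_ball
    rw [dist_eq_norm]
    linarith [hp hx hy hxy]
  have hsum := integral_biUnion_finset F (μ := volume) (f := enD a b)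
    (fun m _ => measurableSet_ball (x := m) (ε := Real.exp (ℓ / 8))) hdisj
    fun m _ => h.wave.integrable_enD.integrableOn
  have hle := setIntegral_le_integral (s := ⋃ m ∈ F, ball m (Real.exp (ℓ / 8)))
    h.wave.integrable_enD (Eventually.of_forall fun z => enD_nonneg a b z)
  have h5 : (F.card : ℝ) * (κ * ℓ / (32 * cutConst)) ≤ 8 * ℓ := by
    have := Finset.card_nsmul_le_sum F _ _ hpt
    rw [nsmul_eq_mul] at this
    linarith [h.energy_le]
  have h6 : (F.card : ℝ) ≤ 256 * cutConst / κ := by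
    rw [le_div_iff₀ hκ0]
    rw [mul_div_assoc', div_le_iff₀ (by positivity)] at h5
    have : 0 < ℓ := by linarith
    nlinarith
  exact_mod_cast h6.trans (Nat.le_ceil _)

/-- A smooth function vanishing where `a + i b` has small modulus and equal to `1` away from a
small set. -/
structure IsGate (C ℓ : ℝ) (a b χ : ℂ → ℝ) : Prop where
  smooth : ContDiff ℝ (⊤ : ℕ∞) χ
  nonneg : ∀ z, 0 ≤ χ z
  le_one : ∀ z, χ z ≤ 1
  eq_zero : ∀ z, msq a b z < 1 / 4 → χ z = 0
  compact : HasCompactSupport (fun z => χ z - 1)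
  volume_le : volume {z | χ z ≠ 1} ≤ ENNReal.ofReal (C * Real.exp ℓ)
  integral_gradient_le : ∫ z, (dX χ z ^ 2 + dY χ z ^ 2) ≤ C / ℓ
  gradient_le : ∀ z, dX χ z ^ 2 + dY χ z ^ 2 ≤ (C * Real.exp (-(ℓ / 4))) ^ 2

theorem dX_finset_sum {ι : Type*} (F : Finset ι) {f : ι → ℂ → ℝ}
    (hf : ∀ i, ContDiff ℝ (⊤ : ℕ∞) (f i)) (z : ℂ) :
    dX (fun z => ∑ i ∈ F, f i z) z = ∑ i ∈ F, dX (f i) z := by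
  have h : HasFDerivAt (fun z => ∑ i ∈ F, f i z) (∑ i ∈ F, fderiv ℝ (f i) z) z :=
    HasFDerivAt.fun_sum fun i _ => ((hf i).differentiableAt_infty z).hasFDerivAt
  rw [dX_eq_of_hasFDerivAt h, _root_.sum_apply]
  rfl

theorem dY_finset_sum {ι : Type*} (F : Finset ι) {f : ι → ℂ → ℝ}
    (hf : ∀ i, ContDiff ℝ (⊤ : ℕ∞) (f i)) (z : ℂ) :
    dY (fun z => ∑ i ∈ F, f i z) z = ∑ i ∈ F, dY (f i) z := by
  have h : HasFDerivAt (fun z => ∑ i ∈ F, f i z) (∑ i ∈ F, fderiv ℝ (f i) z) z :=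
    HasFDerivAt.fun_sum fun i _ => ((hf i).differentiableAt_infty z).hasFDerivAt
  rw [dY_eq_of_hasFDerivAt h, _root_.sum_apply]
  rfl

theorem exists_gate {L : ℝ} (hL : 1 ≤ L) : ∃ C : ℝ, 1 ≤ C ∧ ∀ᶠ ℓ : ℝ in atTop,
    ∀ (a b : ℂ → ℝ) (c : ℝ), IsSlowWave L ℓ a b c → ∃ χ, IsGate C ℓ a b χ := by
  obtain ⟨M, hM⟩ := exists_vortex_cover hL
  have hK := one_le_cutConst
  set K := cutConst with hKdef
  set C := 32 * Real.pi * K ^ 4 * M ^ 2 + 4 * K ^ 2 * M + M * Real.pi + 1 with hC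
  have hC1 : 32 * Real.pi * K ^ 4 * M ^ 2 ≤ C ∧ 4 * K ^ 2 * M ≤ C ∧ M * Real.pi ≤ C ∧ 1 ≤ C := by
    have h1 : 0 ≤ 32 * Real.pi * K ^ 4 * M ^ 2 := by positivity
    have h2 : 0 ≤ 4 * K ^ 2 * M := by positivity
    have h3 : 0 ≤ M * Real.pi := by positivity
    refine ⟨?_, ?_, ?_, ?_⟩ <;> linarith
  refine ⟨C, hC1.2.2.2, ?_⟩
  filter_upwards [hM, eventually_ge_atTop 16] with ℓ hℓM hℓ a b c h
  obtain ⟨F, hF, hcov⟩ := hℓM a b c h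
  have hFM : (F.card : ℝ) ≤ M := by exact_mod_cast hF
  have hs : 0 < 2 / ℓ := by positivity
  have hinv : 1 / (2 / ℓ) = ℓ / 2 := one_div_div _ _
  set ψ : ℂ → ℂ → ℝ := fun m => logCut (2 / ℓ) m with hψ
  have hψs : ∀ m, ContDiff ℝ (⊤ : ℕ∞) (ψ m) := fun m => contDiff_logCut _ m
  have hψ0 : ∀ m z, 0 ≤ ψ m z := fun m z => logCut_nonneg _ m z
  set Ψ : ℂ → ℝ := fun z => ∑ m ∈ F, ψ m z with hΨ
  have hΨs : ContDiff ℝ (⊤ : ℕ∞) Ψ := ContDiff.sum fun m _ => hψs m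
  have hΨ1 : ContDiff ℝ (⊤ : ℕ∞) (fun z => 1 + Ψ z) := contDiff_const.add hΨs
  set χ : ℂ → ℝ := fun z => cutProfile (1 + Ψ z) with hχ
  have hχs : ContDiff ℝ (⊤ : ℕ∞) χ := contDiff_cutProfile.comp hΨ1
  have hχX : ∀ z, dX χ z = deriv cutProfile (1 + Ψ z) * ∑ m ∈ F, dX (ψ m) z := fun z => by
    have h1 := dX_comp contDiff_cutProfile hΨ1 z
    rw [dX_add contDiff_const hΨs, dX_const, zero_add, dX_finset_sum F hψs] at h1
    exact h1
  have hχY : ∀ z, dY χ z = deriv cutProfile (1 + Ψ z) * ∑ m ∈ F, dY (ψ m) z := fun z => by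
    have h1 := dY_comp contDiff_cutProfile hΨ1 z
    rw [dY_add contDiff_const hΨs, dY_const, zero_add, dY_finset_sum F hψs] at h1
    exact h1
  have hone : ∀ z, χ z ≠ 1 → ∃ m ∈ F, ‖z - m‖ < Real.exp (ℓ / 2) := by
    intro z hz
    by_contra! hcon
    apply hz
    apply cutProfile_eq_one
    have : Ψ z = 0 := Finset.sum_eq_zero fun m hm => logCut_eq_zero hs (by
      rw [hinv]
      exact hcon m hm)
    rw [this, add_zero]
  have hgrad : ∀ z, dX χ z ^ 2 + dY χ z ^ 2 ≤
      K ^ 2 * M * ∑ m ∈ F, (dX (ψ m) z ^ 2 + dY (ψ m) z ^ 2) := by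
    intro z
    rw [hχX, hχY, mul_pow, mul_pow, ← mul_add, mul_assoc]
    have h1 := abs_deriv_cutProfile_le (1 + Ψ z)
    have h2 : deriv cutProfile (1 + Ψ z) ^ 2 ≤ K ^ 2 := sq_le_sq' (abs_le.1 h1).1 (abs_le.1 h1).2
    have h3 := sq_sum_le_card_mul_sum_sq (s := F) (f := fun m => dX (ψ m) z)
    have h4 := sq_sum_le_card_mul_sum_sq (s := F) (f := fun m => dY (ψ m) z)
    have h5 : 0 ≤ ∑ m ∈ F, (dX (ψ m) z ^ 2 + dY (ψ m) z ^ 2) :=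
      Finset.sum_nonneg fun m _ => by positivity
    have h6 : (∑ m ∈ F, dX (ψ m) z) ^ 2 + (∑ m ∈ F, dY (ψ m) z) ^ 2 ≤
        M * ∑ m ∈ F, (dX (ψ m) z ^ 2 + dY (ψ m) z ^ 2) := by
      calc _ ≤ (F.card : ℝ) * ∑ m ∈ F, (dX (ψ m) z ^ 2 + dY (ψ m) z ^ 2) := by
            rw [Finset.sum_add_distrib, mul_add]
            linarith
        _ ≤ _ := by gcongr
    gcongr
  have hsumle : ∀ {f : ℂ → ℝ} {B : ℝ}, 0 ≤ B → (∀ m, f m ≤ B) → ∑ m ∈ F, f m ≤ M * B := by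
    intro f B hB hf
    calc ∑ m ∈ F, f m ≤ F.card • B := Finset.sum_le_card_nsmul F _ _ fun m _ => hf m
      _ ≤ M * B := by
          rw [nsmul_eq_mul]
          gcongr
  refine ⟨χ, hχs, fun z => cutProfile_nonneg _, fun z => cutProfile_le_one _, ?_, ?_, ?_, ?_, ?_⟩
  · intro z hz
    obtain ⟨m, hm, hzm⟩ := hcov z hz
    have h1 : ψ m z = 1 := by
      apply logCut_eq_one hs
      rw [hinv]
      have e2 : Real.exp (ℓ / 2) = Real.exp (ℓ / 4) ^ 2 := by
        rw [← Real.exp_nat_mul]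
        congr 1
        push_cast
        ring
      have e4 : Real.exp (ℓ / 4) = Real.exp (ℓ / 8) ^ 2 := by
        rw [← Real.exp_nat_mul]
        congr 1
        push_cast
        ring
      have e5 : 5 ≤ Real.exp (ℓ / 4) := by linarith [Real.add_one_le_exp (ℓ / 4)]
      have e6 : ‖z - m‖ ^ 2 ≤ (2 * Real.exp (ℓ / 8)) ^ 2 := by gcongr
      rw [mul_pow, ← e4] at e6
      nlinarith
    apply cutProfile_eq_zero
    have h2 : ψ m z ≤ Ψ z := Finset.single_le_sum (f := fun m => ψ m z) (fun m _ => hψ0 m z) hm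
    linarith
  · refine HasCompactSupport.of_eq_zero_of_lt (Real.exp (ℓ / 2) + ∑ m ∈ F, ‖m‖) fun z hz => ?_
    by_contra hne
    obtain ⟨m, hm, hzm⟩ := hone z fun h1 => hne (by rw [h1, sub_self])
    have h2 : ‖m‖ ≤ ∑ m ∈ F, ‖m‖ := Finset.single_le_sum (f := fun m => ‖m‖)
      (fun m _ => norm_nonneg m) hm
    have := norm_sub_norm_le z m
    linarith
  · have hsub : {z | χ z ≠ 1} ⊆ ⋃ m ∈ F, ball m (Real.exp (ℓ / 2)) := by
      intro z hz
      obtain ⟨m, hm, hzm⟩ := hone z hz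
      simp only [Set.mem_iUnion, mem_ball, dist_eq_norm]
      exact ⟨m, hm, hzm⟩
    refine (measure_mono hsub).trans ((measure_biUnion_finset_le F _).trans ?_)
    have hvol : ∀ m : ℂ, volume (ball m (Real.exp (ℓ / 2))) =
        ENNReal.ofReal (Real.pi * Real.exp ℓ) := by
      intro m
      have e2 : Real.exp ℓ = Real.exp (ℓ / 2) ^ 2 := by
        rw [← Real.exp_nat_mul]
        congr 1
        push_cast
        ring
      rw [e2, ← volume_ball_complex_real m (Real.exp_pos _).le, measureReal_def,
        ENNReal.ofReal_toReal measure_ball_lt_top.ne]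
    simp_rw [hvol]
    rw [Finset.sum_const, nsmul_eq_mul, ← ENNReal.ofReal_natCast, ← ENNReal.ofReal_mul (by positivity)]
    apply ENNReal.ofReal_le_ofReal
    rw [← mul_assoc]
    refine mul_le_mul_of_nonneg_right (le_trans ?_ hC1.2.2.1) (Real.exp_pos _).le
    gcongr
  · have hi : ∀ m, Integrable (fun z => dX (ψ m) z ^ 2 + dY (ψ m) z ^ 2) :=
      fun m => integrable_gradient_logCut hs m
    have h1 : ∫ z, (dX χ z ^ 2 + dY χ z ^ 2) ≤
        ∫ z, K ^ 2 * M * ∑ m ∈ F, (dX (ψ m) z ^ 2 + dY (ψ m) z ^ 2) :=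
      integral_mono_of_nonneg (Eventually.of_forall fun z => by positivity)
        ((integrable_finsetSum F fun m _ => hi m).const_mul _) (Eventually.of_forall hgrad)
    rw [integral_const_mul, integral_finsetSum F fun m _ => hi m] at h1
    refine h1.trans ?_
    have h2 : ∑ m ∈ F, ∫ z, (dX (ψ m) z ^ 2 + dY (ψ m) z ^ 2) ≤
        M * ((2 * K * (2 / ℓ)) ^ 2 * (Real.pi * (2 / (2 / ℓ) + 1))) :=
      hsumle (by positivity) fun m => integral_gradient_logCut_le hs m
    calc _ ≤ K ^ 2 * M * (M * ((2 * K * (2 / ℓ)) ^ 2 * (Real.pi * (2 / (2 / ℓ) + 1)))) := by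
          gcongr
      _ = 16 * Real.pi * K ^ 4 * M ^ 2 * (ℓ + 1) / ℓ ^ 2 := by
          field_simp
          ring
      _ ≤ 32 * Real.pi * K ^ 4 * M ^ 2 / ℓ := by
          rw [div_le_div_iff₀ (by positivity) (by positivity)]
          have h3 : 0 ≤ 16 * Real.pi * K ^ 4 * M ^ 2 := by positivity
          have h4 : (ℓ + 1) * ℓ ≤ 2 * ℓ ^ 2 := by nlinarith
          nlinarith
      _ ≤ C / ℓ := by
          gcongr
          exact hC1.1
  · intro z
    refine (hgrad z).trans ?_
    have h2 : ∑ m ∈ F, (dX (ψ m) z ^ 2 + dY (ψ m) z ^ 2) ≤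
        M * ((2 * K * (2 / ℓ)) ^ 2 * Real.exp (-(ℓ / 2))) :=
      hsumle (by positivity) fun m => by
        have := gradient_logCut_le_exp hs m z
        rwa [hinv] at this
    have e2 : Real.exp (-(ℓ / 2)) = Real.exp (-(ℓ / 4)) ^ 2 := by
      rw [← Real.exp_nat_mul]
      congr 1
      push_cast
      ring
    calc _ ≤ K ^ 2 * M * (M * ((2 * K * (2 / ℓ)) ^ 2 * Real.exp (-(ℓ / 2)))) := by gcongr
      _ = (4 * K ^ 2 * M * (1 / ℓ) * Real.exp (-(ℓ / 4))) ^ 2 := by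
          rw [e2]
          ring
      _ ≤ (4 * K ^ 2 * M * 1 * Real.exp (-(ℓ / 4))) ^ 2 := by
          gcongr
          rw [div_le_one (by linarith)]
          linarith
      _ ≤ _ := by
          rw [mul_one]
          gcongr
          exact hC1.2.1

/-! ### The Cauchy transform -/

/-- The Cauchy transform, a right inverse of the operator `∂₁ + i ∂₂`. -/
def cauchyTr (S : ℂ → ℂ) (z : ℂ) : ℂ := (2 * Real.pi : ℂ)⁻¹ * ∫ w, w⁻¹ * S (z - w)

theorem locallyIntegrable_inv_complex : LocallyIntegrable (fun w : ℂ => w⁻¹) := by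
  have h1 : ∀ r : ℝ, IntegrableOn (fun w : ℂ => w⁻¹) (ball 0 r) := by
    intro r
    refine (integrableOn_norm_rpow (q := 1) (r := r) (by norm_num)).mono'
      measurable_inv.aestronglyMeasurable (Eventually.of_forall fun w => ?_)
    rw [Real.rpow_neg_one, norm_inv]
  intro x
  refine ⟨ball 0 (‖x‖ + 1), isOpen_ball.mem_nhds (by simp), h1 _⟩

theorem cauchyTr_eq_convolution (S : ℂ → ℂ) : cauchyTr S = fun z => (2 * Real.pi : ℂ)⁻¹ *
    (convolution (fun w : ℂ => w⁻¹) S (ContinuousLinearMap.mul ℝ ℂ) volume) z := rfl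

theorem contDiff_cauchyTr {S : ℂ → ℂ} (hS : ContDiff ℝ (⊤ : ℕ∞) S) (hc : HasCompactSupport S) :
    ContDiff ℝ (⊤ : ℕ∞) (cauchyTr S) := by
  rw [cauchyTr_eq_convolution]
  exact contDiff_const.mul
    (hc.contDiff_convolution_right (ContinuousLinearMap.mul ℝ ℂ) locallyIntegrable_inv_complex hS)

theorem fderiv_cauchyTr_apply {S : ℂ → ℂ} (hS : ContDiff ℝ (⊤ : ℕ∞) S) (hc : HasCompactSupport S)
    (z v : ℂ) : fderiv ℝ (cauchyTr S) z v = (2 * Real.pi : ℂ)⁻¹ *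
      ∫ w, w⁻¹ * fderiv ℝ S (z - w) v := by
  have h1 := hc.hasFDerivAt_convolution_right (ContinuousLinearMap.mul ℝ ℂ)
    locallyIntegrable_inv_complex (hS.of_le (by simp)) z
  have h2 := convolution_precompR_apply (ContinuousLinearMap.mul ℝ ℂ)
    locallyIntegrable_inv_complex (hc.fderiv ℝ) (hS.continuous_fderiv (by simp)) z v
  rw [cauchyTr_eq_convolution, (h1.const_mul _).fderiv, smul_apply, h2]
  rfl

theorem cauchyRiemann_cauchyTr {S : ℂ → ℂ} (hS : ContDiff ℝ (⊤ : ℕ∞) S)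
    (hc : HasCompactSupport S) (z : ℂ) :
    fderiv ℝ (cauchyTr S) z 1 + Complex.I * fderiv ℝ (cauchyTr S) z Complex.I = S z := by
  have hf : ContDiff ℝ (⊤ : ℕ∞) (fun w => S (z - w)) := hS.comp (contDiff_const.sub contDiff_id)
  have hfc : HasCompactSupport (fun w => S (z - w)) :=
    hc.comp_homeomorph (Homeomorph.subLeft z)
  have hd : ∀ w v, fderiv ℝ (fun w => S (z - w)) w v = - fderiv ℝ S (z - w) v := by
    intro w v
    have h1 : HasFDerivAt (fun w : ℂ => z - w) (-ContinuousLinearMap.id ℝ ℂ) w :=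
      (hasFDerivAt_id w).const_sub z
    have h2 := (hS.differentiable (by simp) (z - w)).hasFDerivAt.comp w h1
    have h3 := h2.fderiv
    simp only [Function.comp_def] at h3
    rw [h3]
    simp
  have h0 := integral_cauchyRiemann_div hf hfc
  have hi : ∀ v : ℂ, Integrable (fun w => w⁻¹ * fderiv ℝ S (z - w) v) := by
    intro v
    have hcf : HasCompactSupport (fun w => fderiv ℝ S w v) :=
      (hc.fderiv ℝ).comp_left (g := fun T : ℂ →L[ℝ] ℂ => T v) (by simp)
    have := integrable_div_of_continuous (s := fun w => fderiv ℝ S (z - w) v)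
      (((hS.continuous_fderiv (by simp)).comp (by fun_prop)).clm_apply continuous_const)
      (hcf.comp_homeomorph (Homeomorph.subLeft z))
    simpa only [div_eq_inv_mul] using this
  rw [fderiv_cauchyTr_apply hS hc, fderiv_cauchyTr_apply hS hc]
  have h4 : ∫ w, (fderiv ℝ (fun w => S (z - w)) w 1 +
      Complex.I * fderiv ℝ (fun w => S (z - w)) w Complex.I) / w =
      -((∫ w, w⁻¹ * fderiv ℝ S (z - w) 1) + Complex.I * ∫ w, w⁻¹ * fderiv ℝ S (z - w) Complex.I) := by
    rw [← integral_const_mul, ← integral_add (hi 1) ((hi Complex.I).const_mul _), ← integral_neg]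
    congr 1
    funext w
    rw [hd, hd]
    simp only [div_eq_mul_inv]
    ring
  rw [h4, sub_zero] at h0
  have hpi : (2 * Real.pi : ℂ) ≠ 0 := by
    simp [Real.pi_ne_zero]
  have h5 : (∫ w, w⁻¹ * fderiv ℝ S (z - w) 1) + Complex.I * ∫ w, w⁻¹ * fderiv ℝ S (z - w) Complex.I
      = (2 * Real.pi : ℂ) * S z := by
    linear_combination -h0
  have h6 : (2 * Real.pi : ℂ)⁻¹ * ((2 * Real.pi : ℂ) * S z) = S z := by
    rw [← mul_assoc, inv_mul_cancel₀ hpi, one_mul]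
  rw [← h6, ← h5]
  ring

/-- The potential `∫ ‖S w‖ / ‖z − w‖`. -/
def rieszPot (S : ℂ → ℂ) (z : ℂ) : ℝ := ∫ w, ‖S w‖ * ‖z - w‖⁻¹

theorem integrable_rieszPot {S : ℂ → ℂ} (hS : Continuous S) (hc : HasCompactSupport S) (z : ℂ) :
    Integrable (fun w => ‖S w‖ * ‖z - w‖⁻¹) := by
  have h1 := (integrable_div_of_continuous (s := fun w => S (z - w)) (by fun_prop)
    (hc.comp_homeomorph (Homeomorph.subLeft z))).norm.comp_sub_left z
  refine h1.congr (Eventually.of_forall fun w => ?_)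
  simp [div_eq_mul_inv]

theorem norm_cauchyTr_le (S : ℂ → ℂ) (z : ℂ) : ‖cauchyTr S z‖ ≤ rieszPot S z := by
  have h1 : ∫ w, w⁻¹ * S (z - w) = ∫ w, (z - w)⁻¹ * S w := by
    rw [← integral_sub_left_eq_self (fun w => (z - w)⁻¹ * S w) volume z]
    simp
  rw [cauchyTr, h1, norm_mul]
  have h2 : ‖∫ w, (z - w)⁻¹ * S w‖ ≤ rieszPot S z := by
    refine (norm_integral_le_integral_norm _).trans_eq ?_
    unfold rieszPot
    congr 1
    funext w
    rw [norm_mul, norm_inv, mul_comm]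
  have h3 : ‖(2 * Real.pi : ℂ)⁻¹‖ ≤ 1 := by
    rw [norm_inv, norm_mul, Complex.norm_real, Real.norm_eq_abs, abs_of_pos Real.pi_pos]
    refine inv_le_one_of_one_le₀ ?_
    have := Real.two_le_pi
    norm_num
    linarith
  calc _ ≤ 1 * ‖∫ w, (z - w)⁻¹ * S w‖ := by gcongr
    _ ≤ _ := by rw [one_mul]; exact h2

theorem rieszPot_nonneg (S : ℂ → ℂ) (z : ℂ) : 0 ≤ rieszPot S z :=
  integral_nonneg fun w => by positivity

/-- Interpolated sup bound for the potential. -/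
theorem rieszPot_le {S : ℂ → ℂ} (hS : Continuous S) (hc : HasCompactSupport S) {A B δ : ℝ}
    (hA : ∀ z, ‖S z‖ ≤ A) (hB : ∫ z, ‖S z‖ ≤ B) (hδ : 0 < δ) (z : ℂ) :
    rieszPot S z ≤ 3 * Real.pi * A * δ + B / δ := by
  have hA0 : 0 ≤ A := (norm_nonneg _).trans (hA 0)
  have hSi : Integrable (fun w => ‖S w‖) := (hS.integrable_of_hasCompactSupport hc).norm
  have hk := (integrable_indicator_iff measurableSet_ball).2
    (integrableOn_ball_norm_sub_rpow (q := 1) (r := δ) (by norm_num) (by norm_num) hδ z z)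
  have h1 : rieszPot S z ≤ ∫ w, (A * (ball z δ).indicator (fun w => ‖w - z‖ ^ (-(1 : ℝ))) w
      + ‖S w‖ * δ⁻¹) := by
    refine integral_mono (integrable_rieszPot hS hc z) ((hk.const_mul A).add (hSi.mul_const _))
      fun w => ?_
    dsimp only
    by_cases hw : w ∈ ball z δ
    · rw [Set.indicator_of_mem hw, Real.rpow_neg_one, norm_sub_rev z w]
      have h2 : ‖S w‖ * ‖w - z‖⁻¹ ≤ A * ‖w - z‖⁻¹ := by
        gcongr
        exact hA w
      have : 0 ≤ ‖S w‖ * δ⁻¹ := by positivity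
      linarith
    · rw [Set.indicator_of_notMem hw, mul_zero, zero_add]
      rw [mem_ball, not_lt, dist_comm, dist_eq_norm] at hw
      gcongr
  rw [integral_add (hk.const_mul A) (hSi.mul_const _), integral_const_mul, integral_mul_const,
    integral_indicator measurableSet_ball] at h1
  have h3 := integral_ball_norm_sub_rpow_le (q := 1) (r := δ) (by norm_num) (by norm_num) hδ z z
  have h4 : δ ^ (2 - 1 : ℝ) = δ := by norm_num
  rw [h4] at h3
  have h5 : (2 * Real.pi / (2 - 1) + Real.pi) * δ = 3 * Real.pi * δ := by ring
  rw [h5] at h3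
  calc _ ≤ _ := h1
    _ ≤ A * (3 * Real.pi * δ) + B * δ⁻¹ := by gcongr
    _ = _ := by ring

theorem le_add_rpow_mul_rpow {k τ q : ℝ} (hk : 0 ≤ k) (hτ : 0 < τ) (hq : 1 ≤ q) :
    k ≤ τ + τ ^ (1 - q) * k ^ q := by
  rcases le_or_gt k τ with h | h
  · have : 0 ≤ τ ^ (1 - q) * k ^ q := by positivity
    linarith
  · have hk0 : 0 < k := hτ.trans h
    have h1 : k = k ^ (1 - q) * k ^ q := by
      rw [← Real.rpow_add hk0]
      simp
    have h2 : k ^ (1 - q) ≤ τ ^ (1 - q) :=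
      Real.rpow_le_rpow_of_nonpos hτ h.le (by linarith)
    calc k = k ^ (1 - q) * k ^ q := h1
      _ ≤ τ ^ (1 - q) * k ^ q := by gcongr
      _ ≤ _ := by linarith

theorem integrable_norm_mul_rpow {S : ℂ → ℂ} (hS : Continuous S) (hc : HasCompactSupport S)
    {q : ℝ} (hq2 : q < 2) (z : ℂ) :
    Integrable (fun w => ‖S w‖ * ‖z - w‖ ^ (-q)) := by
  obtain ⟨K, hK⟩ := hS.bounded_above_of_compact_support hc
  obtain ⟨R, hR⟩ := hc.isCompact.isBounded.subset_ball z
  have h1 := ((integrableOn_norm_sub_rpow (r := R) hq2 z).const_mul K)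
  have h2 : IntegrableOn (fun w => ‖S w‖ * ‖z - w‖ ^ (-q)) (ball z R) := by
    refine h1.mono' ?_ (Eventually.of_forall fun w => ?_)
    · exact (hS.norm.measurable.mul (by fun_prop)).aestronglyMeasurable
    · rw [Real.norm_of_nonneg (by positivity), norm_sub_rev z w]
      gcongr
      exact hK w
  refine (integrableOn_iff_integrable_of_support_subset fun w hw => ?_).1 h2
  refine hR (subset_tsupport _ fun h0 => hw ?_)
  simp [h0]

theorem rieszPot_rpow_le {S : ℂ → ℂ} (hS : Continuous S) (hc : HasCompactSupport S)
    {q B : ℝ} (hq : 1 ≤ q) (hq2 : q < 2) (hB0 : 0 < B) (hB : ∫ z, ‖S z‖ ≤ B) (z : ℂ) :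
    rieszPot S z ^ q ≤ 2 ^ q * B ^ (q - 1) * ∫ w, ‖S w‖ * ‖z - w‖ ^ (-q) := by
  set N := rieszPot S z with hN
  set J := ∫ w, ‖S w‖ * ‖z - w‖ ^ (-q) with hJ
  have hJ0 : 0 ≤ J := integral_nonneg fun w => by positivity
  rcases (rieszPot_nonneg S z).eq_or_lt with h0 | h0
  · rw [hN, ← h0, Real.zero_rpow (by linarith)]
    positivity
  rw [← hN] at h0
  have hτ : 0 < N / (2 * B) := by positivity
  have hSi : Integrable (fun w => ‖S w‖) := (hS.integrable_of_hasCompactSupport hc).norm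
  have hJi := integrable_norm_mul_rpow hS hc hq2 z
  have h1 : N ≤ ∫ w, (N / (2 * B) * ‖S w‖ +
      (N / (2 * B)) ^ (1 - q) * (‖S w‖ * ‖z - w‖ ^ (-q))) := by
    refine integral_mono (integrable_rieszPot hS hc z) ((hSi.const_mul _).add (hJi.const_mul _))
      fun w => ?_
    have h2 := le_add_rpow_mul_rpow (k := ‖z - w‖⁻¹) (by positivity) hτ hq
    rw [Real.inv_rpow (norm_nonneg _), ← Real.rpow_neg (norm_nonneg _)] at h2
    have h3 := mul_le_mul_of_nonneg_left h2 (norm_nonneg (S w))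
    dsimp only
    linarith
  rw [integral_add (hSi.const_mul _) (hJi.const_mul _), integral_const_mul, integral_const_mul,
    ← hJ] at h1
  have h2 : N / (2 * B) * ∫ w, ‖S w‖ ≤ N / 2 := by
    calc _ ≤ N / (2 * B) * B := by gcongr
      _ = _ := by field_simp
  have h3 : N / 2 ≤ (N / (2 * B)) ^ (1 - q) * J := by linarith
  have h4 : (N / (2 * B)) ^ (q - 1) * (N / 2) ≤ J := by
    calc _ ≤ (N / (2 * B)) ^ (q - 1) * ((N / (2 * B)) ^ (1 - q) * J) := by gcongr
      _ = J := by
        rw [← mul_assoc, ← Real.rpow_add hτ]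
        simp
  have h5 : N ^ q = 2 ^ q * B ^ (q - 1) * ((N / (2 * B)) ^ (q - 1) * (N / 2)) := by
    rw [Real.div_rpow h0.le (by positivity), Real.mul_rpow (by norm_num) hB0.le]
    have e1 : N ^ q = N ^ (q - 1) * N := by
      rw [← Real.rpow_add_one h0.ne']; simp
    have e2 : (2 : ℝ) ^ q = 2 ^ (q - 1) * 2 := by
      rw [← Real.rpow_add_one (by norm_num)]; simp
    have e3 : 0 < B ^ (q - 1) := by positivity
    have e4 : (0 : ℝ) < 2 ^ (q - 1) := by positivity
    rw [e1, e2]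
    field_simp
  rw [h5]
  gcongr

theorem integral_ball_rieszPot_rpow_le {S : ℂ → ℂ} (hS : Continuous S) (hc : HasCompactSupport S)
    {q B r : ℝ} (hq : 1 ≤ q) (hq2 : q < 2) (hB0 : 0 < B) (hB : ∫ z, ‖S z‖ ≤ B) (hr : 0 < r)
    (X : ℂ) : IntegrableOn (fun z => ∫ w, ‖S w‖ * ‖z - w‖ ^ (-q)) (ball X r) ∧
    2 ^ q * B ^ (q - 1) * ∫ z in ball X r, ∫ w, ‖S w‖ * ‖z - w‖ ^ (-q) ≤
      2 ^ q * B ^ q * (2 * Real.pi / (2 - q) + Real.pi) * r ^ (2 - q) := by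
  have hSi : Integrable (fun w => ‖S w‖) := (hS.integrable_of_hasCompactSupport hc).norm
  have hmeas : Measurable (fun p : ℂ × ℂ => ‖S p.2‖ * ‖p.1 - p.2‖ ^ (-q)) := by
    refine (hS.norm.measurable.comp measurable_snd).mul ?_
    fun_prop
  set M := (2 * Real.pi / (2 - q) + Real.pi) * r ^ (2 - q) with hM
  have hin : ∀ w, ∫ z in ball X r, ‖S w‖ * ‖z - w‖ ^ (-q) ≤ ‖S w‖ * M := by
    intro w
    rw [integral_const_mul]
    gcongr
    exact integral_ball_norm_sub_rpow_le (by linarith) hq2 hr X w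
  have hin0 : ∀ w, 0 ≤ ∫ z in ball X r, ‖S w‖ * ‖z - w‖ ^ (-q) := fun w =>
    integral_nonneg fun z => by positivity
  have hwi : Integrable (fun w => ∫ z in ball X r, ‖S w‖ * ‖z - w‖ ^ (-q)) := by
    refine (hSi.mul_const M).mono' ?_ (Eventually.of_forall fun w => ?_)
    · exact (StronglyMeasurable.integral_prod_left' (μ := volume.restrict (ball X r))
        (f := fun p : ℂ × ℂ => ‖S p.2‖ * ‖p.1 - p.2‖ ^ (-q))
        hmeas.stronglyMeasurable).aestronglyMeasurable
    · rw [Real.norm_of_nonneg (hin0 w)]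
      exact hin w
  have hprod : Integrable (fun p : ℂ × ℂ => ‖S p.2‖ * ‖p.1 - p.2‖ ^ (-q))
      ((volume.restrict (ball X r)).prod volume) := by
    refine (integrable_prod_iff' hmeas.aestronglyMeasurable).2 ⟨Eventually.of_forall fun w => ?_, ?_⟩
    · have h1 := integrableOn_ball_norm_sub_rpow (by linarith) hq2 hr X w
      exact h1.const_mul ‖S w‖
    · refine hwi.congr (Eventually.of_forall fun w => ?_)
      dsimp only
      congr 1
      funext z
      rw [Real.norm_of_nonneg (by positivity)]
  refine ⟨hprod.integral_prod_left, ?_⟩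
  have hsw := integral_integral_swap (f := fun z w : ℂ => ‖S w‖ * ‖z - w‖ ^ (-q)) hprod
  rw [hsw]
  have h1 : ∫ w, ∫ z in ball X r, ‖S w‖ * ‖z - w‖ ^ (-q) ≤ B * M := by
    calc _ ≤ ∫ w, ‖S w‖ * M := integral_mono hwi (hSi.mul_const M) hin
      _ = (∫ w, ‖S w‖) * M := integral_mul_const _ _
      _ ≤ B * M := by
        have : 0 ≤ M := by
          have : 0 < 2 - q := by linarith
          positivity
        gcongr
  have e1 : B ^ q = B ^ (q - 1) * B := by
    rw [← Real.rpow_add_one hB0.ne']; simp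
  calc _ ≤ 2 ^ q * B ^ (q - 1) * (B * M) := by gcongr
    _ = _ := by rw [e1, hM]; ring

/-- Decay of the Cauchy transform of a function with zero mean. -/
theorem integrable_norm_cauchyTr_sq {S : ℂ → ℂ} (hS : ContDiff ℝ (⊤ : ℕ∞) S)
    (hc : HasCompactSupport S) (h0 : ∫ z, S z = 0) :
    Integrable (fun z => ‖cauchyTr S z‖ ^ 2) := by
  obtain ⟨R₀, hR₀⟩ := hc.isCompact.isBounded.subset_closedBall 0
  set R := max R₀ 1 with hR
  have hR1 : 1 ≤ R := le_max_right _ _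
  have hsup : ∀ w, S w ≠ 0 → ‖w‖ ≤ R := fun w hw => by
    have := hR₀ (subset_tsupport _ hw)
    rw [mem_closedBall_zero_iff] at this
    exact this.trans (le_max_left _ _)
  have hSi : Integrable S := hS.continuous.integrable_of_hasCompactSupport hc
  set B := ∫ w, ‖S w‖ with hB
  have hB0 : 0 ≤ B := integral_nonneg fun w => norm_nonneg _
  have hfar : ∀ z : ℂ, 2 * R < ‖z‖ → ‖cauchyTr S z‖ ≤ 2 * R * B * ‖z‖⁻¹ ^ 2 := by
    intro z hz
    have hz0 : 0 < ‖z‖ := by linarith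
    have hzne : z ≠ 0 := norm_pos_iff.1 hz0
    have h1 : ∫ w, w⁻¹ * S (z - w) = ∫ w, (z - w)⁻¹ * S w := by
      rw [← integral_sub_left_eq_self (fun w => (z - w)⁻¹ * S w) volume z]
      simp
    have hi : Integrable (fun w => (z - w)⁻¹ * S w) := by
      refine (integrable_rieszPot hS.continuous hc z).mono'
        ((by fun_prop : Measurable fun w : ℂ => (z - w)⁻¹).mul
          hS.continuous.measurable).aestronglyMeasurable
        (Eventually.of_forall fun w => ?_)
      rw [norm_mul, norm_inv, mul_comm]
    have h2 : ∫ w, (z - w)⁻¹ * S w = ∫ w, ((z - w)⁻¹ * S w - z⁻¹ * S w) := by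
      rw [integral_sub hi (hSi.const_mul _), integral_const_mul, h0]
      simp
    have h3 : ‖∫ w, (z - w)⁻¹ * S w‖ ≤ ∫ w, (2 * R * ‖z‖⁻¹ ^ 2) * ‖S w‖ := by
      rw [h2]
      refine norm_integral_le_of_norm_le (hSi.norm.const_mul _) (Eventually.of_forall fun w => ?_)
      rw [← sub_mul, norm_mul]
      by_cases hw : S w = 0
      · simp [hw]
      have hwR := hsup w hw
      have h4 : ‖z‖ / 2 ≤ ‖z - w‖ := by
        have := norm_sub_norm_le z w
        linarith
      have h5 : 0 < ‖z - w‖ := by linarith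
      have h6 : (z - w)⁻¹ - z⁻¹ = w * ((z - w)⁻¹ * z⁻¹) := by
        have : z - w ≠ 0 := norm_pos_iff.1 h5
        field_simp
        ring
      have h7 : ‖z - w‖⁻¹ ≤ 2 * ‖z‖⁻¹ := by
        calc _ ≤ (‖z‖ / 2)⁻¹ := by gcongr
          _ = _ := by rw [inv_div, div_eq_mul_inv]
      rw [h6, norm_mul, norm_mul, norm_inv, norm_inv]
      calc ‖w‖ * (‖z - w‖⁻¹ * ‖z‖⁻¹) * ‖S w‖ ≤ R * (2 * ‖z‖⁻¹ * ‖z‖⁻¹) * ‖S w‖ := by gcongr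
        _ = _ := by ring
    rw [integral_const_mul, ← hB] at h3
    rw [cauchyTr, h1, norm_mul]
    have h8 : ‖(2 * Real.pi : ℂ)⁻¹‖ ≤ 1 := by
      rw [norm_inv, norm_mul, Complex.norm_real, Real.norm_eq_abs, abs_of_pos Real.pi_pos]
      refine inv_le_one_of_one_le₀ ?_
      have := Real.two_le_pi
      norm_num
      linarith
    calc _ ≤ 1 * (2 * R * ‖z‖⁻¹ ^ 2 * B) := by gcongr
      _ = _ := by ring
  have hG := (contDiff_cauchyTr hS hc).continuous
  have hdec : Integrable (fun z : ℂ => (2 * R * B) ^ 2 * 16 * (1 + ‖z‖) ^ (-(4 : ℝ))) := by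
    refine (integrable_one_add_norm ?_).const_mul _
    rw [Complex.finrank_real_complex]
    norm_num
  have h1 : IntegrableOn (fun z => ‖cauchyTr S z‖ ^ 2) (closedBall 0 (2 * R)) :=
    (hG.norm.pow 2).continuousOn.integrableOn_compact (isCompact_closedBall _ _)
  have h2 : IntegrableOn (fun z => ‖cauchyTr S z‖ ^ 2) (closedBall 0 (2 * R))ᶜ := by
    refine hdec.integrableOn.mono' (hG.norm.pow 2).aestronglyMeasurable ?_
    refine (ae_restrict_iff' measurableSet_closedBall.compl).2 (Eventually.of_forall fun z hz => ?_)
    rw [Set.mem_compl_iff, mem_closedBall_zero_iff, not_le] at hz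
    have hz0 : 0 < ‖z‖ := by linarith
    rw [Real.norm_of_nonneg (by positivity)]
    have h3 : ‖z‖⁻¹ ≤ 2 * (1 + ‖z‖)⁻¹ := by
      rw [← div_eq_mul_inv, inv_eq_one_div, div_le_div_iff₀ hz0 (by positivity)]
      linarith
    have h4 : (1 + ‖z‖) ^ (-(4 : ℝ)) = ((1 + ‖z‖)⁻¹) ^ 4 := by
      rw [Real.rpow_neg (by positivity), inv_pow]
      norm_cast
    rw [h4]
    calc ‖cauchyTr S z‖ ^ 2 ≤ (2 * R * B * ‖z‖⁻¹ ^ 2) ^ 2 := by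
          gcongr
          exact hfar z hz
      _ ≤ (2 * R * B * (2 * (1 + ‖z‖)⁻¹) ^ 2) ^ 2 := by gcongr
      _ = _ := by ring
  have := h1.union h2
  rwa [Set.union_compl_self, integrableOn_univ] at this

/-! ### The divergence–curl system -/

/-- A solution `(g₁, g₂)` of `div g = σ`, `curl g = ω` with the estimates used below. -/
structure IsDivCurlSol (σ ω g₁ g₂ : ℂ → ℝ) (B M : ℝ) : Prop where
  smooth_fst : ContDiff ℝ (⊤ : ℕ∞) g₁
  smooth_snd : ContDiff ℝ (⊤ : ℕ∞) g₂
  div_eq : ∀ z, dX g₁ z + dY g₂ z = σ z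
  curl_eq : ∀ z, dX g₂ z - dY g₁ z = ω z
  integrable_sq : Integrable (fun z => g₁ z ^ 2 + g₂ z ^ 2)
  sup_le : ∀ z, g₁ z ^ 2 + g₂ z ^ 2 ≤ M ^ 2
  integral_rpow_le : ∀ q r : ℝ, 1 ≤ q → q < 2 → 0 < r → ∀ X : ℂ,
    ∫ z in ball X r, √(g₁ z ^ 2 + g₂ z ^ 2) ^ q ≤
      2 ^ q * B ^ q * (2 * Real.pi / (2 - q) + Real.pi) * r ^ (2 - q)

theorem exists_isDivCurlSol {σ ω : ℂ → ℝ} (hσ : ContDiff ℝ (⊤ : ℕ∞) σ)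
    (hω : ContDiff ℝ (⊤ : ℕ∞) ω) (hσc : HasCompactSupport σ) (hωc : HasCompactSupport ω)
    (hσ0 : ∫ z, σ z = 0) (hω0 : ∫ z, ω z = 0) {A B δ : ℝ} (hA : ∀ z, |σ z| + |ω z| ≤ A)
    (hB0 : 0 < B) (hB : ∫ z, (|σ z| + |ω z|) ≤ B) (hδ : 0 < δ) :
    ∃ g₁ g₂, IsDivCurlSol σ ω g₁ g₂ B (3 * Real.pi * A * δ + B / δ) := by
  set S : ℂ → ℂ := fun z => (σ z : ℂ) - Complex.I * (ω z : ℂ) with hS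
  have hSs : ContDiff ℝ (⊤ : ℕ∞) S :=
    (Complex.ofRealCLM.contDiff.comp hσ).sub
      (contDiff_const.mul (Complex.ofRealCLM.contDiff.comp hω))
  have hSc : HasCompactSupport S := by
    refine HasCompactSupport.sub ?_ (HasCompactSupport.mul_left ?_)
    · exact hσc.comp_left (g := fun x : ℝ => (x : ℂ)) rfl
    · exact hωc.comp_left (g := fun x : ℝ => (x : ℂ)) rfl
  have hσi : Integrable σ := hσ.continuous.integrable_of_hasCompactSupport hσc
  have hωi : Integrable ω := hω.continuous.integrable_of_hasCompactSupport hωc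
  have hSn : ∀ z, ‖S z‖ ≤ |σ z| + |ω z| := fun z => by
    refine (norm_sub_le _ _).trans_eq ?_
    simp
  have hSA : ∀ z, ‖S z‖ ≤ A := fun z => (hSn z).trans (hA z)
  have hSB : ∫ z, ‖S z‖ ≤ B :=
    (integral_mono (hSs.continuous.integrable_of_hasCompactSupport hSc).norm
      (hσi.abs.add hωi.abs) hSn).trans hB
  have hS0 : ∫ z, S z = 0 := by
    have i1 : Integrable (fun z => (σ z : ℂ)) := hσi.ofReal
    have i2 : Integrable (fun z => (ω z : ℂ)) := hωi.ofReal
    rw [hS, integral_sub i1 (i2.const_mul _), integral_const_mul, integral_complex_ofReal,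
      integral_complex_ofReal, hσ0, hω0]
    simp
  have hG := contDiff_cauchyTr hSs hSc
  have hGn : ∀ z, (cauchyTr S z).re ^ 2 + (-(cauchyTr S z).im) ^ 2 = ‖cauchyTr S z‖ ^ 2 := by
    intro z
    rw [norm_sq_eq_re_im]
    ring
  have h1 : ∀ z v, fderiv ℝ (fun z => (cauchyTr S z).re) z v = (fderiv ℝ (cauchyTr S) z v).re := by
    intro z v
    have := (Complex.reCLM.hasFDerivAt.comp z (hG.differentiable (by simp) z).hasFDerivAt).fderiv
    simp only [Function.comp_def, Complex.reCLM_apply] at this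
    rw [this]; rfl
  have h2 : ∀ z v, fderiv ℝ (fun z => -(cauchyTr S z).im) z v =
      -(fderiv ℝ (cauchyTr S) z v).im := by
    intro z v
    have := (Complex.imCLM.hasFDerivAt.comp z (hG.differentiable (by simp) z).hasFDerivAt).neg.fderiv
    simp only [Function.comp_def, Complex.imCLM_apply] at this
    have e : (fun z => -(cauchyTr S z).im) = -fun z => (cauchyTr S z).im := rfl
    rw [e, this]; rfl
  refine ⟨fun z => (cauchyTr S z).re, fun z => -(cauchyTr S z).im,
    Complex.reCLM.contDiff.comp hG, (Complex.imCLM.contDiff.comp hG).neg, ?_, ?_, ?_, ?_, ?_⟩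
  · intro z
    have := congrArg Complex.re (cauchyRiemann_cauchyTr hSs hSc z)
    simp [hS] at this
    simp only [dX, dY]
    rw [h1, h2]
    linarith
  · intro z
    have := congrArg Complex.im (cauchyRiemann_cauchyTr hSs hSc z)
    simp [hS] at this
    simp only [dX, dY]
    rw [h1, h2]
    linarith
  · simp only [hGn]
    exact integrable_norm_cauchyTr_sq hSs hSc hS0
  · intro z
    rw [hGn]
    gcongr
    exact (norm_cauchyTr_le S z).trans (rieszPot_le hSs.continuous hSc hSA hSB hδ z)
  · intro q r hq hq2 hr X
    obtain ⟨hi, hle⟩ := integral_ball_rieszPot_rpow_le hSs.continuous hSc hq hq2 hB0 hSB hr X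
    refine le_trans ?_ hle
    rw [← integral_const_mul]
    refine integral_mono_of_nonneg (Eventually.of_forall fun z => by positivity)
      (hi.const_mul _) (Eventually.of_forall fun z => ?_)
    dsimp only
    rw [hGn, Real.sqrt_sq (norm_nonneg _)]
    refine le_trans ?_ (rieszPot_rpow_le hSs.continuous hSc hq hq2 hB0 hSB z)
    exact Real.rpow_le_rpow (norm_nonneg _) (norm_cauchyTr_le S z) (by linarith)

/-! ### A Poincaré inequality and the orthogonality of curl-free and divergence-free fields -/

theorem sq_sub_le_integral {H : ℂ → ℝ} (hH : ContDiff ℝ (⊤ : ℕ∞) H) (x v : ℂ) :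
    (H (x + v) - H x) ^ 2 ≤
      ∫ t in Set.Ioc (0 : ℝ) 1, ‖v‖ ^ 2 * (dX H (x + t * v) ^ 2 + dY H (x + t * v) ^ 2) := by
  have hline : Continuous (fun t : ℝ => x + t * v) := by fun_prop
  have hX : Continuous (dX H) := (contDiff_dX hH).continuous
  have hY : Continuous (dY H) := (contDiff_dY hH).continuous
  set g : ℝ → ℝ := fun t => v.re * dX H (x + t * v) + v.im * dY H (x + t * v) with hg
  have hgc : Continuous g := by
    have := hX.comp hline
    have := hY.comp hline
    simp only [Function.comp_def] at *
    fun_prop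
  have hd : ∀ t : ℝ, HasDerivAt (fun t : ℝ => H (x + t * v)) (g t) t := by
    intro t
    have h1 : HasDerivAt (fun t : ℝ => x + (t : ℂ) * v) (1 * v) t :=
      ((Complex.ofRealCLM.hasDerivAt).mul_const v).const_add x
    have h2 := (hH.differentiableAt_infty (x + t * v)).hasFDerivAt.comp_hasDerivAt t h1
    rw [one_mul, fderiv_real_apply] at h2
    exact h2
  have h3 : ∫ t in (0 : ℝ)..1, g t = H (x + v) - H x := by
    rw [intervalIntegral.integral_eq_sub_of_hasDerivAt (fun t _ => hd t)
      (hgc.intervalIntegrable _ _)]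
    simp
  set m := ∫ t in (0 : ℝ)..1, g t with hm
  have h4 : 0 ≤ ∫ t in (0 : ℝ)..1, (g t - m) ^ 2 :=
    intervalIntegral.integral_nonneg (by norm_num) fun t _ => sq_nonneg _
  have h5 : ∫ t in (0 : ℝ)..1, (g t - m) ^ 2 = (∫ t in (0 : ℝ)..1, g t ^ 2) - m ^ 2 := by
    have e : ∀ t, (g t - m) ^ 2 = g t ^ 2 - 2 * m * g t + m ^ 2 := fun t => by ring
    simp only [e]
    rw [intervalIntegral.integral_add, intervalIntegral.integral_sub,
      intervalIntegral.integral_const_mul, ← hm]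
    · simp; ring
    all_goals exact Continuous.intervalIntegrable (by fun_prop) _ _
  rw [← h3]
  have h6 : ∫ t in (0 : ℝ)..1, g t ^ 2 ≤ ∫ t in (0 : ℝ)..1,
      ‖v‖ ^ 2 * (dX H (x + t * v) ^ 2 + dY H (x + t * v) ^ 2) := by
    refine intervalIntegral.integral_mono_on (by norm_num)
      ((hgc.pow 2).intervalIntegrable _ _) (Continuous.intervalIntegrable ?_ _ _) fun t _ => ?_
    · have := hX.comp hline
      have := hY.comp hline
      simp only [Function.comp_def] at *
      fun_prop
    · rw [norm_sq_eq_re_im]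
      simp only [hg]
      nlinarith [sq_nonneg (v.re * dY H (x + t * v) - v.im * dX H (x + t * v))]
  rw [intervalIntegral.integral_of_le zero_le_one (f := fun t : ℝ =>
    ‖v‖ ^ 2 * (dX H (x + t * v) ^ 2 + dY H (x + t * v) ^ 2))] at h6
  linarith

theorem lintegral_sq_sub_le {H : ℂ → ℝ} (hH : ContDiff ℝ (⊤ : ℕ∞) H) (v : ℂ) :
    ∫⁻ x, ENNReal.ofReal ((H (x + v) - H x) ^ 2) ≤
      ENNReal.ofReal (‖v‖ ^ 2) * ∫⁻ x, ENNReal.ofReal (dX H x ^ 2 + dY H x ^ 2) := by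
  have hX : Continuous (dX H) := (contDiff_dX hH).continuous
  have hY : Continuous (dY H) := (contDiff_dY hH).continuous
  have hF : Continuous (fun p : ℂ × ℝ => ‖v‖ ^ 2 *
      (dX H (p.1 + p.2 * v) ^ 2 + dY H (p.1 + p.2 * v) ^ 2)) := by
    have hl : Continuous (fun p : ℂ × ℝ => p.1 + (p.2 : ℂ) * v) := by fun_prop
    have h1 := hX.comp hl
    have h2 := hY.comp hl
    simp only [Function.comp_def] at h1 h2
    fun_prop
  calc ∫⁻ x, ENNReal.ofReal ((H (x + v) - H x) ^ 2)
      ≤ ∫⁻ x, ∫⁻ t in Set.Ioc (0 : ℝ) 1, ENNReal.ofReal (‖v‖ ^ 2 *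
        (dX H (x + t * v) ^ 2 + dY H (x + t * v) ^ 2)) := by
        refine lintegral_mono fun x => ?_
        have hc : Continuous (fun t : ℝ => ‖v‖ ^ 2 *
            (dX H (x + t * v) ^ 2 + dY H (x + t * v) ^ 2)) :=
          hF.comp (Continuous.prodMk continuous_const continuous_id)
        rw [← ofReal_integral_eq_lintegral_ofReal hc.integrableOn_Ioc
          (Eventually.of_forall fun t => by positivity)]
        exact ENNReal.ofReal_le_ofReal (sq_sub_le_integral hH x v)
    _ = ∫⁻ t in Set.Ioc (0 : ℝ) 1, ∫⁻ x, ENNReal.ofReal (‖v‖ ^ 2 *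
        (dX H (x + t * v) ^ 2 + dY H (x + t * v) ^ 2)) := by
        rw [lintegral_lintegral_swap]
        exact (ENNReal.measurable_ofReal.comp hF.measurable).aemeasurable
    _ = ∫⁻ t in Set.Ioc (0 : ℝ) 1, ENNReal.ofReal (‖v‖ ^ 2) *
        ∫⁻ x, ENNReal.ofReal (dX H x ^ 2 + dY H x ^ 2) := by
        congr 1
        funext t
        rw [lintegral_add_right_eq_self (fun x => ENNReal.ofReal (‖v‖ ^ 2 *
          (dX H x ^ 2 + dY H x ^ 2))) ((t : ℂ) * v)]
        simp only [ENNReal.ofReal_mul (sq_nonneg ‖v‖)]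
        rw [lintegral_const_mul]
        exact ENNReal.measurable_ofReal.comp (by fun_prop : Continuous fun x =>
          dX H x ^ 2 + dY H x ^ 2).measurable
    _ = _ := by simp

/-- Poincaré inequality on a disk, with a nearly optimal constant replaced by a value of `H`. -/
theorem exists_integral_ball_sq_sub_le {H : ℂ → ℝ} (hH : ContDiff ℝ (⊤ : ℕ∞) H)
    (hi : Integrable (fun z => dX H z ^ 2 + dY H z ^ 2)) {R : ℝ} (hR : 0 < R) :
    ∃ m, ∫ z in ball 0 R, (H z - m) ^ 2 ≤ 16 * R ^ 2 * ∫ z, (dX H z ^ 2 + dY H z ^ 2) := by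
  have hHc := hH.continuous
  set E := ∫ z, (dX H z ^ 2 + dY H z ^ 2) with hE
  have hE0 : 0 ≤ E := integral_nonneg fun z => by positivity
  have hEl : ∫⁻ x, ENNReal.ofReal (dX H x ^ 2 + dY H x ^ 2) = ENNReal.ofReal E :=
    (ofReal_integral_eq_lintegral_ofReal hi (Eventually.of_forall fun z => by positivity)).symm
  set f : ℂ → ENNReal := fun x => ∫⁻ z in ball 0 R, ENNReal.ofReal ((H z - H x) ^ 2) with hf
  have hf1 : ∀ x ∈ ball (0 : ℂ) R, f x ≤
      ∫⁻ v in ball 0 (2 * R), ENNReal.ofReal ((H (x + v) - H x) ^ 2) := by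
    intro x hx
    simp only [hf]
    rw [← lintegral_indicator measurableSet_ball, ← lintegral_indicator measurableSet_ball,
      ← lintegral_add_left_eq_self _ x]
    refine lintegral_mono fun v => ?_
    by_cases hv : x + v ∈ ball (0 : ℂ) R
    · have : v ∈ ball (0 : ℂ) (2 * R) := by
        rw [mem_ball_zero_iff] at *
        have := norm_sub_le (x + v) x
        rw [add_sub_cancel_left] at this
        linarith
      rw [Set.indicator_of_mem hv, Set.indicator_of_mem this]
    · rw [Set.indicator_of_notMem hv]
      exact zero_le
  have hf2 : ∫⁻ x in ball 0 R, f x ≤ ENNReal.ofReal (16 * Real.pi * R ^ 4 * E) := by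
    calc ∫⁻ x in ball 0 R, f x
        ≤ ∫⁻ x in ball 0 R, ∫⁻ v in ball 0 (2 * R), ENNReal.ofReal ((H (x + v) - H x) ^ 2) :=
          setLIntegral_mono' measurableSet_ball hf1
      _ = ∫⁻ v in ball 0 (2 * R), ∫⁻ x in ball 0 R, ENNReal.ofReal ((H (x + v) - H x) ^ 2) := by
          rw [lintegral_lintegral_swap]
          refine (ENNReal.measurable_ofReal.comp ?_).aemeasurable
          exact Continuous.measurable (by fun_prop)
      _ ≤ ∫⁻ v in ball (0 : ℂ) (2 * R), ENNReal.ofReal (4 * R ^ 2 * E) := by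
          refine setLIntegral_mono' measurableSet_ball fun v hv => ?_
          refine (setLIntegral_le_lintegral _ _).trans ((lintegral_sq_sub_le hH v).trans ?_)
          rw [hEl, ← ENNReal.ofReal_mul (sq_nonneg _)]
          refine ENNReal.ofReal_le_ofReal ?_
          rw [mem_ball_zero_iff] at hv
          have : ‖v‖ ^ 2 ≤ (2 * R) ^ 2 := by gcongr
          nlinarith
      _ = ENNReal.ofReal (4 * R ^ 2 * E) * volume (ball (0 : ℂ) (2 * R)) := by
          rw [setLIntegral_const]
      _ = _ := by
          have hv := volume_ball_complex_real (0 : ℂ) (show 0 ≤ 2 * R by linarith)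
          rw [Measure.real] at hv
          rw [← ENNReal.ofReal_toReal measure_ball_lt_top.ne, hv,
            ← ENNReal.ofReal_mul (by positivity)]
          congr 1
          ring
  have hvol : volume (ball (0 : ℂ) R) ≠ 0 := (measure_ball_pos _ _ hR).ne'
  obtain ⟨x, hx, hxf⟩ : ∃ x ∈ ball (0 : ℂ) R, f x ≤ laverage (volume.restrict (ball 0 R)) f := by
    refine exists_le_setLAverage hvol measure_ball_lt_top.ne ?_
    refine (Measurable.lintegral_prod_right' (ν := volume.restrict (ball 0 R))
      (f := fun p : ℂ × ℂ => ENNReal.ofReal ((H p.2 - H p.1) ^ 2)) ?_).aemeasurable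
    exact ENNReal.measurable_ofReal.comp (by fun_prop : Continuous fun p : ℂ × ℂ =>
      (H p.2 - H p.1) ^ 2).measurable
  refine ⟨H x, ?_⟩
  have hsq : Continuous (fun z => (H z - H x) ^ 2) := by fun_prop
  have hint : IntegrableOn (fun z => (H z - H x) ^ 2) (ball 0 R) :=
    (hsq.continuousOn.integrableOn_compact (isCompact_closedBall 0 R)).mono_set
      ball_subset_closedBall
  rw [← ENNReal.ofReal_le_ofReal_iff (by positivity), ofReal_integral_eq_lintegral_ofReal hint
    (Eventually.of_forall fun z => by positivity)]
  refine hxf.trans ?_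
  rw [setLAverage_eq]
  refine ENNReal.div_le_of_le_mul ?_
  refine hf2.trans_eq ?_
  have hv := volume_ball_complex_real (0 : ℂ) hR.le
  rw [Measure.real] at hv
  rw [← ENNReal.ofReal_toReal (measure_ball_lt_top (x := (0 : ℂ)) (r := R)).ne, hv,
    ← ENNReal.ofReal_mul (by positivity)]
  congr 1
  ring

theorem exists_potential {D₁ D₂ : ℂ → ℝ} (h₁ : ContDiff ℝ (⊤ : ℕ∞) D₁)
    (h₂ : ContDiff ℝ (⊤ : ℕ∞) D₂) (hcurl : ∀ z, dX D₂ z = dY D₁ z) :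
    ∃ H : ℂ → ℝ, ContDiff ℝ (⊤ : ℕ∞) H ∧ (∀ z, dX H z = D₁ z) ∧ ∀ z, dY H z = D₂ z := by
  set ω : ℂ → ℂ →L[ℝ] ℝ := fun z => D₁ z • Complex.reCLM + D₂ z • Complex.imCLM with hω
  have hωs : ContDiff ℝ (⊤ : ℕ∞) ω := (h₁.smul contDiff_const).add (h₂.smul contDiff_const)
  have hωd : ∀ z v w, fderiv ℝ ω z v w = fderiv ℝ D₁ z v * w.re + fderiv ℝ D₂ z v * w.im := by
    intro z v w
    have hd : HasFDerivAt ω _ z :=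
      ((h₁.differentiableAt_infty z).hasFDerivAt.smul_const Complex.reCLM).add
      ((h₂.differentiableAt_infty z).hasFDerivAt.smul_const Complex.imCLM)
    rw [hd.fderiv]
    simp
  obtain ⟨H, hH⟩ := convex_univ.exists_forall_hasFDerivAt_of_fderiv_symmetric isOpen_univ
    (hωs.differentiable (by simp)).differentiableOn (fun z _ v w => by
      rw [hωd, hωd, fderiv_real_apply D₁, fderiv_real_apply D₂, fderiv_real_apply D₁ z w,
        fderiv_real_apply D₂ z w, hcurl]
      ring)
  have hf : ∀ z, fderiv ℝ H z = ω z := fun z => (hH z trivial).fderiv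
  refine ⟨H, contDiff_infty_iff_fderiv.2 ⟨fun z => (hH z trivial).differentiableAt, ?_⟩, ?_, ?_⟩
  · rw [funext hf]
    exact hωs
  · intro z
    simp [dX, hf, hω]
  · intro z
    simp [dY, hf, hω]

/-- A divergence has zero integral when the field is square integrable up to factors of
controlled quadratic growth. -/
theorem integral_eq_zero_of_div {P Y₁ Y₂ : ℂ → ℝ} (hP : Continuous P) (hPi : Integrable P)
    (hY₁ : ContDiff ℝ (⊤ : ℕ∞) Y₁) (hY₂ : ContDiff ℝ (⊤ : ℕ∞) Y₂)
    (hYi : Integrable (fun z => Y₁ z ^ 2 + Y₂ z ^ 2)) {E : ℝ} (hE0 : 0 ≤ E)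
    (hex : ∀ R : ℝ, 0 < R → ∃ h : ℂ → ℝ, ContDiff ℝ (⊤ : ℕ∞) h ∧
      (∫ z in ball 0 R, h z ^ 2) ≤ E * R ^ 2 ∧
      ∀ z, dX (fun w => h w * Y₁ w) z + dY (fun w => h w * Y₂ w) z = P z) :
    ∫ z, P z = 0 := by
  have hK := one_le_cutConst
  set K := 128 * cutConst ^ 2 * E with hKd
  have hK0 : 0 ≤ K := by positivity
  set Q : ℂ → ℝ := fun z => Y₁ z ^ 2 + Y₂ z ^ 2 with hQ
  have key : ∀ ε : ℝ, 0 < ε → ∀ n : ℕ, |∫ z, cutoff (2 * ((n : ℝ) + 1)) z *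
      P z| ≤
      ε * K + ε⁻¹ * ((∫ z, Q z) - ∫ z, cutoff ((n : ℝ) + 1) z * Q z) := by
    intro ε hε n
    set ρ : ℝ := (n : ℝ) + 1 with hρd
    have hρ : 0 < ρ := by positivity
    obtain ⟨h, hh, hm, hdiv⟩ := hex (5 * ρ) (by positivity)
    set η := cutoff (2 * ρ) with hη
    have hηs : ContDiff ℝ (⊤ : ℕ∞) η := contDiff_cutoff _
    have hηc : HasCompactSupport η := hasCompactSupport_cutoff (by positivity)
    have hηX := hηc.dX
    have hηY := hηc.dY
    have hηXs := contDiff_dX hηs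
    have hηYs := contDiff_dY hηs
    set q : ℂ → ℝ := fun z => -(h z * (dX η z * Y₁ z + dY η z * Y₂ z)) with hq
    have hqs : ContDiff ℝ (⊤ : ℕ∞) q := by fun_prop
    have hqi : Integrable q := by
      refine hqs.continuous.integrable_of_hasCompactSupport ?_
      exact (HasCompactSupport.mul_left (hηX.mul_right.add hηY.mul_right)).comp_left
        (g := fun x : ℝ => -x) (by simp)
    have hPηi : Integrable (fun z => η z * P z) := by
      refine Continuous.integrable_of_hasCompactSupport ?_ hηc.mul_right
      fun_prop
    have heq : ∫ z, η z * P z = ∫ z, q z := by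
      refine integral_eq_of_eq_add_div hPηi hqi
        (F := fun z => η z * (h z * Y₁ z)) (G := fun z => η z * (h z * Y₂ z))
        (by fun_prop) (by fun_prop) hηc.mul_right hηc.mul_right fun z => ?_
      have := hdiv z
      simp (disch := fun_prop) only [dX_mul, dY_mul] at this ⊢
      rw [← this]
      simp only [hq]
      ring
    rw [heq]
    have hbi : Integrable ((ball (0 : ℂ) (5 * ρ)).indicator fun z => h z ^ 2) := by
      refine (integrable_indicator_iff measurableSet_ball).2 ?_
      exact ((by fun_prop : Continuous fun z => h z ^ 2).continuousOn.integrableOn_compact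
        (isCompact_closedBall 0 (5 * ρ))).mono_set ball_subset_closedBall
    have hcQ : Integrable (fun z => cutoff ρ z * Q z) :=
      Continuous.integrable_of_hasCompactSupport
        ((contDiff_cutoff ρ).continuous.mul (by fun_prop))
        (hasCompactSupport_cutoff hρ).mul_right
    have hT : Integrable (fun z => Q z - cutoff ρ z * Q z) := hYi.sub hcQ
    have hpt : ∀ z, ‖q z‖ ≤ ε * (4 * cutConst ^ 2 / ρ ^ 2) *
        (ball (0 : ℂ) (5 * ρ)).indicator (fun z => h z ^ 2) z +
        ε⁻¹ * (Q z - cutoff ρ z * Q z) := by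
      intro z
      have hQ0 : 0 ≤ Q z := by positivity
      have hQ1 : 0 ≤ Q z - cutoff ρ z * Q z := by
        have := cutoff_le_one ρ z
        nlinarith
      have hin : 0 ≤ (ball (0 : ℂ) (5 * ρ)).indicator (fun z => h z ^ 2) z :=
        Set.indicator_nonneg (fun _ _ => sq_nonneg _) _
      have hnn : 0 ≤ ε * (4 * cutConst ^ 2 / ρ ^ 2) *
        (ball (0 : ℂ) (5 * ρ)).indicator (fun z => h z ^ 2) z +
        ε⁻¹ * (Q z - cutoff ρ z * Q z) := by positivity
      rcases lt_or_ge ‖z‖ (2 * ρ) with h1 | h1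
      · obtain ⟨e1, e2⟩ := gradient_cutoff_eq_zero (by positivity) h1
        have : q z = 0 := by simp only [hq, hη, e1, e2]; ring
        rw [this, norm_zero]
        exact hnn
      rcases lt_or_ge ‖z‖ (5 * ρ) with h2 | h2
      · rw [cutoff_eq_zero hρ h1, zero_mul, sub_zero,
          Set.indicator_of_mem (mem_ball_zero_iff.2 h2), Real.norm_eq_abs]
        have h3 := gradient_cutoff_bound (show 0 < 2 * ρ by positivity) z
        have h4 : (4 * cutConst / (2 * ρ)) ^ 2 = 4 * cutConst ^ 2 / ρ ^ 2 := by
          field_simp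
          ring
        rw [h4, ← hη] at h3
        have h5 : (dX η z * Y₁ z + dY η z * Y₂ z) ^ 2 ≤ 4 * cutConst ^ 2 / ρ ^ 2 * Q z := by
          calc _ ≤ (dX η z ^ 2 + dY η z ^ 2) * Q z := by
                simp only [hQ]
                nlinarith [sq_nonneg (dX η z * Y₂ z - dY η z * Y₁ z)]
            _ ≤ _ := by gcongr
        set k := 4 * cutConst ^ 2 / ρ ^ 2 with hk
        have hk0 : 0 ≤ k := by positivity
        have h6 : 0 ≤ ε * k * h z ^ 2 + ε⁻¹ * Q z := by positivity
        apply abs_le_of_sq_le_sq _ h6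
        calc q z ^ 2 = h z ^ 2 * (dX η z * Y₁ z + dY η z * Y₂ z) ^ 2 := by
              simp only [hq]; ring
          _ ≤ h z ^ 2 * (k * Q z) := by gcongr
          _ = (ε * k * h z ^ 2) * (ε⁻¹ * Q z) := by field_simp
          _ ≤ _ := by
            have a1 : 0 ≤ ε * k * h z ^ 2 := by positivity
            have a2 : 0 ≤ ε⁻¹ * Q z := by positivity
            nlinarith
      · obtain ⟨e1, e2⟩ := gradient_cutoff_eq_zero_of_gt (show 0 < 2 * ρ by positivity)
          (show 2 * (2 * ρ) < ‖z‖ by linarith)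
        have : q z = 0 := by simp only [hq, hη, e1, e2]; ring
        rw [this, norm_zero]
        exact hnn
    have hle := norm_integral_le_of_norm_le ((hbi.const_mul _).add (hT.const_mul _))
      (Eventually.of_forall hpt)
    rw [Real.norm_eq_abs, integral_add' (hbi.const_mul _) (hT.const_mul _), integral_const_mul,
      integral_const_mul, integral_indicator measurableSet_ball, integral_sub hYi hcQ] at hle
    refine hle.trans ?_
    have h7 : ε * (4 * cutConst ^ 2 / ρ ^ 2) * ∫ z in ball 0 (5 * ρ), h z ^ 2 ≤ ε * K := by
      calc _ ≤ ε * (4 * cutConst ^ 2 / ρ ^ 2) * (E * (5 * ρ) ^ 2) := by gcongr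
        _ = ε * (100 * cutConst ^ 2 * E) := by field_simp; ring
        _ ≤ ε * K := by
          rw [hKd]
          gcongr
          norm_num
    linarith
  have lim : ∀ ε : ℝ, 0 < ε → |∫ z, P z| ≤ ε * K := by
    intro ε hε
    have t1 := (tendsto_integral_cutoff hPi).comp
      (tendsto_atTop_mono (fun n : ℕ => (by omega : n ≤ 2 * n + 1)) tendsto_id)
    have t2 : Tendsto (fun n : ℕ => ε * K +
        ε⁻¹ * ((∫ z, Q z) - ∫ z, cutoff ((n : ℝ) + 1) z * Q z)) atTop
        (nhds (ε * K + ε⁻¹ * ((∫ z, Q z) - ∫ z, Q z))) :=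
      tendsto_const_nhds.add ((tendsto_const_nhds.sub (tendsto_integral_cutoff hYi)).const_mul _)
    rw [sub_self, mul_zero, add_zero] at t2
    refine le_of_tendsto_of_tendsto' t1.abs t2 fun n => ?_
    have := key ε hε n
    simp only [Function.comp_apply]
    have e : (((2 * n + 1 : ℕ) : ℝ) + 1) = 2 * ((n : ℝ) + 1) := by push_cast; ring
    rw [e]
    exact this
  have h0 : |∫ z, P z| ≤ 0 := by
    refine le_of_forall_pos_le_add fun δ hδ => ?_
    have := lim (δ / (K + 1)) (by positivity)
    rw [zero_add]
    refine this.trans ?_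
    rw [div_mul_eq_mul_div, div_le_iff₀ (by positivity)]
    nlinarith
  exact abs_nonpos_iff.1 h0

theorem integral_inner_eq_zero {D₁ D₂ Y₁ Y₂ : ℂ → ℝ} (hD₁ : ContDiff ℝ (⊤ : ℕ∞) D₁)
    (hD₂ : ContDiff ℝ (⊤ : ℕ∞) D₂) (hY₁ : ContDiff ℝ (⊤ : ℕ∞) Y₁) (hY₂ : ContDiff ℝ (⊤ : ℕ∞) Y₂)
    (hcurl : ∀ z, dX D₂ z = dY D₁ z) (hdiv : ∀ z, dX Y₁ z + dY Y₂ z = 0)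
    (hDi : Integrable (fun z => D₁ z ^ 2 + D₂ z ^ 2))
    (hYi : Integrable (fun z => Y₁ z ^ 2 + Y₂ z ^ 2)) :
    Integrable (fun z => D₁ z * Y₁ z + D₂ z * Y₂ z) ∧
    ∫ z, (D₁ z * Y₁ z + D₂ z * Y₂ z) = 0 := by
  have hPi : Integrable (fun z => D₁ z * Y₁ z + D₂ z * Y₂ z) := by
    refine (hDi.add hYi).mono' (by fun_prop : Continuous fun z => D₁ z * Y₁ z + D₂ z * Y₂ z
).aestronglyMeasurable (Eventually.of_forall fun z => ?_)
    rw [Real.norm_eq_abs, abs_le]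
    simp only [Pi.add_apply]
    constructor <;> nlinarith [sq_nonneg (D₁ z + Y₁ z), sq_nonneg (D₂ z + Y₂ z),
      sq_nonneg (D₁ z - Y₁ z), sq_nonneg (D₂ z - Y₂ z), sq_nonneg (D₁ z), sq_nonneg (D₂ z),
      sq_nonneg (Y₁ z), sq_nonneg (Y₂ z)]
  refine ⟨hPi, ?_⟩
  obtain ⟨H, hH, hHX, hHY⟩ := exists_potential hD₁ hD₂ hcurl
  have hHi : Integrable (fun z => dX H z ^ 2 + dY H z ^ 2) := by
    simpa only [hHX, hHY] using hDi
  refine integral_eq_zero_of_div (by fun_prop) hPi hY₁ hY₂ hYi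
    (E := 16 * ∫ z, (dX H z ^ 2 + dY H z ^ 2))
    (mul_nonneg (by norm_num) (integral_nonneg fun z => by positivity)) fun R hR => ?_
  obtain ⟨m, hm⟩ := exists_integral_ball_sq_sub_le hH hHi hR
  refine ⟨fun z => H z - m, by fun_prop, by linarith, fun z => ?_⟩
  simp (disch := fun_prop) only [dX_mul, dX_sub, dX_const, dY_mul, dY_sub, dY_const, hHX, hHY]
  linear_combination (H z - m) * hdiv z

theorem integral_div_eq_zero {Y₁ Y₂ : ℂ → ℝ} (hY₁ : ContDiff ℝ (⊤ : ℕ∞) Y₁)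
    (hY₂ : ContDiff ℝ (⊤ : ℕ∞) Y₂) (hYi : Integrable (fun z => Y₁ z ^ 2 + Y₂ z ^ 2))
    (hdi : Integrable (fun z => dX Y₁ z + dY Y₂ z)) : ∫ z, (dX Y₁ z + dY Y₂ z) = 0 := by
  have h1 := contDiff_dX hY₁
  have h2 := contDiff_dY hY₂
  refine integral_eq_zero_of_div (by fun_prop) hdi hY₁ hY₂ hYi Real.pi_pos.le fun R hR => ?_
  refine ⟨fun _ => 1, by fun_prop, ?_, fun z => by simp only [one_mul]⟩
  simp only [one_pow]
  rw [setIntegral_const, volume_ball_complex_real 0 hR.le]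
  simp

/-! ### The normalized current away from the vortices -/

/-- The gate divided by the squared modulus. -/
def gateQuot (χ a b : ℂ → ℝ) (z : ℂ) : ℝ := χ z / msq a b z

/-- Divergence of the gated current. -/
def gateDiv (χ a b : ℂ → ℝ) (c : ℝ) (z : ℂ) : ℝ :=
  dX χ z * curX a b z + dY χ z * (curY a b z - c / 2 * (1 - msq a b z))

/-- Curl of the normalized gated current. -/
def gateCurl (χ a b : ℂ → ℝ) (z : ℂ) : ℝ :=
  dX (fun w => gateQuot χ a b w * curY a b w) z - dY (fun w => gateQuot χ a b w * curX a b w) z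

section gate

variable {a b χ : ℂ → ℝ} {c C ℓ L : ℝ}

theorem contDiff_gateQuot (ha : ContDiff ℝ (⊤ : ℕ∞) a) (hb : ContDiff ℝ (⊤ : ℕ∞) b)
    (hg : IsGate C ℓ a b χ) : ContDiff ℝ (⊤ : ℕ∞) (gateQuot χ a b) := by
  have hW := contDiff_msq ha hb
  rw [contDiff_iff_contDiffAt]
  intro z
  by_cases hz : msq a b z < 1 / 4
  · have h0 : gateQuot χ a b =ᶠ[nhds z] fun _ => 0 := by
      filter_upwards [(hW.continuous.isOpen_preimage _ isOpen_Iio).mem_nhds hz] with w hw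
      rw [gateQuot, hg.eq_zero w hw, zero_div]
    exact contDiffAt_const.congr_of_eventuallyEq h0
  · refine hg.smooth.contDiffAt.div hW.contDiffAt fun h => hz ?_
    rw [h]
    norm_num

theorem gateQuot_mul_msq (hg : IsGate C ℓ a b χ) (z : ℂ) :
    gateQuot χ a b z * msq a b z = χ z := by
  by_cases hz : msq a b z = 0
  · rw [hg.eq_zero z (by rw [hz]; norm_num), hz, mul_zero]
  · rw [gateQuot, div_mul_cancel₀ _ hz]

theorem gateQuot_nonneg (hg : IsGate C ℓ a b χ) (z : ℂ) : 0 ≤ gateQuot χ a b z :=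
  div_nonneg (hg.nonneg z) (msq_nonneg z)

theorem gateQuot_le (hg : IsGate C ℓ a b χ) (z : ℂ) : gateQuot χ a b z ≤ 4 := by
  by_cases hz : msq a b z < 1 / 4
  · rw [gateQuot, hg.eq_zero z hz, zero_div]
    norm_num
  · rw [not_lt] at hz
    rw [gateQuot, div_le_iff₀ (by linarith)]
    linarith [hg.le_one z]

theorem gateCurl_eq_zero (ha : ContDiff ℝ (⊤ : ℕ∞) a) (hb : ContDiff ℝ (⊤ : ℕ∞) b)
    (hg : IsGate C ℓ a b χ) {z : ℂ} (hz : msq a b z < 1 / 4) : gateCurl χ a b z = 0 := by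
  have hW := contDiff_msq ha hb
  have h0 : ∀ f : ℂ → ℝ, (fun w => gateQuot χ a b w * f w) =ᶠ[nhds z] fun _ => 0 := by
    intro f
    filter_upwards [(hW.continuous.isOpen_preimage _ isOpen_Iio).mem_nhds hz] with w hw
    rw [gateQuot, hg.eq_zero w hw, zero_div, zero_mul]
  rw [gateCurl, dX, dY, (h0 _).fderiv_eq, (h0 _).fderiv_eq]
  simp

theorem msq_mul_gateCurl (ha : ContDiff ℝ (⊤ : ℕ∞) a) (hb : ContDiff ℝ (⊤ : ℕ∞) b)
    (hg : IsGate C ℓ a b χ) (z : ℂ) :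
    msq a b z * gateCurl χ a b z = dX χ z * curY a b z - dY χ z * curX a b z := by
  have hκ := contDiff_gateQuot ha hb hg
  have hW := contDiff_msq ha hb
  have hmul : (fun w => gateQuot χ a b w * msq a b w) = χ := funext (gateQuot_mul_msq hg)
  have h1 := dX_mul hκ hW z
  have h2 := dY_mul hκ hW z
  rw [hmul] at h1 h2
  rw [dX_msq ha hb] at h1
  rw [dY_msq ha hb] at h2
  rw [h1, h2, gateCurl, dX_mul hκ (contDiff_curY ha hb), dY_mul hκ (contDiff_curX ha hb)]
  have e1 : curX a b = fun z => a z * dX b z - b z * dX a z := rfl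
  have e2 : curY a b = fun z => a z * dY b z - b z * dY a z := rfl
  rw [e1, e2]
  simp (disch := fun_prop) only [dX_mul, dX_sub, dY_mul, dY_sub]
  rw [dX_dY_comm ha, dX_dY_comm hb, msq]
  ring

theorem gateCurl_sq_le (ha : ContDiff ℝ (⊤ : ℕ∞) a) (hb : ContDiff ℝ (⊤ : ℕ∞) b)
    (hg : IsGate C ℓ a b χ) (z : ℂ) :
    gateCurl χ a b z ^ 2 ≤ (dX χ z ^ 2 + dY χ z ^ 2) * (4 * gsq a b z) := by
  have hgs := gsq_nonneg (a := a) (b := b) z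
  by_cases hz : msq a b z < 1 / 4
  · rw [gateCurl_eq_zero ha hb hg hz, zero_pow two_ne_zero]
    positivity
  rw [not_lt] at hz
  have h1 := msq_mul_gateCurl ha hb hg z
  have h2 : (msq a b z * gateCurl χ a b z) ^ 2 ≤
      (dX χ z ^ 2 + dY χ z ^ 2) * (msq a b z * gsq a b z) := by
    rw [h1]
    calc _ ≤ (dX χ z ^ 2 + dY χ z ^ 2) * (curX a b z ^ 2 + curY a b z ^ 2) := by
          nlinarith [sq_nonneg (dX χ z * curX a b z + dY χ z * curY a b z)]
      _ ≤ _ := by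
          gcongr
          exact current_sq_le z
  have hW0 : 0 < msq a b z := by linarith
  have h3 : msq a b z * gateCurl χ a b z ^ 2 ≤ (dX χ z ^ 2 + dY χ z ^ 2) * gsq a b z := by
    refine le_of_mul_le_mul_left ?_ hW0
    linarith
  nlinarith [sq_nonneg (gateCurl χ a b z)]

theorem gateDiv_eq (h : IsWave a b c) (hg : IsGate C ℓ a b χ) (z : ℂ) :
    dX (fun w => χ w * curX a b w) z +
      dY (fun w => χ w * (curY a b w - c / 2 * (1 - msq a b w))) z = gateDiv χ a b c z := by
  have ha := h.smooth_re
  have hb := h.smooth_im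
  have hχ := hg.smooth
  have h1 := h.div_current z
  simp (disch := fun_prop) only [dX_mul, dY_mul, dY_sub, dY_const]
  rw [gateDiv]
  linear_combination χ z * h1

theorem gated_current_sq_le (hs : IsSlowWave L ℓ a b c) (hc : c ≤ 1) (z : ℂ) :
    curX a b z ^ 2 + (curY a b z - c / 2 * (1 - msq a b z)) ^ 2 ≤
      4 * gsq a b z + (1 - msq a b z) ^ 2 := by
  have h1 := current_sq_le (a := a) (b := b) z
  have h2 := hs.msq_le z
  have h3 := gsq_nonneg (a := a) (b := b) z
  have hc0 := hs.speed_pos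
  have h4 : (c / 2 * (1 - msq a b z)) ^ 2 ≤ (1 / 4) * (1 - msq a b z) ^ 2 := by
    rw [mul_pow]
    gcongr
    nlinarith
  nlinarith [sq_nonneg (curY a b z + c / 2 * (1 - msq a b z)), sq_nonneg (curX a b z),
    sq_nonneg (1 - msq a b z)]

theorem gateDiv_sq_le (hs : IsSlowWave L ℓ a b c) (hc : c ≤ 1) (z : ℂ) :
    gateDiv χ a b c z ^ 2 ≤
      (dX χ z ^ 2 + dY χ z ^ 2) * (4 * gsq a b z + (1 - msq a b z) ^ 2) := by
  refine le_trans ?_ (mul_le_mul_of_nonneg_left (gated_current_sq_le hs hc z)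
    (by positivity : 0 ≤ dX χ z ^ 2 + dY χ z ^ 2))
  rw [gateDiv]
  nlinarith [sq_nonneg (dX χ z * (curY a b z - c / 2 * (1 - msq a b z)) - dY χ z * curX a b z)]

end gate

theorem abs_le_of_sq_le_mul {x s t k : ℝ} (hk : 0 < k) (hs : 0 ≤ s) (ht : 0 ≤ t)
    (h : x ^ 2 ≤ s * t) : |x| ≤ (k * s + k⁻¹ * t) / 2 := by
  have h1 : 0 ≤ k * s := by positivity
  have h2 : 0 ≤ k⁻¹ * t := by positivity
  apply abs_le_of_sq_le_sq _ (by positivity)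
  have h3 : s * t = (k * s) * (k⁻¹ * t) := by field_simp
  nlinarith [sq_nonneg (k * s - k⁻¹ * t)]

section field

variable {a b χ : ℂ → ℝ} {c C ℓ L : ℝ}

theorem IsGate.hasCompactSupport_dX (hg : IsGate C ℓ a b χ) : HasCompactSupport (dX χ) := by
  have h1 := hg.compact.dX
  have h2 : dX (fun z => χ z - 1) = dX χ := by
    funext z
    have hχ := hg.smooth
    simp (disch := fun_prop) only [dX_sub, dX_const, sub_zero]
  rwa [h2] at h1

theorem IsGate.hasCompactSupport_dY (hg : IsGate C ℓ a b χ) : HasCompactSupport (dY χ) := by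
  have h1 := hg.compact.dY
  have h2 : dY (fun z => χ z - 1) = dY χ := by
    funext z
    have hχ := hg.smooth
    simp (disch := fun_prop) only [dY_sub, dY_const, sub_zero]
  rwa [h2] at h1

theorem IsGate.hasCompactSupport_gradient_sq (hg : IsGate C ℓ a b χ) :
    HasCompactSupport (fun z => dX χ z ^ 2 + dY χ z ^ 2) :=
  (hg.hasCompactSupport_dX.comp_left (g := fun x : ℝ => x ^ 2) (by norm_num)).add
    (hg.hasCompactSupport_dY.comp_left (g := fun x : ℝ => x ^ 2) (by norm_num))

theorem IsGate.integrable_gradient_sq (hg : IsGate C ℓ a b χ) :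
    Integrable (fun z => dX χ z ^ 2 + dY χ z ^ 2) := by
  have hχ := hg.smooth
  have h1 : ContDiff ℝ (⊤ : ℕ∞) (fun z => dX χ z ^ 2 + dY χ z ^ 2) := by fun_prop
  exact h1.continuous.integrable_of_hasCompactSupport hg.hasCompactSupport_gradient_sq

/-- A factorization of the square passes vanishing from the first factor to the function. -/
theorem IsGate.hasCompactSupport_of_sq_le (hg : IsGate C ℓ a b χ) {f t : ℂ → ℝ}
    (hf : ∀ z, f z ^ 2 ≤ (dX χ z ^ 2 + dY χ z ^ 2) * t z) : HasCompactSupport f := by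
  refine hg.hasCompactSupport_gradient_sq.mono fun z hz hz0 => hz ?_
  have h1 := hf z
  have h2 : dX χ z ^ 2 + dY χ z ^ 2 = 0 := hz0
  rw [h2, zero_mul] at h1
  exact pow_eq_zero_iff two_ne_zero |>.1 (le_antisymm h1 (sq_nonneg _))

theorem contDiff_gateDiv (ha : ContDiff ℝ (⊤ : ℕ∞) a) (hb : ContDiff ℝ (⊤ : ℕ∞) b)
    (hχ : ContDiff ℝ (⊤ : ℕ∞) χ) : ContDiff ℝ (⊤ : ℕ∞) (gateDiv χ a b c) := by
  have h1 := contDiff_curX ha hb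
  have h2 := contDiff_curY ha hb
  have h3 := contDiff_msq ha hb
  unfold gateDiv
  fun_prop

theorem contDiff_gateCurl (ha : ContDiff ℝ (⊤ : ℕ∞) a) (hb : ContDiff ℝ (⊤ : ℕ∞) b)
    (hg : IsGate C ℓ a b χ) : ContDiff ℝ (⊤ : ℕ∞) (gateCurl χ a b) := by
  have h1 := contDiff_curX ha hb
  have h2 := contDiff_curY ha hb
  have h3 := contDiff_gateQuot ha hb hg
  unfold gateCurl
  fun_prop

theorem sq_gated_current_integrable (hs : IsSlowWave L ℓ a b c) (hc : c ≤ 1)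
    (hg : IsGate C ℓ a b χ) :
    Integrable (fun z => (χ z * curX a b z) ^ 2 +
      (χ z * (curY a b z - c / 2 * (1 - msq a b z))) ^ 2) := by
  have ha := hs.wave.smooth_re
  have hb := hs.wave.smooth_im
  have hχ := hg.smooth
  have h1 := contDiff_curX ha hb
  have h2 := contDiff_curY ha hb
  have h3 := contDiff_msq ha hb
  have hi : Integrable (fun z => 4 * gsq a b z + (1 - msq a b z) ^ 2) :=
    (hs.wave.integrable_gsq.const_mul 4).add hs.wave.integrable_pot
  refine hi.mono' (Continuous.aestronglyMeasurable (ContDiff.continuous (𝕜 := ℝ)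
    (n := (⊤ : ℕ∞)) (by fun_prop))) (ae_of_all _ fun z => ?_)
  rw [Real.norm_of_nonneg (by positivity), mul_pow, mul_pow, ← mul_add]
  have h4 := gated_current_sq_le hs hc z
  have h5 : χ z ^ 2 ≤ 1 := pow_le_one₀ (hg.nonneg z) (hg.le_one z)
  nlinarith [sq_nonneg (curX a b z), sq_nonneg (curY a b z - c / 2 * (1 - msq a b z))]

theorem gateQuot_sq_mul_current_le (hg : IsGate C ℓ a b χ) (z : ℂ) :
    gateQuot χ a b z ^ 2 * (curX a b z ^ 2 + curY a b z ^ 2) ≤ 4 * gsq a b z := by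
  have h1 := current_sq_le (a := a) (b := b) z
  have h2 := gateQuot_mul_msq hg z
  have h3 := gateQuot_nonneg hg z
  have h4 := gateQuot_le hg z
  have h5 := gsq_nonneg (a := a) (b := b) z
  calc _ ≤ gateQuot χ a b z ^ 2 * (msq a b z * gsq a b z) := by gcongr
    _ = gateQuot χ a b z * (gateQuot χ a b z * msq a b z) * gsq a b z := by ring
    _ = gateQuot χ a b z * χ z * gsq a b z := by rw [h2]
    _ ≤ 4 * 1 * gsq a b z := by
      gcongr
      · exact hg.nonneg z
      · exact hg.le_one z
    _ = _ := by ring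

theorem sq_gateQuot_current_integrable (h : IsWave a b c) (hg : IsGate C ℓ a b χ) :
    Integrable (fun z => (gateQuot χ a b z * curX a b z) ^ 2 +
      (gateQuot χ a b z * curY a b z) ^ 2) := by
  have ha := h.smooth_re
  have hb := h.smooth_im
  have h0 := contDiff_gateQuot ha hb hg
  have h1 := contDiff_curX ha hb
  have h2 := contDiff_curY ha hb
  refine (h.integrable_gsq.const_mul 4).mono' (Continuous.aestronglyMeasurable
    (ContDiff.continuous (𝕜 := ℝ) (n := (⊤ : ℕ∞)) (by fun_prop))) (ae_of_all _ fun z => ?_)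
  rw [Real.norm_of_nonneg (by positivity), mul_pow, mul_pow, ← mul_add]
  exact gateQuot_sq_mul_current_le hg z

theorem integral_gateDiv_eq_zero (hs : IsSlowWave L ℓ a b c) (hc : c ≤ 1)
    (hg : IsGate C ℓ a b χ) : ∫ z, gateDiv χ a b c z = 0 := by
  have ha := hs.wave.smooth_re
  have hb := hs.wave.smooth_im
  have hχ := hg.smooth
  have h1 := contDiff_curX ha hb
  have h2 := contDiff_curY ha hb
  have h3 := contDiff_msq ha hb
  have h4 := integral_div_eq_zero (Y₁ := fun w => χ w * curX a b w)
    (Y₂ := fun w => χ w * (curY a b w - c / 2 * (1 - msq a b w))) (by fun_prop) (by fun_prop)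
    (sq_gated_current_integrable hs hc hg) (by
      simp only [gateDiv_eq hs.wave hg]
      exact (contDiff_gateDiv ha hb hχ).continuous.integrable_of_hasCompactSupport
        (hg.hasCompactSupport_of_sq_le (gateDiv_sq_le hs hc)))
  simpa only [gateDiv_eq hs.wave hg] using h4

theorem integral_gateCurl_eq_zero (h : IsWave a b c) (hg : IsGate C ℓ a b χ) :
    ∫ z, gateCurl χ a b z = 0 := by
  have ha := h.smooth_re
  have hb := h.smooth_im
  have h0 := contDiff_gateQuot ha hb hg
  have h1 := contDiff_curX ha hb
  have h2 := contDiff_curY ha hb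
  have he : ∀ z, dX (fun w => gateQuot χ a b w * curY a b w) z +
      dY (fun w => (-1) * (gateQuot χ a b w * curX a b w)) z = gateCurl χ a b z := by
    intro z
    simp (disch := fun_prop) only [dY_const_mul, gateCurl]
    ring
  have h4 := integral_div_eq_zero (Y₁ := fun w => gateQuot χ a b w * curY a b w)
    (Y₂ := fun w => (-1) * (gateQuot χ a b w * curX a b w)) (by fun_prop) (by fun_prop)
    ((sq_gateQuot_current_integrable h hg).congr (ae_of_all _ fun z => by ring)) (by
      simp only [he]
      exact (contDiff_gateCurl ha hb hg).continuous.integrable_of_hasCompactSupport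
        (hg.hasCompactSupport_of_sq_le (gateCurl_sq_le ha hb hg)))
  simpa only [he] using h4

/-- The divergence and curl of the gated current are generated by a field which is small in sup
norm. -/
theorem exists_current_field (hs : IsSlowWave L ℓ a b c) (hg : IsGate C ℓ a b χ) (hc : c ≤ 1)
    (hL : 1 ≤ L) (hC : 1 ≤ C) (hℓ : 1 ≤ ℓ) : ∃ g₁ g₂,
    IsDivCurlSol (gateDiv χ a b c) (gateCurl χ a b) g₁ g₂ (C + 80)
      ((15 * Real.pi * L * C + (C + 80)) * Real.exp (-(ℓ / 8))) := by
  have ha := hs.wave.smooth_re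
  have hb := hs.wave.smooth_im
  have hχ := hg.smooth
  have hW0 : ∀ z, 0 ≤ msq a b z := fun z => msq_nonneg z
  have hd := fun z => gateDiv_sq_le (χ := χ) hs hc z
  have hω := fun z => gateCurl_sq_le ha hb hg z
  have hdc := hg.hasCompactSupport_of_sq_le hd
  have hωc := hg.hasCompactSupport_of_sq_le hω
  have hF0 : ∀ z, 0 ≤ dX χ z ^ 2 + dY χ z ^ 2 := fun z => by positivity
  have hE0 := Real.exp_pos (-(ℓ / 4))
  have hA : ∀ z, |gateDiv χ a b c z| + |gateCurl χ a b z| ≤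
      5 * L * C * Real.exp (-(ℓ / 4)) := by
    intro z
    have hG := hg.gradient_le z
    have h1 := hs.gsq_le z
    have h2 := hs.msq_le z
    have h3 := hW0 z
    have h4 := gsq_nonneg (a := a) (b := b) z
    have i1 : |gateDiv χ a b c z| ≤ 3 * L * C * Real.exp (-(ℓ / 4)) := by
      refine abs_le_of_sq_le_sq ?_ (by positivity)
      calc _ ≤ _ := hd z
        _ ≤ (C * Real.exp (-(ℓ / 4))) ^ 2 * (3 * L) ^ 2 := by
          refine mul_le_mul hG ?_ (by positivity) (by positivity)
          nlinarith
        _ = _ := by ring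
    have i2 : |gateCurl χ a b z| ≤ 2 * L * C * Real.exp (-(ℓ / 4)) := by
      refine abs_le_of_sq_le_sq ?_ (by positivity)
      calc _ ≤ _ := hω z
        _ ≤ (C * Real.exp (-(ℓ / 4))) ^ 2 * (2 * L) ^ 2 := by
          refine mul_le_mul hG ?_ (by positivity) (by positivity)
          nlinarith
        _ = _ := by ring
    linarith
  have hB : ∫ z, (|gateDiv χ a b c z| + |gateCurl χ a b z|) ≤ C + 80 := by
    have hk : 0 < ℓ := by linarith
    have hi1 := hg.integrable_gradient_sq.const_mul ℓ
    have hi2 := hs.wave.integrable_gsq.const_mul (ℓ⁻¹ * 4)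
    have hi3 := hs.wave.integrable_pot.const_mul (ℓ⁻¹ / 2)
    have hmono : ∫ z, (|gateDiv χ a b c z| + |gateCurl χ a b z|) ≤
        ∫ z, (ℓ * (dX χ z ^ 2 + dY χ z ^ 2) + ℓ⁻¹ * 4 * gsq a b z +
          ℓ⁻¹ / 2 * (1 - msq a b z) ^ 2) := by
      refine integral_mono ?_ ((hi1.add hi2).add hi3) fun z => ?_
      · exact ((contDiff_gateDiv ha hb hχ).continuous.integrable_of_hasCompactSupport hdc).abs.add
          ((contDiff_gateCurl ha hb hg).continuous.integrable_of_hasCompactSupport hωc).abs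
      · have h4 := gsq_nonneg (a := a) (b := b) z
        have j1 := abs_le_of_sq_le_mul hk (hF0 z) (by positivity) (hd z)
        have j2 := abs_le_of_sq_le_mul hk (hF0 z) (by positivity) (hω z)
        show |gateDiv χ a b c z| + |gateCurl χ a b z| ≤ _
        linarith
    have hi12 : Integrable (fun z => ℓ * (dX χ z ^ 2 + dY χ z ^ 2) + ℓ⁻¹ * 4 * gsq a b z) :=
      hi1.add hi2
    rw [integral_add hi12 hi3, integral_add hi1 hi2, integral_const_mul,
      integral_const_mul, integral_const_mul] at hmono
    have k1 : ℓ * ∫ z, (dX χ z ^ 2 + dY χ z ^ 2) ≤ C := by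
      have := mul_le_mul_of_nonneg_left hg.integral_gradient_le hk.le
      rwa [mul_div_cancel₀ _ hk.ne'] at this
    have k2 : ℓ⁻¹ * 4 * ∫ z, gsq a b z ≤ 64 := by
      have := mul_le_mul_of_nonneg_left hs.integral_gsq_le (show 0 ≤ ℓ⁻¹ * 4 by positivity)
      field_simp at this ⊢
      linarith
    have k3 : ℓ⁻¹ / 2 * ∫ z, (1 - msq a b z) ^ 2 ≤ 16 := by
      have := mul_le_mul_of_nonneg_left hs.integral_pot_le (show 0 ≤ ℓ⁻¹ / 2 by positivity)
      field_simp at this ⊢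
      linarith
    linarith
  obtain ⟨g₁, g₂, hsol⟩ := exists_isDivCurlSol (contDiff_gateDiv (c := c) ha hb hχ)
    (contDiff_gateCurl ha hb hg) hdc hωc (integral_gateDiv_eq_zero hs hc hg)
    (integral_gateCurl_eq_zero hs.wave hg) hA (by linarith) hB (Real.exp_pos (ℓ / 8))
  refine ⟨g₁, g₂, ?_⟩
  convert hsol using 1
  have e1 : (C + 80) / Real.exp (ℓ / 8) = (C + 80) * Real.exp (-(ℓ / 8)) := by
    rw [Real.exp_neg, div_eq_mul_inv]
  rw [e1]
  have : Real.exp (-(ℓ / 8)) = Real.exp (-(ℓ / 4)) * Real.exp (ℓ / 8) := by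
    rw [← Real.exp_add]
    congr 1
    ring
  linear_combination 15 * Real.pi * L * C * this

end field

section remainder

variable {a b χ g₁ g₂ : ℂ → ℝ} {c B C ℓ L M : ℝ}

/-- Squared distance from the normalized gated current to the field `(g₁, g₂)`. -/
def gateRem (χ a b g₁ g₂ : ℂ → ℝ) (z : ℂ) : ℝ :=
  (gateQuot χ a b z * curX a b z - g₁ z) ^ 2 + (gateQuot χ a b z * curY a b z - g₂ z) ^ 2

theorem integrable_sq_sub {f₁ f₂ : ℂ → ℝ} (hf₁ : Continuous f₁) (hf₂ : Continuous f₂)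
    (hg₁ : Continuous g₁) (hg₂ : Continuous g₂)
    (hf : Integrable (fun z => f₁ z ^ 2 + f₂ z ^ 2))
    (hg : Integrable (fun z => g₁ z ^ 2 + g₂ z ^ 2)) :
    Integrable (fun z => (f₁ z - g₁ z) ^ 2 + (f₂ z - g₂ z) ^ 2) := by
  refine ((hf.add hg).const_mul 2).mono' (Continuous.aestronglyMeasurable (by fun_prop))
    (ae_of_all _ fun z => ?_)
  rw [Real.norm_of_nonneg (by positivity)]
  simp only [Pi.add_apply]
  nlinarith [sq_nonneg (f₁ z + g₁ z), sq_nonneg (f₂ z + g₂ z)]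

theorem gateRem_le {z : ℂ} (hg : IsGate C ℓ a b χ) (hM : g₁ z ^ 2 + g₂ z ^ 2 ≤ M ^ 2) :
    gateRem χ a b g₁ g₂ z ≤
      8 * ((gateQuot χ a b z * curX a b z - g₁ z) * (χ z * curX a b z - g₁ z) +
        (gateQuot χ a b z * curY a b z - g₂ z) *
          (χ z * (curY a b z - c / 2 * (1 - msq a b z)) - g₂ z)) +
      16 * (2 * M ^ 2 + c ^ 2 / 2) * (1 - msq a b z) ^ 2 := by
  have hW := gateQuot_mul_msq hg z
  have hχ0 := hg.nonneg z
  have hχ1 := hg.le_one z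
  rw [gateRem]
  by_cases hz : msq a b z < 1 / 4
  · have h0 : gateQuot χ a b z = 0 := by rw [gateQuot, hg.eq_zero z hz, zero_div]
    rw [h0, hg.eq_zero z hz]
    have : 0 ≤ 16 * (2 * M ^ 2 + c ^ 2 / 2) * (1 - msq a b z) ^ 2 := by positivity
    nlinarith [sq_nonneg (g₁ z), sq_nonneg (g₂ z)]
  rw [not_lt] at hz
  set k := gateQuot χ a b z
  set W := msq a b z
  set x := curX a b z
  set y := curY a b z
  set s := χ z
  set D₁ := k * x - g₁ z with hD₁
  set D₂ := k * y - g₂ z with hD₂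
  have e1 : s * x - g₁ z = W * D₁ + (W - 1) * g₁ z := by rw [hD₁, ← hW]; ring
  have e2 : s * (y - c / 2 * (1 - W)) - g₂ z = W * D₂ + (W - 1) * (g₂ z + s * (c / 2)) := by
    rw [hD₂, ← hW]; ring
  rw [e1, e2]
  have hV : g₁ z ^ 2 + (g₂ z + s * (c / 2)) ^ 2 ≤ 2 * M ^ 2 + c ^ 2 / 2 := by
    have : (s * (c / 2)) ^ 2 ≤ c ^ 2 / 4 := by
      have : s ^ 2 ≤ 1 := pow_le_one₀ hχ0 hχ1
      nlinarith [sq_nonneg c]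
    nlinarith [sq_nonneg (g₂ z - s * (c / 2)), sq_nonneg (g₁ z)]
  have hV2 := mul_le_mul_of_nonneg_right hV (sq_nonneg (1 - W))
  set v := g₂ z + s * (c / 2)
  have h1 := sq_nonneg (D₁ + 4 * (W - 1) * g₁ z)
  have h2 := sq_nonneg (D₂ + 4 * (W - 1) * v)
  have h3 := mul_nonneg (sub_nonneg.2 hz) (add_nonneg (sq_nonneg D₁) (sq_nonneg D₂))
  nlinarith

/-- Testing the divergence-free field against the curl-free one. -/
theorem integral_gateRem_le (hs : IsSlowWave L ℓ a b c) (hc : c ≤ 1) (hg : IsGate C ℓ a b χ)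
    (hsol : IsDivCurlSol (gateDiv χ a b c) (gateCurl χ a b) g₁ g₂ B M) :
    Integrable (gateRem χ a b g₁ g₂) ∧
    ∫ z, gateRem χ a b g₁ g₂ z ≤
      16 * (2 * M ^ 2 + c ^ 2 / 2) * ∫ z, (1 - msq a b z) ^ 2 := by
  have ha := hs.wave.smooth_re
  have hb := hs.wave.smooth_im
  have hχ := hg.smooth
  have h0 := contDiff_gateQuot ha hb hg
  have h1 := contDiff_curX ha hb
  have h2 := contDiff_curY ha hb
  have h3 := contDiff_msq ha hb
  have hg₁ := hsol.smooth_fst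
  have hg₂ := hsol.smooth_snd
  have hDi := integrable_sq_sub (h0.mul h1).continuous (h0.mul h2).continuous hg₁.continuous
    hg₂.continuous (sq_gateQuot_current_integrable hs.wave hg) hsol.integrable_sq
  have hYs : ContDiff ℝ (⊤ : ℕ∞) (fun w => χ w * (curY a b w - c / 2 * (1 - msq a b w))) := by
    fun_prop
  have hYi := integrable_sq_sub (hχ.mul h1).continuous hYs.continuous hg₁.continuous
    hg₂.continuous (sq_gated_current_integrable hs hc hg) hsol.integrable_sq
  have hin := integral_inner_eq_zero (D₁ := fun w => gateQuot χ a b w * curX a b w - g₁ w)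
    (D₂ := fun w => gateQuot χ a b w * curY a b w - g₂ w)
    (Y₁ := fun w => χ w * curX a b w - g₁ w)
    (Y₂ := fun w => χ w * (curY a b w - c / 2 * (1 - msq a b w)) - g₂ w)
    (by fun_prop) (by fun_prop) (by fun_prop) (by fun_prop) (fun z => by
      have e := hsol.curl_eq z
      have k1 : ContDiff ℝ (⊤ : ℕ∞) (fun w => gateQuot χ a b w * curX a b w) := by fun_prop
      have k2 : ContDiff ℝ (⊤ : ℕ∞) (fun w => gateQuot χ a b w * curY a b w) := by fun_prop
      rw [dX_sub k2 hg₂, dY_sub k1 hg₁]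
      rw [gateCurl] at e
      linarith) (fun z => by
      have e := hsol.div_eq z
      have k1 : ContDiff ℝ (⊤ : ℕ∞) (fun w => χ w * curX a b w) := by fun_prop
      rw [dX_sub k1 hg₁, dY_sub hYs hg₂]
      rw [← gateDiv_eq hs.wave hg] at e
      linarith) hDi hYi
  refine ⟨hDi, ?_⟩
  have hmono := integral_mono (f := gateRem χ a b g₁ g₂) hDi ((hin.1.const_mul 8).add
    (hs.wave.integrable_pot.const_mul (16 * (2 * M ^ 2 + c ^ 2 / 2))))
    fun z => gateRem_le hg (hsol.sup_le z)
  rwa [integral_add' (hin.1.const_mul 8) (hs.wave.integrable_pot.const_mul _),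
    integral_const_mul, integral_const_mul, hin.2, mul_zero, zero_add] at hmono

end remainder

theorem sqrt_rpow_le {q s k : ℝ} (hq1 : 1 ≤ q) (hq2 : q < 2) (hs : 0 ≤ s) (hk : 0 < k) :
    √s ^ q ≤ k ^ (q - 2) * s + k ^ q := by
  have hx := Real.sqrt_nonneg s
  have h1 : 0 ≤ k ^ (q - 2) * s := by positivity
  have h2 : 0 ≤ k ^ q := by positivity
  rcases le_total (√s) k with h | h
  · have := Real.rpow_le_rpow hx h (by linarith : 0 ≤ q)
    linarith
  · have hx0 : 0 < √s := hk.trans_le h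
    have h3 : √s ^ q = √s ^ (q - 2) * s := by
      nth_rw 3 [← Real.sq_sqrt hs]
      rw [← Real.rpow_natCast, ← Real.rpow_add hx0]
      norm_num
    have h4 : √s ^ (q - 2) ≤ k ^ (q - 2) :=
      Real.rpow_le_rpow_of_nonpos hk h (by linarith)
    rw [h3]
    have := mul_le_mul_of_nonneg_right h4 hs
    linarith

theorem sqrt_add_rpow_le {q s t : ℝ} (hq : 0 ≤ q) (hs : 0 ≤ s) (ht : 0 ≤ t) :
    √(s + t) ^ q ≤ 2 ^ q * √s ^ q + 2 ^ q * √t ^ q := by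
  have key : ∀ x y : ℝ, 0 ≤ x → 0 ≤ y → x ≤ y → √(x + y) ^ q ≤ 2 ^ q * √y ^ q := by
    intro x y hx hy hxy
    rw [← Real.mul_rpow (by norm_num) (Real.sqrt_nonneg _)]
    refine Real.rpow_le_rpow (Real.sqrt_nonneg _) ?_ hq
    rw [show (2 : ℝ) = √4 by rw [show (4 : ℝ) = 2 ^ 2 by norm_num]; simp, ← Real.sqrt_mul (by norm_num)]
    exact Real.sqrt_le_sqrt (by linarith)
  have h1 : 0 ≤ 2 ^ q * √s ^ q := by positivity
  have h2 : 0 ≤ 2 ^ q * √t ^ q := by positivity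
  rcases le_total s t with h | h
  · linarith [key s t hs ht h]
  · rw [add_comm s t]
    linarith [key t s ht hs h]

section split

variable {a b χ g₁ g₂ : ℂ → ℝ} {c B C ℓ L M : ℝ}

/-- Where the gate is open, the gradient splits into modulus, remainder and field. -/
theorem gsq_le_of_gate_eq_one (hs : IsSlowWave L ℓ a b c) (hg : IsGate C ℓ a b χ) {z : ℂ}
    (hz : χ z = 1) : gsq a b z ≤ (4 * gateRem χ a b g₁ g₂ z +
      (dX (msq a b) z ^ 2 + dY (msq a b) z ^ 2)) + 4 * (g₁ z ^ 2 + g₂ z ^ 2) := by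
  have hW : 1 / 4 ≤ msq a b z := by
    by_contra! h
    rw [hg.eq_zero z h] at hz
    norm_num at hz
  have hW2 := hs.msq_le z
  have h1 := msq_mul_gsq hs.wave.smooth_re hs.wave.smooth_im z
  have h2 := gateQuot_mul_msq hg z
  rw [hz] at h2
  have h3 : curX a b z ^ 2 + curY a b z ^ 2 = msq a b z ^ 2 *
      ((gateQuot χ a b z * curX a b z) ^ 2 + (gateQuot χ a b z * curY a b z) ^ 2) := by
    linear_combination -(curX a b z ^ 2 + curY a b z ^ 2) * (gateQuot χ a b z * msq a b z + 1) * h2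
  set k₁ := gateQuot χ a b z * curX a b z with hk₁
  set k₂ := gateQuot χ a b z * curY a b z with hk₂
  have h4 : k₁ ^ 2 + k₂ ^ 2 ≤ 2 * gateRem χ a b g₁ g₂ z + 2 * (g₁ z ^ 2 + g₂ z ^ 2) := by
    rw [gateRem, ← hk₁, ← hk₂]
    nlinarith [sq_nonneg (k₁ - 2 * g₁ z), sq_nonneg (k₂ - 2 * g₂ z)]
  have hG : 0 ≤ dX (msq a b) z ^ 2 + dY (msq a b) z ^ 2 := by positivity
  have hK : 0 ≤ k₁ ^ 2 + k₂ ^ 2 := by positivity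
  have h5 : msq a b z * gsq a b z ≤ msq a b z *
      ((dX (msq a b) z ^ 2 + dY (msq a b) z ^ 2) + 2 * (k₁ ^ 2 + k₂ ^ 2)) := by
    rw [h1, h3]
    nlinarith [mul_nonneg (sub_nonneg.2 hW) hG, mul_nonneg (sub_nonneg.2 hW2) (mul_nonneg
      (by linarith : 0 ≤ msq a b z) hK)]
  have := le_of_mul_le_mul_left h5 (by linarith)
  linarith

theorem sqrt_gsq_rpow_le (hs : IsSlowWave L ℓ a b c) (hg : IsGate C ℓ a b χ) {q k m t : ℝ}
    (hq1 : 1 ≤ q) (hq2 : q < 2) (hk : 0 < k) (hm : 0 < m) (ht : 0 < t) (z : ℂ) :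
    √(gsq a b z) ^ q ≤ (k ^ (q - 2) * gsq a b z +
        k ^ q * ({w | χ w ≠ 1}.indicator 1 z + (t ^ 2)⁻¹ * (1 - msq a b z) ^ 2) +
        2 ^ q * m ^ (q - 2) * (4 * gateRem χ a b g₁ g₂ z +
          2 * (1 / (1 + ((1 - msq a b z) / t) ^ 2) *
            (dX (msq a b) z ^ 2 + dY (msq a b) z ^ 2)))) +
      2 ^ q * m ^ q + 4 ^ q * √(g₁ z ^ 2 + g₂ z ^ 2) ^ q := by
  have hgs := gsq_nonneg (a := a) (b := b) z
  have hG : 0 ≤ dX (msq a b) z ^ 2 + dY (msq a b) z ^ 2 := by positivity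
  have hR : 0 ≤ gateRem χ a b g₁ g₂ z := by rw [gateRem]; positivity
  have hI : 0 ≤ {w | χ w ≠ 1}.indicator (1 : ℂ → ℝ) z :=
    Set.indicator_nonneg (fun _ _ => zero_le_one) z
  set G := dX (msq a b) z ^ 2 + dY (msq a b) z ^ 2
  set w := 1 / (1 + ((1 - msq a b z) / t) ^ 2) with hw
  have hw0 : 0 ≤ w := by positivity
  have hkq : 0 < k ^ q := by positivity
  have p1 : 0 ≤ k ^ (q - 2) * gsq a b z := by positivity
  have p2 : 0 ≤ k ^ q * ({w | χ w ≠ 1}.indicator 1 z + (t ^ 2)⁻¹ * (1 - msq a b z) ^ 2) := by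
    positivity
  have p3 : 0 ≤ 2 ^ q * m ^ (q - 2) * (4 * gateRem χ a b g₁ g₂ z + 2 * (w * G)) := by positivity
  have p4 : 0 ≤ 2 ^ q * m ^ q := by positivity
  have p5 : 0 ≤ 4 ^ q * √(g₁ z ^ 2 + g₂ z ^ 2) ^ q := by positivity
  have hsmall : 1 ≤ {w | χ w ≠ 1}.indicator (1 : ℂ → ℝ) z + (t ^ 2)⁻¹ * (1 - msq a b z) ^ 2 →
      √(gsq a b z) ^ q ≤ k ^ (q - 2) * gsq a b z +
        k ^ q * ({w | χ w ≠ 1}.indicator 1 z + (t ^ 2)⁻¹ * (1 - msq a b z) ^ 2) := by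
    intro h
    have h1 := sqrt_rpow_le hq1 hq2 hgs hk
    have h2 := mul_le_mul_of_nonneg_left h hkq.le
    linarith
  by_cases hχ : χ z = 1
  · by_cases hWt : (1 - msq a b z) ^ 2 ≤ t ^ 2
    · have hw2 : 1 ≤ 2 * w := by
        have : ((1 - msq a b z) / t) ^ 2 ≤ 1 := by
          rw [div_pow, div_le_one (by positivity)]
          exact hWt
        rw [hw, mul_one_div, le_div_iff₀ (by positivity)]
        linarith
      have h1 := gsq_le_of_gate_eq_one (g₁ := g₁) (g₂ := g₂) hs hg hχ
      have h2 : gsq a b z ≤ (4 * gateRem χ a b g₁ g₂ z + 2 * (w * G)) +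
          4 * (g₁ z ^ 2 + g₂ z ^ 2) := by
        have := mul_le_mul_of_nonneg_right hw2 hG
        linarith
      have h3 := Real.rpow_le_rpow (Real.sqrt_nonneg _) (Real.sqrt_le_sqrt h2)
        (by linarith : 0 ≤ q)
      have h4 := sqrt_add_rpow_le (q := q) (by linarith)
        (show 0 ≤ 4 * gateRem χ a b g₁ g₂ z + 2 * (w * G) by positivity)
        (show 0 ≤ 4 * (g₁ z ^ 2 + g₂ z ^ 2) by positivity)
      have h5 := sqrt_rpow_le hq1 hq2
        (show 0 ≤ 4 * gateRem χ a b g₁ g₂ z + 2 * (w * G) by positivity) hm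
      have h6 : 2 ^ q * √(4 * (g₁ z ^ 2 + g₂ z ^ 2)) ^ q =
          4 ^ q * √(g₁ z ^ 2 + g₂ z ^ 2) ^ q := by
        rw [Real.sqrt_mul (by norm_num), Real.mul_rpow (Real.sqrt_nonneg _) (Real.sqrt_nonneg _),
          show √4 = (2 : ℝ) by rw [show (4 : ℝ) = 2 ^ 2 by norm_num]; simp, ← mul_assoc,
          ← Real.mul_rpow (by norm_num) (by norm_num)]
        norm_num
      have h7 := mul_le_mul_of_nonneg_left h5 (show (0 : ℝ) ≤ 2 ^ q by positivity)
      linarith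
    · rw [not_le] at hWt
      have := hsmall (by
        have : 1 ≤ (t ^ 2)⁻¹ * (1 - msq a b z) ^ 2 := by
          rw [inv_mul_eq_div, le_div_iff₀ (by positivity)]
          linarith
        linarith)
      linarith
  · have := hsmall (by
      rw [Set.indicator_of_mem (by exact hχ), Pi.one_apply]
      have : 0 ≤ (t ^ 2)⁻¹ * (1 - msq a b z) ^ 2 := by positivity
      linarith)
    linarith

end split

section integrate

variable {a b χ g₁ g₂ : ℂ → ℝ} {c B C ℓ L M : ℝ}

theorem integral_sqrt_gsq_rpow_le (hs : IsSlowWave L ℓ a b c) (hc : c ≤ 1)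
    (hg : IsGate C ℓ a b χ) (hC : 0 ≤ C)
    (hsol : IsDivCurlSol (gateDiv χ a b c) (gateCurl χ a b) g₁ g₂ B M) {q k m t r : ℝ}
    (hq1 : 1 ≤ q) (hq2 : q < 2) (hk : 0 < k) (hm : 0 < m) (ht : 0 < t) (hr : 0 < r) (X : ℂ) :
    ∫ z in ball X r, √(gsq a b z) ^ q ≤
      k ^ (q - 2) * (16 * ℓ) + k ^ q * (C * Real.exp ℓ + (t ^ 2)⁻¹ * (32 * ℓ)) +
      2 ^ q * m ^ (q - 2) * (4 * (16 * (2 * M ^ 2 + c ^ 2 / 2) * (32 * ℓ)) +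
        2 * ((4 * t + 4 * c) * (16 * ℓ) + 2 * c * (32 * ℓ))) +
      2 ^ q * m ^ q * (Real.pi * r ^ 2) +
      4 ^ q * (2 ^ q * B ^ q * (2 * Real.pi / (2 - q) + Real.pi) * r ^ (2 - q)) := by
  have ha := hs.wave.smooth_re
  have hb := hs.wave.smooth_im
  have hχ := hg.smooth
  have hW := contDiff_msq ha hb
  have hgs := contDiff_gsq ha hb
  have hg₁ := hsol.smooth_fst.continuous
  have hg₂ := hsol.smooth_snd.continuous
  have hq0 : 0 ≤ q := by linarith
  have hc0 := hs.speed_pos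
  have hcont : ∀ {f : ℂ → ℝ}, Continuous f → IntegrableOn f (ball X r) := fun hf =>
    (hf.continuousOn.integrableOn_compact (isCompact_closedBall X r)).mono_set ball_subset_closedBall
  -- the set where the gate is not open
  have hSm : MeasurableSet {w | χ w ≠ 1} :=
    (isOpen_ne_fun hχ.continuous continuous_const).measurableSet
  have hSf : volume {w | χ w ≠ 1} ≠ ⊤ := (hg.volume_le.trans_lt ENNReal.ofReal_lt_top).ne
  have hSi : Integrable ({w | χ w ≠ 1}.indicator (1 : ℂ → ℝ)) :=
    (integrable_indicator_iff hSm).2 (integrableOn_const hSf)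
  have hSv : ∫ z, {w | χ w ≠ 1}.indicator (1 : ℂ → ℝ) z ≤ C * Real.exp ℓ := by
    rw [integral_indicator_one hSm, measureReal_def]
    exact ENNReal.toReal_le_of_le_ofReal (by positivity) hg.volume_le
  -- the weighted gradient of the modulus
  have hwi : Integrable (fun z => 1 / (1 + ((1 - msq a b z) / t) ^ 2) *
      (dX (msq a b) z ^ 2 + dY (msq a b) z ^ 2)) := by
    refine (hs.wave.integrable_gsq.const_mul 8).mono' ?_ (ae_of_all _ fun z => ?_)
    · refine Continuous.aestronglyMeasurable (Continuous.mul (Continuous.div₀ (by fun_prop)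
        (by have := hW.continuous; fun_prop) fun z => ?_) (ContDiff.continuous (𝕜 := ℝ)
        (n := (⊤ : ℕ∞)) (by fun_prop)))
      positivity
    · rw [Real.norm_of_nonneg (by positivity)]
      have h1 := gradient_msq_sq_le ha hb z
      have h2 := hs.msq_le z
      have h3 := gsq_nonneg (a := a) (b := b) z
      have h4 : 1 / (1 + ((1 - msq a b z) / t) ^ 2) ≤ 1 := by
        rw [div_le_one (by positivity)]
        linarith [sq_nonneg ((1 - msq a b z) / t)]
      calc _ ≤ 1 * (dX (msq a b) z ^ 2 + dY (msq a b) z ^ 2) := by gcongr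
        _ ≤ _ := by nlinarith
  have hwv := hs.wave.integral_gradient_msq_le hs.msq_le ht
  rw [abs_of_pos hc0] at hwv
  obtain ⟨hRi, hRv⟩ := integral_gateRem_le hs hc hg hsol
  have hgi := hs.wave.integrable_gsq
  have hpi := hs.wave.integrable_pot
  have hgv := hs.integral_gsq_le
  have hpv := hs.integral_pot_le
  -- global part
  have i1 : Integrable (fun z => k ^ (q - 2) * gsq a b z) := hgi.const_mul _
  have i2' : Integrable (fun z => {w | χ w ≠ 1}.indicator (1 : ℂ → ℝ) z +
      (t ^ 2)⁻¹ * (1 - msq a b z) ^ 2) := hSi.add (hpi.const_mul _)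
  have i2 : Integrable (fun z => k ^ q * ({w | χ w ≠ 1}.indicator (1 : ℂ → ℝ) z +
      (t ^ 2)⁻¹ * (1 - msq a b z) ^ 2)) := i2'.const_mul _
  have i3' : Integrable (fun z => 4 * gateRem χ a b g₁ g₂ z +
      2 * (1 / (1 + ((1 - msq a b z) / t) ^ 2) *
        (dX (msq a b) z ^ 2 + dY (msq a b) z ^ 2))) := (hRi.const_mul 4).add (hwi.const_mul 2)
  have i3 : Integrable (fun z => 2 ^ q * m ^ (q - 2) * (4 * gateRem χ a b g₁ g₂ z +
      2 * (1 / (1 + ((1 - msq a b z) / t) ^ 2) *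
        (dX (msq a b) z ^ 2 + dY (msq a b) z ^ 2)))) := i3'.const_mul _
  have i12 : Integrable (fun z => k ^ (q - 2) * gsq a b z + k ^ q *
      ({w | χ w ≠ 1}.indicator (1 : ℂ → ℝ) z + (t ^ 2)⁻¹ * (1 - msq a b z) ^ 2)) := i1.add i2
  set F : ℂ → ℝ := fun z => k ^ (q - 2) * gsq a b z +
        k ^ q * ({w | χ w ≠ 1}.indicator 1 z + (t ^ 2)⁻¹ * (1 - msq a b z) ^ 2) +
        2 ^ q * m ^ (q - 2) * (4 * gateRem χ a b g₁ g₂ z +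
          2 * (1 / (1 + ((1 - msq a b z) / t) ^ 2) *
            (dX (msq a b) z ^ 2 + dY (msq a b) z ^ 2))) with hF
  have hFi : Integrable F := i12.add i3
  have hF0 : ∀ z, 0 ≤ F z := by
    intro z
    have hgs := gsq_nonneg (a := a) (b := b) z
    have hR : 0 ≤ gateRem χ a b g₁ g₂ z := by rw [gateRem]; positivity
    have hI : 0 ≤ {w | χ w ≠ 1}.indicator (1 : ℂ → ℝ) z :=
      Set.indicator_nonneg (fun _ _ => zero_le_one) z
    rw [hF]
    positivity
  have hFv : ∫ z, F z ≤ k ^ (q - 2) * (16 * ℓ) +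
      k ^ q * (C * Real.exp ℓ + (t ^ 2)⁻¹ * (32 * ℓ)) +
      2 ^ q * m ^ (q - 2) * (4 * (16 * (2 * M ^ 2 + c ^ 2 / 2) * (32 * ℓ)) +
        2 * ((4 * t + 4 * c) * (16 * ℓ) + 2 * c * (32 * ℓ))) := by
    rw [hF, integral_add i12 i3, integral_add i1 i2, integral_const_mul, integral_const_mul,
      integral_add hSi (hpi.const_mul _), integral_const_mul, integral_const_mul,
      integral_add (hRi.const_mul 4) (hwi.const_mul 2), integral_const_mul, integral_const_mul]
    have e1 : 16 * (2 * M ^ 2 + c ^ 2 / 2) * ∫ z, (1 - msq a b z) ^ 2 ≤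
        16 * (2 * M ^ 2 + c ^ 2 / 2) * (32 * ℓ) := by gcongr
    have e2 : (4 * t + 4 * c) * (∫ z, gsq a b z) + 2 * c * ∫ z, (1 - msq a b z) ^ 2 ≤
        (4 * t + 4 * c) * (16 * ℓ) + 2 * c * (32 * ℓ) := by gcongr
    have e3 := hRv.trans e1
    have e4 := hwv.trans e2
    gcongr
  -- local part
  have hH : Continuous fun z => 4 ^ q * √(g₁ z ^ 2 + g₂ z ^ 2) ^ q := by
    refine continuous_const.mul (Continuous.rpow_const (by fun_prop) fun z => Or.inr hq0)
  have hL : Continuous fun z => √(gsq a b z) ^ q :=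
    Continuous.rpow_const (by have := hgs.continuous; fun_prop) fun z => Or.inr hq0
  have hKi : IntegrableOn (fun _ : ℂ => 2 ^ q * m ^ q) (ball X r) := hcont continuous_const
  have hFK : IntegrableOn (fun z => F z + 2 ^ q * m ^ q) (ball X r) := hFi.integrableOn.add hKi
  have hmono : ∫ z in ball X r, √(gsq a b z) ^ q ≤
      ∫ z in ball X r, (F z + 2 ^ q * m ^ q + 4 ^ q * √(g₁ z ^ 2 + g₂ z ^ 2) ^ q) :=
    integral_mono (hcont hL) (hFK.add (hcont hH))
      fun z => sqrt_gsq_rpow_le hs hg hq1 hq2 hk hm ht z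
  rw [integral_add hFK (hcont hH), integral_add hFi.integrableOn hKi, setIntegral_const,
    volume_ball_complex_real X hr.le, integral_const_mul, smul_eq_mul] at hmono
  have hFl : ∫ z in ball X r, F z ≤ ∫ z, F z :=
    setIntegral_le_integral hFi (Eventually.of_forall hF0)
  have hHv := mul_le_mul_of_nonneg_left (hsol.integral_rpow_le q r hq1 hq2 hr X)
    (show (0 : ℝ) ≤ 4 ^ q by positivity)
  linarith

end integrate

theorem exists_integral_sqrt_gsq_rpow_le {L q : ℝ} (hL : 1 ≤ L) (hq1 : 1 ≤ q) (hq2 : q < 2) :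
    ∃ K : ℝ, 0 < K ∧ ∀ᶠ ℓ : ℝ in atTop, ∀ (a b : ℂ → ℝ) (c : ℝ), IsSlowWave L ℓ a b c →
      ∀ X : ℂ, ∫ z in ball X (Real.exp ℓ), √(gsq a b z) ^ q ≤ K * Real.exp ℓ ^ (2 - q) := by
  obtain ⟨C, hC, hgate⟩ := exists_gate hL
  set N := 15 * Real.pi * L * C + (C + 80) with hN
  have hq0 : 0 < 2 - q := by linarith
  have hB : (0 : ℝ) < C + 80 := by linarith
  refine ⟨1 + 2 ^ q + 2 ^ q * Real.pi +
    4 ^ q * (2 ^ q * (C + 80) ^ q * (2 * Real.pi / (2 - q) + Real.pi)), by positivity, ?_⟩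
  have ev1 := (tendsto_pow_mul_exp_neg_mul (4096 * N ^ 2 + 128) 1
    (show (0 : ℝ) < 1 / 4 by norm_num)).eventually (ge_mem_nhds (show (0 : ℝ) < 1 / 2 by norm_num))
  have ev2 := (tendsto_pow_mul_exp_neg_mul 10240 2
    (show (0 : ℝ) < 1 by norm_num)).eventually (ge_mem_nhds (show (0 : ℝ) < 1 / 2 by norm_num))
  have ev3 := (tendsto_pow_mul_exp_neg_mul (48 + C) 1
    (show (0 : ℝ) < (2 - q) / 2 by linarith)).eventually
    (ge_mem_nhds (show (0 : ℝ) < 1 by norm_num))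
  filter_upwards [hgate, ev1, ev2, ev3, eventually_ge_atTop 1] with ℓ hgate h1 h2 h3 hℓ
  intro a b c hs X
  obtain ⟨χ, hg⟩ := hgate a b c hs
  have hE := Real.exp_pos (-ℓ)
  have hc0 := hs.speed_pos
  have hcl := hs.speed_le
  rw [one_mul] at h2
  rw [pow_one] at h1 h3
  have hc : c ≤ 1 := by nlinarith [mul_pos (show 0 < ℓ by linarith) hE]
  obtain ⟨g₁, g₂, hsol⟩ := exists_current_field hs hg hc hL hC hℓ
  have hmain := integral_sqrt_gsq_rpow_le hs hc hg (by linarith) hsol hq1 hq2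
    (Real.exp_pos (-(ℓ / 2))) (Real.exp_pos (-ℓ)) (Real.exp_pos (-(ℓ / 4))) (Real.exp_pos ℓ) X
  rw [← hN] at hmain
  set s := Real.exp ((2 - q) / 2 * ℓ) with hsdef
  have hs0 : 0 < s := Real.exp_pos _
  have eQ : Real.exp ℓ ^ (2 - q) = s * s := by
    rw [← Real.exp_mul, hsdef, ← Real.exp_add]
    congr 1
    ring
  have ek : Real.exp (-(ℓ / 2)) ^ (q - 2) = s := by
    rw [← Real.exp_mul, hsdef]
    congr 1
    ring
  have ekq : Real.exp (-(ℓ / 2)) ^ q * Real.exp ℓ = s := by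
    rw [← Real.exp_mul, hsdef, ← Real.exp_add]
    congr 1
    ring
  have ekt : Real.exp (-(ℓ / 2)) ^ q * (Real.exp (-(ℓ / 4)) ^ 2)⁻¹ ≤ s := by
    rw [← Real.exp_mul, hsdef, ← Real.exp_nat_mul, ← Real.exp_neg, ← Real.exp_add]
    apply Real.exp_le_exp.2
    push_cast
    linarith
  have em : Real.exp (-ℓ) ^ (q - 2) = s * s := by
    rw [← eQ, ← Real.exp_mul, ← Real.exp_mul]
    congr 1
    ring
  have emr : Real.exp (-ℓ) ^ q * Real.exp ℓ ^ 2 = s * s := by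
    rw [← eQ, ← Real.exp_mul, ← Real.exp_mul, ← Real.exp_nat_mul, ← Real.exp_add]
    congr 1
    push_cast
    ring
  have hA : Real.exp (-(ℓ / 2)) ^ (q - 2) * (16 * ℓ) + Real.exp (-(ℓ / 2)) ^ q *
      (C * Real.exp ℓ + (Real.exp (-(ℓ / 4)) ^ 2)⁻¹ * (32 * ℓ)) ≤ s * s := by
    have k1 : (48 + C) * ℓ ≤ s := by
      rw [Real.exp_neg, ← hsdef, mul_inv_le_iff₀ hs0, one_mul] at h3
      exact h3
    have k2 := mul_le_mul_of_nonneg_right ekt (show 0 ≤ 32 * ℓ by linarith)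
    have k3 := mul_le_mul_of_nonneg_left k1 hs0.le
    have k4 : s * C ≤ s * (C * ℓ) := by
      apply mul_le_mul_of_nonneg_left _ hs0.le
      nlinarith
    rw [ek]
    calc _ = s * (16 * ℓ) + C * (Real.exp (-(ℓ / 2)) ^ q * Real.exp ℓ) +
          Real.exp (-(ℓ / 2)) ^ q * (Real.exp (-(ℓ / 4)) ^ 2)⁻¹ * (32 * ℓ) := by ring
      _ ≤ s * s := by
        rw [ekq]
        linarith
  have hM : (N * Real.exp (-(ℓ / 8))) ^ 2 = N ^ 2 * Real.exp (-(1 / 4 * ℓ)) := by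
    rw [mul_pow, ← Real.exp_nat_mul]
    congr 2
    push_cast
    ring
  have hT : 4 * (16 * (2 * (N * Real.exp (-(ℓ / 8))) ^ 2 + c ^ 2 / 2) * (32 * ℓ)) +
      2 * ((4 * Real.exp (-(ℓ / 4)) + 4 * c) * (16 * ℓ) + 2 * c * (32 * ℓ)) ≤ 1 := by
    rw [hM, show ℓ / 4 = 1 / 4 * ℓ by ring]
    have hc2 : c ^ 2 ≤ c := by nlinarith
    have hcl2 := mul_le_mul_of_nonneg_right hcl (show 0 ≤ ℓ by linarith)
    have hc2l := mul_le_mul_of_nonneg_right hc2 (show 0 ≤ ℓ by linarith)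
    generalize Real.exp (-(1 / 4 * ℓ)) = e at *
    have e1 : 4 * (16 * (2 * (N ^ 2 * e) + c ^ 2 / 2) * (32 * ℓ)) +
        2 * ((4 * e + 4 * c) * (16 * ℓ) + 2 * c * (32 * ℓ)) =
        (4096 * N ^ 2 + 128) * ℓ * e + 1024 * (c ^ 2 * ℓ) + 256 * (c * ℓ) := by ring
    rw [e1]
    linarith
  have hTT := mul_le_mul_of_nonneg_left hT (show 0 ≤ 2 ^ q * (s * s) by positivity)
  have e2 : 2 ^ q * Real.exp (-ℓ) ^ q * (Real.pi * Real.exp ℓ ^ 2) =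
      2 ^ q * Real.pi * (s * s) := by
    rw [← emr]
    ring
  rw [em, e2, eQ] at hmain
  rw [eQ]
  linarith

section complexMap

variable {u : ℂ → ℂ}

theorem re_fderiv_apply (hu : ContDiff ℝ (⊤ : ℕ∞) u) (z v : ℂ) :
    (fderiv ℝ u z v).re = fderiv ℝ (fun w => (u w).re) z v := by
  have h := Complex.reCLM.hasFDerivAt.comp z
    (hu.differentiable (by simp) z).hasFDerivAt
  have h2 : fderiv ℝ (fun w => (u w).re) z = _ := h.fderiv
  rw [h2]
  rfl

theorem im_fderiv_apply (hu : ContDiff ℝ (⊤ : ℕ∞) u) (z v : ℂ) :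
    (fderiv ℝ u z v).im = fderiv ℝ (fun w => (u w).im) z v := by
  have h := Complex.imCLM.hasFDerivAt.comp z
    (hu.differentiable (by simp) z).hasFDerivAt
  have h2 : fderiv ℝ (fun w => (u w).im) z = _ := h.fderiv
  rw [h2]
  rfl

theorem contDiff_pd1 (hu : ContDiff ℝ (⊤ : ℕ∞) u) : ContDiff ℝ (⊤ : ℕ∞) (pd1 u) :=
  (hu.fderiv_right (m := (⊤ : ℕ∞)) (by simp)).clm_apply contDiff_const

theorem contDiff_pd2 (hu : ContDiff ℝ (⊤ : ℕ∞) u) : ContDiff ℝ (⊤ : ℕ∞) (pd2 u) :=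
  (hu.fderiv_right (m := (⊤ : ℕ∞)) (by simp)).clm_apply contDiff_const

theorem re_pd1 (hu : ContDiff ℝ (⊤ : ℕ∞) u) (z : ℂ) :
    (pd1 u z).re = dX (fun w => (u w).re) z := re_fderiv_apply hu z 1

theorem im_pd1 (hu : ContDiff ℝ (⊤ : ℕ∞) u) (z : ℂ) :
    (pd1 u z).im = dX (fun w => (u w).im) z := im_fderiv_apply hu z 1

theorem re_pd2 (hu : ContDiff ℝ (⊤ : ℕ∞) u) (z : ℂ) :
    (pd2 u z).re = dY (fun w => (u w).re) z := re_fderiv_apply hu z Complex.I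

theorem im_pd2 (hu : ContDiff ℝ (⊤ : ℕ∞) u) (z : ℂ) :
    (pd2 u z).im = dY (fun w => (u w).im) z := im_fderiv_apply hu z Complex.I

theorem re_lap (hu : ContDiff ℝ (⊤ : ℕ∞) u) (z : ℂ) : (lap u z).re =
    dX (dX fun w => (u w).re) z + dY (dY fun w => (u w).re) z := by
  rw [lap, Complex.add_re, re_fderiv_apply (contDiff_pd1 hu), re_fderiv_apply (contDiff_pd2 hu)]
  simp only [re_pd1 hu, re_pd2 hu]
  rfl

theorem im_lap (hu : ContDiff ℝ (⊤ : ℕ∞) u) (z : ℂ) : (lap u z).im =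
    dX (dX fun w => (u w).im) z + dY (dY fun w => (u w).im) z := by
  rw [lap, Complex.add_im, im_fderiv_apply (contDiff_pd1 hu), im_fderiv_apply (contDiff_pd2 hu)]
  simp only [im_pd1 hu, im_pd2 hu]
  rfl

theorem energyDensity_eq_enD (hu : ContDiff ℝ (⊤ : ℕ∞) u) (z : ℂ) :
    energyDensity u z = enD (fun w => (u w).re) (fun w => (u w).im) z := by
  rw [energyDensity, gradSq, norm_sq_eq_re_im, norm_sq_eq_re_im, norm_sq_eq_re_im, re_pd1 hu,
    im_pd1 hu, re_pd2 hu, im_pd2 hu, enD, gsq, msq]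
  ring

theorem momDensity_eq_momY (hu : ContDiff ℝ (⊤ : ℕ∞) u) :
    momDensity u = momY (fun w => (u w).re) (fun w => (u w).im) := by
  funext z
  rw [momDensity, momY, ← re_pd2 hu, ← im_pd2 hu]
  simp
  ring

theorem norm_fderiv_le_sqrt_gsq (hu : ContDiff ℝ (⊤ : ℕ∞) u) (z : ℂ) :
    ‖fderiv ℝ u z‖ ≤ √(gsq (fun w => (u w).re) (fun w => (u w).im) z) := by
  refine ContinuousLinearMap.opNorm_le_bound _ (Real.sqrt_nonneg _) fun v => ?_
  have hv : ‖v‖ = √(v.re ^ 2 + v.im ^ 2) := by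
    rw [← norm_sq_eq_re_im, Real.sqrt_sq (norm_nonneg _)]
  have hl : ‖fderiv ℝ u z v‖ =
      √((fderiv ℝ u z v).re ^ 2 + (fderiv ℝ u z v).im ^ 2) := by
    rw [← norm_sq_eq_re_im, Real.sqrt_sq (norm_nonneg _)]
  rw [hv, hl, ← Real.sqrt_mul (gsq_nonneg z), re_fderiv_apply hu, im_fderiv_apply hu,
    fderiv_real_apply, fderiv_real_apply]
  refine Real.sqrt_le_sqrt ?_
  rw [gsq]
  nlinarith [sq_nonneg (v.im * dX (fun w => (u w).re) z - v.re * dY (fun w => (u w).re) z),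
    sq_nonneg (v.im * dX (fun w => (u w).im) z - v.re * dY (fun w => (u w).im) z)]

theorem integrable_enD_of_energy_lt_top (hu : memE u) :
    Integrable (enD (fun w => (u w).re) (fun w => (u w).im)) ∧
      ∫ z, enD (fun w => (u w).re) (fun w => (u w).im) z = Efun u := by
  have ha : ContDiff ℝ (⊤ : ℕ∞) (fun w => (u w).re) := Complex.reCLM.contDiff.comp hu.1
  have hb : ContDiff ℝ (⊤ : ℕ∞) (fun w => (u w).im) := Complex.imCLM.contDiff.comp hu.1
  have hm := (contDiff_enD ha hb).continuous.aestronglyMeasurable (μ := volume)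
  have h1 : energy u =
      ∫⁻ z, ENNReal.ofReal (enD (fun w => (u w).re) (fun w => (u w).im) z) := by
    rw [energy]
    simp only [energyDensity_eq_enD hu.1]
  have h0 : 0 ≤ᵐ[volume] enD (fun w => (u w).re) (fun w => (u w).im) :=
    ae_of_all _ fun z => enD_nonneg _ _ z
  refine ⟨⟨hm, ?_⟩, ?_⟩
  · rw [hasFiniteIntegral_iff_ofReal h0, ← h1]
    exact hu.2
  · rw [integral_eq_lintegral_of_nonneg_ae h0 hm, ← h1]
    rfl

theorem isWave_of_TW {c : ℝ} (hu : memE u) (hTW : TW c u) :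
    IsWave (fun w => (u w).re) (fun w => (u w).im) c := by
  have ha : ContDiff ℝ (⊤ : ℕ∞) (fun w => (u w).re) := Complex.reCLM.contDiff.comp hu.1
  have hb : ContDiff ℝ (⊤ : ℕ∞) (fun w => (u w).im) := Complex.imCLM.contDiff.comp hu.1
  have hE := (integrable_enD_of_energy_lt_top hu).1
  refine ⟨ha, hb, fun z => ?_, fun z => ?_, ?_, ?_⟩
  · have h := congrArg Complex.re (hTW z)
    rw [norm_sq_eq_re_im] at h
    simp only [Complex.sub_re, Complex.neg_re, Complex.mul_re,
      Complex.I_re, Complex.I_im, Complex.ofReal_re, Complex.ofReal_im, Complex.mul_im,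
      Complex.zero_re, re_lap hu.1, re_pd2 hu.1, im_pd2 hu.1] at h
    rw [msq]
    linarith
  · have h := congrArg Complex.im (hTW z)
    rw [norm_sq_eq_re_im] at h
    simp only [Complex.sub_im, Complex.neg_im, Complex.mul_re,
      Complex.I_re, Complex.I_im, Complex.ofReal_re, Complex.ofReal_im, Complex.mul_im,
      Complex.zero_im, im_lap hu.1, re_pd2 hu.1, im_pd2 hu.1] at h
    rw [msq]
    linarith
  · refine (hE.const_mul 2).mono' (contDiff_gsq ha hb).continuous.aestronglyMeasurable
      (ae_of_all _ fun z => ?_)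
    rw [Real.norm_of_nonneg (gsq_nonneg z), enD]
    nlinarith [sq_nonneg (1 - msq (fun w => (u w).re) (fun w => (u w).im) z)]
  · have hW := contDiff_msq ha hb
    refine (hE.const_mul 4).mono' (Continuous.aestronglyMeasurable
      (by have := hW.continuous; fun_prop)) (ae_of_all _ fun z => ?_)
    rw [Real.norm_of_nonneg (sq_nonneg _), enD]
    nlinarith [gsq_nonneg (a := fun w => (u w).re) (b := fun w => (u w).im) z]

theorem speed_mul_momentum_le {c : ℝ} (hu : memE u) (hTW : TW c u) (hm : momInt u) :
    c * P2 u ≤ Efun u := by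
  have hw := isWave_of_TW hu hTW
  obtain ⟨hEi, hE⟩ := integrable_enD_of_energy_lt_top hu
  have hmi : Integrable (momY (fun w => (u w).re) (fun w => (u w).im)) := by
    rw [← momDensity_eq_momY hu.1]
    exact hm
  have hp := hw.pohozaev hmi
  rw [integral_add hw.integrable_stressXX (hmi.const_mul _), integral_const_mul] at hp
  have h1 : -∫ z, stressXX (fun w => (u w).re) (fun w => (u w).im) z ≤ Efun u := by
    rw [← hE, ← integral_neg]
    refine integral_mono hw.integrable_stressXX.neg hEi fun z => ?_
    rw [stressXX, enD, gsq]
    linarith [sq_nonneg (dX (fun w => (u w).re) z), sq_nonneg (dX (fun w => (u w).im) z)]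
  rw [P2, momDensity_eq_momY hu.1]
  linarith

end complexMap

/-- local `W^{1,p}` bound at scale `𝔭`. -/
theorem local_W1p_bound (Λ₀ : ℝ) (hΛ₀ : 0 < Λ₀) (q : ℝ) (hq1 : 1 ≤ q) (hq2 : q < 2) :
    ∃ C p₀ : ℝ, 0 < C ∧ 0 < p₀ ∧
      ∀ (u : ℂ → ℂ) (p c : ℝ), QuasiMin Λ₀ u p c → p₀ ≤ p →
        ∀ X : ℂ, (∫ z in Metric.ball X p, ‖fderiv ℝ u z‖ ^ q) ≤ C * p ^ (2 - q) := by
  obtain ⟨L, hL, hLip⟩ := exists_gsq_le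
  obtain ⟨K, hK, hev⟩ := exists_integral_sqrt_gsq_rpow_le hL hq1 hq2
  have hev2 := (tendsto_pow_mul_exp_neg_mul 8 1 one_pos).eventually
    (ge_mem_nhds (show (0 : ℝ) < 1 by norm_num))
  obtain ⟨ℓ₀, hℓ₀⟩ := (hev.and (hev2.and (eventually_ge_atTop Λ₀))).exists_forall_of_atTop
  refine ⟨K, Real.exp ℓ₀, hK, Real.exp_pos _, fun u p c hu hp X => ?_⟩
  obtain ⟨hE, -, hc, hTW, hm, hP, hEle⟩ := hu
  have hp0 : 0 < p := (Real.exp_pos _).trans_le hp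
  set ℓ := Real.log p with hℓ
  have hpℓ : p = Real.exp ℓ := (Real.exp_log hp0).symm
  obtain ⟨hmain, hsmall, hΛ⟩ := hℓ₀ ℓ ((Real.le_log_iff_exp_le hp0).2 hp)
  rw [pow_one, one_mul] at hsmall
  have hE8 : Efun u ≤ 8 * ℓ := by
    have := Real.pi_lt_d2
    nlinarith
  have hcs : c ≤ 8 * ℓ * Real.exp (-ℓ) := by
    have h1 := speed_mul_momentum_le hE hTW hm
    rw [Real.exp_neg, ← hpℓ, ← div_eq_mul_inv, le_div_iff₀ hp0, ← hP]
    exact h1.trans hE8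
  have hc1 : |c| ≤ 1 := by
    rw [abs_of_pos hc]
    linarith
  have hw := isWave_of_TW hE hTW
  have hW : ∀ z, msq (fun w => (u w).re) (fun w => (u w).im) z ≤ 2 := fun z => by
    have h1 := hw.msq_le hc.ne' z
    have h2 : c ^ 2 ≤ 1 := (sq_le_one_iff_abs_le_one c).2 hc1
    linarith
  have hs : IsSlowWave L ℓ (fun w => (u w).re) (fun w => (u w).im) c :=
    ⟨hw, hc, hcs, hW, hLip _ _ _ hw hc1 hW, (integrable_enD_of_energy_lt_top hE).2.trans_le hE8⟩
  have hfin := hmain _ _ _ hs X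
  rw [← hpℓ] at hfin
  refine le_trans (integral_mono_of_nonneg (ae_of_all _ fun z => by positivity) ?_
    (ae_of_all _ fun z => Real.rpow_le_rpow (norm_nonneg _) (norm_fderiv_le_sqrt_gsq hE.1 z)
      (by linarith))) hfin
  have hcont : Continuous fun z =>
      √(gsq (fun w => (u w).re) (fun w => (u w).im) z) ^ q :=
    Continuous.rpow_const
      (by have := (contDiff_gsq hw.smooth_re hw.smooth_im).continuous; fun_prop)
      fun z => Or.inr (by linarith)
  exact (hcont.continuousOn.integrableOn_compact (isCompact_closedBall X p)).mono_set
    ball_subset_closedBall
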